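/- For every n ≥ 1, the rational group cohomology of Sp_{2n}(ℤ) vanishes in its virtual cohomological dimension: H^{n²}(Sp_{2n}(ℤ); ℚ) = 0. (Gunnells; Brück–Patzt–Sroka) -/

import Mathlib

namespace SpTop

section ListChains

variable {A B : Type*}

/-- Boundary of a list in the augmented complex of ordered chains. -/
noncomputable def bdl : List A → (List A →₀ ℚ)
  | [] => 0
  | a :: l => Finsupp.single l 1 - (bdl l).mapDomain (List.cons a)

/-- The boundary operator on list chains. -/
noncomputable def bd : (List A →₀ ℚ) →ₗ[ℚ] (List A →₀ ℚ) :=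
  Finsupp.linearCombination ℚ bdl

/-- Evaluation of a cochain on chains. -/
noncomputable def ev (f : List A → ℚ) : (List A →₀ ℚ) →ₗ[ℚ] ℚ :=
  Finsupp.linearCombination ℚ f

/-- Coboundary of a cochain. -/
noncomputable def cob (f : List A → ℚ) (l : List A) : ℚ := ev f (bdl l)

/-- Joining a vertex to a chain. -/
noncomputable def cn (a : A) : (List A →₀ ℚ) →ₗ[ℚ] (List A →₀ ℚ) :=
  Finsupp.lmapDomain ℚ ℚ (List.cons a)

/-- The chain map induced by a vertex map. -/
noncomputable def mp (r : A → B) : (List A →₀ ℚ) →ₗ[ℚ] (List B →₀ ℚ) :=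
  Finsupp.lmapDomain ℚ ℚ (List.map r)

@[simp] lemma bd_single (l : List A) (c : ℚ) : bd (Finsupp.single l c) = c • bdl l := by
  simp [bd]

@[simp] lemma ev_single (f : List A → ℚ) (l : List A) (c : ℚ) :
    ev f (Finsupp.single l c) = c * f l := by
  simp [ev]

@[simp] lemma cn_single (a : A) (l : List A) (c : ℚ) :
    cn a (Finsupp.single l c) = Finsupp.single (a :: l) c := by
  simp [cn]

@[simp] lemma mp_single (r : A → B) (l : List A) (c : ℚ) :
    mp r (Finsupp.single l c) = Finsupp.single (l.map r) c := by
  simp [mp]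

@[simp] lemma bdl_nil : bdl ([] : List A) = 0 := rfl

lemma bdl_cons (a : A) (l : List A) : bdl (a :: l) = Finsupp.single l 1 - cn a (bdl l) := rfl

lemma bd_cn (a : A) (z : List A →₀ ℚ) : bd (cn a z) = z - cn a (bd z) := by
  induction z using Finsupp.induction_linear with
  | zero => simp
  | add x y hx hy => simp only [map_add, hx, hy]; abel
  | single l c => simp [bdl_cons, smul_sub]

lemma bd_bdl (l : List A) : bd (bdl l) = 0 := by
  induction l with
  | nil => simp
  | cons a l ih => rw [bdl_cons, map_sub, bd_cn, ih]; simp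

@[simp] lemma bd_bd (z : List A →₀ ℚ) : bd (bd z) = 0 := by
  induction z using Finsupp.induction_linear with
  | zero => simp
  | add x y hx hy => simp [hx, hy]
  | single l c => simp [bd_bdl]

lemma ev_cn (f : List A → ℚ) (a : A) (z : List A →₀ ℚ) :
    ev f (cn a z) = ev (fun m => f (a :: m)) z := by
  induction z using Finsupp.induction_linear with
  | zero => simp
  | add x y hx hy => simp [hx, hy]
  | single l c => simp

lemma ev_mp (f : List B → ℚ) (r : A → B) (z : List A →₀ ℚ) :
    ev f (mp r z) = ev (fun m => f (m.map r)) z := by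
  induction z using Finsupp.induction_linear with
  | zero => simp
  | add x y hx hy => simp [hx, hy]
  | single l c => simp

@[simp] lemma cob_nil (f : List A → ℚ) : cob f [] = 0 := by simp [cob]

lemma cob_cons (f : List A → ℚ) (a : A) (l : List A) :
    cob f (a :: l) = f l - cob (fun m => f (a :: m)) l := by
  simp [cob, bdl_cons, ev_cn]

lemma ev_bd (f : List A → ℚ) (z : List A →₀ ℚ) : ev f (bd z) = ev (cob f) z := by
  induction z using Finsupp.induction_linear with
  | zero => simp
  | add x y hx hy => simp [hx, hy]
  | single l c => simp [cob]

lemma cob_cob (f : List A → ℚ) (l : List A) : cob (cob f) l = 0 := by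
  rw [cob, ← ev_bd, bd_bdl, map_zero]

lemma ev_add (f g : List A → ℚ) (z : List A →₀ ℚ) : ev (f + g) z = ev f z + ev g z := by
  simp only [ev, Finsupp.linearCombination_apply, Finsupp.sum, Pi.add_apply, smul_eq_mul,
    mul_add, Finset.sum_add_distrib]

lemma ev_smul (c : ℚ) (f : List A → ℚ) (z : List A →₀ ℚ) : ev (c • f) z = c * ev f z := by
  simp only [ev, Finsupp.linearCombination_apply, Finsupp.sum, Pi.smul_apply, smul_eq_mul,
    Finset.mul_sum]
  exact Finset.sum_congr rfl fun _ _ => by ring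

lemma ev_sub (f g : List A → ℚ) (z : List A →₀ ℚ) : ev (f - g) z = ev f z - ev g z := by
  rw [sub_eq_add_neg, ev_add, ← neg_one_smul ℚ g, ev_smul]; ring

lemma ev_zero (z : List A →₀ ℚ) : ev (0 : List A → ℚ) z = 0 := by
  simpa using ev_smul 0 (0 : List A → ℚ) z

lemma cob_add (f g : List A → ℚ) (l : List A) : cob (f + g) l = cob f l + cob g l := ev_add ..

lemma cob_sub (f g : List A → ℚ) (l : List A) : cob (f - g) l = cob f l - cob g l := ev_sub ..

lemma cob_smul (c : ℚ) (f : List A → ℚ) (l : List A) : cob (c • f) l = c * cob f l := ev_smul ..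

lemma cob_zero (l : List A) : cob (0 : List A → ℚ) l = 0 := ev_zero _

lemma cob_congr {f g : List A → ℚ} {l : List A}
    (h : ∀ l', l'.Sublist l → l'.length + 1 = l.length → f l' = g l') : cob f l = cob g l := by
  induction l generalizing f g with
  | nil => simp
  | cons a l ih =>
    rw [cob_cons, cob_cons, h l (List.sublist_cons_self a l) (by simp),
      ih fun l' h1 h2 => h (a :: l') (h1.cons_cons a) (by simpa using h2)]

lemma cob_eq_zero {f : List A → ℚ} {l : List A}
    (h : ∀ l', l'.Sublist l → l'.length + 1 = l.length → f l' = 0) : cob f l = 0 := by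
  rw [cob_congr (g := 0) h, cob_zero]

lemma mem_bdl {l l' : List A} (h : l' ∈ (bdl l).support) :
    l'.Sublist l ∧ l'.length + 1 = l.length := by
  classical
  by_contra hn
  have h1 : cob (Pi.single l' 1) l = 0 := cob_eq_zero fun m h1 h2 => by
    rw [Pi.single_apply, if_neg]; rintro rfl; exact hn ⟨h1, h2⟩
  have h2 : ∀ z : List A →₀ ℚ, ev (Pi.single l' 1) z = z l' := fun z => by
    induction z using Finsupp.induction_linear with
    | zero => simp
    | add x y hx hy => simp [hx, hy]
    | single m c => simp [Pi.single_apply, Finsupp.single_apply]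
  rw [cob, h2] at h1
  exact (Finsupp.mem_support_iff.1 h) h1

lemma mp_cn (r : A → B) (a : A) (z : List A →₀ ℚ) : mp r (cn a z) = cn (r a) (mp r z) := by
  induction z using Finsupp.induction_linear with
  | zero => simp
  | add x y hx hy => simp [hx, hy]
  | single l c => simp

lemma mp_bdl (r : A → B) (l : List A) : mp r (bdl l) = bdl (l.map r) := by
  induction l with
  | nil => simp
  | cons a l ih => simp [bdl_cons, mp_cn, ih]

lemma mp_bd (r : A → B) (z : List A →₀ ℚ) : mp r (bd z) = bd (mp r z) := by
  induction z using Finsupp.induction_linear with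
  | zero => simp
  | add x y hx hy => simp [hx, hy]
  | single l c => simp [mp_bdl]

lemma cob_map (f : List B → ℚ) (r : A → B) (l : List A) :
    cob (fun m => f (m.map r)) l = cob f (l.map r) := by
  rw [cob, cob, ← ev_mp, mp_bdl]

/-- Alternating cochains. -/
def Alt (f : List A → ℚ) : Prop :=
  ∀ l₁ a b l₂, f (l₁ ++ a :: b :: l₂) = -f (l₁ ++ b :: a :: l₂)

lemma Alt.cons {f : List A → ℚ} (h : Alt f) (a : A) : Alt fun m => f (a :: m) :=
  fun l₁ b c l₂ => h (a :: l₁) b c l₂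

lemma Alt.cob {f : List A → ℚ} (h : Alt f) : Alt (cob f) := by
  intro l₁ a b l₂
  induction l₁ generalizing f with
  | nil =>
    simp only [List.nil_append, cob_cons]
    have : SpTop.cob (fun m => f (a :: b :: m)) l₂ = -SpTop.cob (fun m => f (b :: a :: m)) l₂ := by
      have := cob_smul (-1) (fun m => f (b :: a :: m)) l₂
      rw [neg_one_mul] at this
      rw [← this]
      exact cob_congr fun m _ _ => by simpa using h [] a b m
    rw [this]; ring
  | cons c l₁ ih =>
    simp only [List.cons_append, cob_cons]
    rw [h l₁ a b l₂, ih (h.cons c)]; ring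

lemma Alt.add {f g : List A → ℚ} (hf : Alt f) (hg : Alt g) : Alt (f + g) := fun l₁ a b l₂ => by
  simp only [Pi.add_apply, hf l₁ a b l₂, hg l₁ a b l₂]; ring

lemma Alt.smul {f : List A → ℚ} (hf : Alt f) (c : ℚ) : Alt (c • f) := fun l₁ a b l₂ => by
  simp only [Pi.smul_apply, hf l₁ a b l₂, smul_neg]

lemma Alt.zero : Alt (0 : List A → ℚ) := fun _ _ _ _ => by simp

lemma Alt.sub {f g : List A → ℚ} (hf : Alt f) (hg : Alt g) : Alt (f - g) := fun l₁ a b l₂ => by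
  simp only [Pi.sub_apply, hf l₁ a b l₂, hg l₁ a b l₂]; ring

lemma Alt.perm {f : List A → ℚ} (hf : Alt f) {l l' : List A} (h : l.Perm l') :
    f l = f l' ∨ f l = -f l' := by
  induction h generalizing f with
  | nil => simp
  | cons a _ ih => exact ih (hf.cons a)
  | swap a b l => exact Or.inr (hf [] b a l)
  | trans _ _ ih1 ih2 =>
    rcases ih1 hf with h1 | h1 <;> rcases ih2 hf with h2 | h2 <;> simp [h1, h2]

lemma Alt.nodup {f : List A → ℚ} (hf : Alt f) {l : List A} (h : f l ≠ 0) : l.Nodup := by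
  classical
  by_contra hn
  obtain ⟨a, ha⟩ := List.exists_duplicate_iff_not_nodup.2 hn
  obtain ⟨l', hl'⟩ : ∃ l', l.Perm (a :: a :: l') := by
    have h2 := List.duplicate_iff_sublist.1 ha
    obtain ⟨m, hm⟩ := h2.exists_perm_append
    exact ⟨m, hm⟩
  have h0 : f (a :: a :: l') = 0 := by
    have := hf [] a a l'
    simp only [List.nil_append] at this
    linarith
  rcases hf.perm hl' with h1 | h1 <;> simp [h0] at h1 <;> exact h h1

/-- Multiplying by the indicator of a permutation invariant set preserves alternation. -/
lemma Alt.ite {f g : List A → ℚ} (hf : Alt f) (hg : Alt g) {P : List A → Prop} [DecidablePred P]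
    (hP : ∀ l l' : List A, l.Perm l' → P l → P l') : Alt fun l => if P l then f l else g l := by
  intro l₁ a b l₂
  have hp : (l₁ ++ a :: b :: l₂).Perm (l₁ ++ b :: a :: l₂) :=
    (List.Perm.swap b a l₂).append_left l₁
  have : P (l₁ ++ a :: b :: l₂) ↔ P (l₁ ++ b :: a :: l₂) := ⟨hP _ _ hp, hP _ _ hp.symm⟩
  simp only [this]
  split_ifs
  · exact hf ..
  · exact hg ..

end ListChains

end SpTop

namespace SpTop

section Sweep

variable {Y : Type*}

/-- Finitely supported cochains of list length `k`; when `c` holds they are moreover reduced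
(they vanish on the empty list) and alternating. -/
structure Adm (c : Prop) (k : ℤ) (f : List Y → ℚ) : Prop where
  fin : (Function.support f).Finite
  len : ∀ l, f l ≠ 0 → (l.length : ℤ) = k
  nil : c → f [] = 0
  alt : c → Alt f

lemma Adm.zero (c : Prop) (k : ℤ) : Adm c k (0 : List Y → ℚ) :=
  ⟨by simp, by simp, by simp, fun _ => Alt.zero⟩

lemma Adm.add {c : Prop} {k : ℤ} {f g : List Y → ℚ} (hf : Adm c k f) (hg : Adm c k g) :
    Adm c k (f + g) := by
  refine ⟨(hf.fin.union hg.fin).subset (Function.support_add f g), fun l h => ?_,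
    fun h => by simp [hf.nil h, hg.nil h], fun h => (hf.alt h).add (hg.alt h)⟩
  by_cases h1 : f l = 0
  · exact hg.len l fun h2 => h (by simp [h1, h2])
  · exact hf.len l h1

lemma Adm.smul {c : Prop} {k : ℤ} {f : List Y → ℚ} (hf : Adm c k f) (r : ℚ) :
    Adm c k (r • f) :=
  ⟨hf.fin.subset (Function.support_const_smul_subset r f),
    fun l h => hf.len l fun h2 => h (by simp [h2]),
    fun h => by simp [hf.nil h], fun h => (hf.alt h).smul r⟩

lemma Adm.sub {c : Prop} {k : ℤ} {f g : List Y → ℚ} (hf : Adm c k f) (hg : Adm c k g) :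
    Adm c k (f - g) := by
  have := hf.add (hg.smul (-1))
  rwa [neg_one_smul, ← sub_eq_add_neg] at this

lemma Adm.ite {c : Prop} {k : ℤ} {f g : List Y → ℚ} (hf : Adm c k f) (hg : Adm c k g)
    {P : List Y → Prop} [DecidablePred P] (hP : ∀ l l' : List Y, l.Perm l' → P l → P l') :
    Adm c k fun l => if P l then f l else g l := by
  refine ⟨(hf.fin.union hg.fin).subset fun l h => ?_, fun l h => ?_, fun h => ?_,
    fun h => (hf.alt h).ite (hg.alt h) hP⟩
  · by_cases h1 : P l
    · left; simpa [h1] using h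
    · right; simpa [h1] using h
  · by_cases h1 : P l
    · exact hf.len l (by simpa [h1] using h)
    · exact hg.len l (by simpa [h1] using h)
  · simp [hf.nil h, hg.nil h]

/-- Families of lists closed under faces (possibly excluding the empty list), under permutations,
and with finite stars. -/
structure Cplx (c : Prop) (N : Set (List Y)) : Prop where
  face : ∀ l ∈ N, ∀ l' : List Y, l'.Sublist l → l' ∈ N ∨ (c ∧ l' = [])
  perm : ∀ l l' : List Y, l.Perm l' → l ∈ N → l' ∈ N
  star : ∀ g : List Y → ℚ, (Function.support g).Finite → (c → g [] = 0) →
    {l ∈ N | cob g l ≠ 0}.Finite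

lemma Cplx.cob_congr {c : Prop} {N : Set (List Y)} (hN : Cplx c N) {f g : List Y → ℚ}
    (hf : c → f [] = 0) (hg : c → g [] = 0) {l : List Y} (hl : l ∈ N)
    (h : ∀ l' ∈ N, l'.Sublist l → f l' = g l') : cob f l = cob g l := by
  refine SpTop.cob_congr fun l' h1 _ => ?_
  rcases hN.face l hl l' h1 with h3 | ⟨h3, rfl⟩
  · exact h l' h3 h1
  · rw [hf h3, hg h3]

open Classical in
/-- The coboundary cut off outside of a complex. -/
lemma Cplx.adm_cob {c : Prop} {N : Set (List Y)} (hN : Cplx c N) {k : ℤ} {g : List Y → ℚ}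
    (hg : Adm c k g) : Adm c (k + 1) fun l => if l ∈ N then cob g l else 0 := by
  refine ⟨(hN.star g hg.fin hg.nil).subset fun l h => ?_, fun l h => ?_, fun h => by simp,
    fun h => (hg.alt h).cob.ite Alt.zero hN.perm⟩
  · by_contra hc
    simp only [Set.mem_ofPred_eq, not_and, not_not] at hc
    simp only [Function.mem_support] at h
    split_ifs at h with h1
    · exact h (hc h1)
    · exact h rfl
  · have h1 : cob g l ≠ 0 := by
      split_ifs at h with h1
      · exact h
      · exact absurd rfl h
    by_contra hc
    refine h1 (cob_eq_zero fun l' h2 h3 => ?_)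
    by_contra h4
    have := hg.len l' h4
    omega

open Classical in
/-- **Sweeping.** If a cochain is a cocycle above level `a` and the slices have at most one
cohomology class, which locally extends over slabs, then it is a coboundary above level `a`. -/
theorem sweep {c : Prop} {N : Set (List Y)} (hN : Cplx c N) (m M : List Y → ℝ)
    (hmM : ∀ l ∈ N, m l ≤ M l)
    (hmono : ∀ l ∈ N, ∀ l' ∈ N, l'.Sublist l → m l' ≤ m l ∧ M l ≤ M l')
    (hperm : ∀ l ∈ N, ∀ l' : List Y, l.Perm l' → M l = M l') (a : ℝ)
    (H : ∀ t ≥ a, (∃ l ∈ N, t ≤ M l) → ∃ b > t, ∀ k : ℤ, ∃ U, Adm c k U ∧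
      (∀ l ∈ N, m l ≤ b → t ≤ M l → cob U l = 0) ∧ ∀ s, t ≤ s → s ≤ b →
        (∀ f, Adm c k f → (∀ l ∈ N, m l ≤ s → s ≤ M l → cob f l = 0) →
          ∃ r : ℚ, ∃ g, Adm c (k - 1) g ∧ ∀ l ∈ N, m l ≤ s → s ≤ M l → f l = r * U l + cob g l) ∧
        (U = 0 ∨ ¬ ∃ g, Adm c (k - 1) g ∧ ∀ l ∈ N, m l ≤ s → s ≤ M l → U l = cob g l))
    (k : ℤ) (f : List Y → ℚ) (hf : Adm c k f) (hcoc : ∀ l ∈ N, a ≤ M l → cob f l = 0) :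
    ∃ g, Adm c (k - 1) g ∧ ∀ l ∈ N, a ≤ M l → f l = cob g l := by
  set T : Set ℝ := {t | a ≤ t ∧ ∃ g, Adm c (k - 1) g ∧ ∀ l ∈ N, t ≤ M l → f l = cob g l} with hT
  suffices a ∈ T from this.2
  have hne : T.Nonempty := by
    obtain ⟨B, hB⟩ := (hf.fin.image M).bddAbove
    refine ⟨max a (B + 1), le_max_left _ _, 0, Adm.zero _ _, fun l hl h => ?_⟩
    rw [cob_zero]
    by_contra h0
    have := hB ⟨l, h0, rfl⟩
    have := (le_max_right a (B + 1)).trans h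
    linarith
  have hbdd : BddBelow T := ⟨a, fun t ht => ht.1⟩
  set t := sInf T with ht
  have hat : a ≤ t := le_csInf hne fun t ht => ht.1
  have htT : t ∈ T := by
    by_contra hnt
    have hex : ∃ l ∈ N, t ≤ M l := by
      by_contra hc
      push Not at hc
      exact hnt ⟨hat, 0, Adm.zero _ _, fun l hl h => absurd h (not_le.2 (hc l hl))⟩
    obtain ⟨b, hb, HU⟩ := H t hat hex
    obtain ⟨U, hU, hUc, hUs⟩ := HU k
    obtain ⟨r, h, hh, hfh⟩ := (hUs t le_rfl hb.le).1 f hf fun l hl _ h2 => hcoc l hl (hat.trans h2)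
    have hfin : {l ∈ N | t ≤ M l ∧ f l ≠ r * U l + cob h l}.Finite := by
      refine ((hf.fin.union hU.fin).union (hN.star h hh.fin hh.nil)).subset ?_
      rintro l ⟨hl, -, h2⟩
      by_contra hc
      simp only [Set.mem_union, Function.mem_support, not_or, not_not, Set.mem_ofPred_eq,
        not_and] at hc
      exact h2 (by rw [hc.1.1, hc.1.2, hc.2 hl]; ring)
    obtain ⟨s, hts, hsb, hs⟩ : ∃ s, t < s ∧ s ≤ b ∧
        ∀ l ∈ N, m l ≤ s → t ≤ M l → f l = r * U l + cob h l := by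
      have : ∀ᶠ s in nhdsWithin t (Set.Ioi t),
          ∀ l ∈ {l ∈ N | t ≤ M l ∧ f l ≠ r * U l + cob h l}, s < m l := by
        rw [Filter.eventually_all_finite hfin]
        rintro l ⟨hl, h1, h2⟩
        have : t < m l := by
          by_contra h3
          exact h2 (hfh l hl (not_lt.1 h3) h1)
        exact nhdsWithin_le_nhds (eventually_lt_nhds this)
      obtain ⟨s, hs1, hs2, hs3⟩ := (this.and (Ioc_mem_nhdsGT hb)).exists
      refine ⟨s, hs2, hs3, fun l hl h1 h2 => ?_⟩
      by_contra h3
      exact absurd h1 (not_le.2 (hs1 l ⟨hl, h2, h3⟩))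
    obtain ⟨t₁, ht₁T, ht₁s⟩ := exists_lt_of_csInf_lt hne hts
    have htt₁ : t ≤ t₁ := csInf_le hbdd ht₁T
    obtain ⟨hat₁, g, hg, hfg⟩ := ht₁T
    have hrU : ∀ l, r * U l = 0 := by
      intro l
      rcases (hUs t₁ htt₁ (ht₁s.le.trans hsb)).2 with h0 | h0
      · simp [h0]
      · rcases eq_or_ne r 0 with hr | hr
        · simp [hr]
        · refine absurd ⟨r⁻¹ • (g - h), (hg.sub hh).smul _, fun l hl h1 h2 => ?_⟩ h0
          rw [cob_smul, cob_sub, ← hfg l hl h2, hs l hl (h1.trans ht₁s.le) (htt₁.trans h2)]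
          field_simp
          ring
    obtain ⟨U', hU', hUc', hUs'⟩ := HU (k - 1)
    obtain ⟨r', e, he, hge⟩ := (hUs' t₁ htt₁ (ht₁s.le.trans hsb)).1 (g - h) (hg.sub hh)
      fun l hl h1 h2 => by
        rw [cob_sub, ← hfg l hl h2, hs l hl (h1.trans ht₁s.le) (htt₁.trans h2), hrU]; ring
    have hce := hN.adm_cob he
    rw [sub_add_cancel] at hce
    set ce : List Y → ℚ := fun l => if l ∈ N then cob e l else 0 with hce'
    have hcee : ∀ l ∈ N, ce l = cob e l := fun l hl => by simp [hce', hl]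
    set G : List Y → ℚ := fun l => if l ∈ N ∧ t₁ ≤ M l then (g - ce) l else (h + r' • U') l
    have hG : Adm c (k - 1) G := (hg.sub hce).ite (P := fun l => l ∈ N ∧ t₁ ≤ M l)
      (hh.add (hU'.smul r')) fun l l' hp hl => ⟨hN.perm l l' hp hl.1, (hperm l hl.1 l' hp) ▸ hl.2⟩
    refine hnt ⟨hat, G, hG, fun l hl htl => ?_⟩
    have hcce : cob ce l = 0 := by
      rw [← cob_cob e l]
      exact hN.cob_congr hce.nil (fun _ => by simp) hl fun l' hl' _ => hcee l' hl'
    by_cases h1 : t₁ ≤ M l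
    · have : cob G l = cob (g - ce) l := hN.cob_congr hG.nil (hg.sub hce).nil hl
        fun l' hl' hs' => by
          simp only [G]
          rw [if_pos ⟨hl', h1.trans (hmono l hl l' hl' hs').2⟩]
      rw [this, cob_sub, hcce, ← hfg l hl h1, sub_zero]
    · have hml : m l ≤ t₁ := (hmM l hl).trans (not_le.1 h1).le
      have : cob G l = cob (h + r' • U') l := hN.cob_congr hG.nil (hh.add (hU'.smul r')).nil hl
        fun l' hl' hs' => by
          simp only [G]
          split_ifs with h2
          · have := hge l' hl' ((hmono l hl l' hl' hs').1.trans hml) h2.2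
            simp only [Pi.sub_apply, Pi.add_apply, Pi.smul_apply, smul_eq_mul,
              hcee l' hl'] at this ⊢
            linarith
          · rfl
      rw [this, cob_add, cob_smul, hUc' l hl (hml.trans (ht₁s.le.trans hsb)) htl,
        hs l hl (hml.trans ht₁s.le) htl, hrU]
      ring
  rcases hat.eq_or_lt with h | h
  · exact h ▸ htT
  exfalso
  obtain ⟨-, g, hg, hfg⟩ := htT
  have hfin : {l ∈ N | f l ≠ cob g l}.Finite := by
    refine (hf.fin.union (hN.star g hg.fin hg.nil)).subset ?_
    rintro l ⟨hl, h2⟩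
    by_contra hc
    simp only [Set.mem_union, Function.mem_support, not_or, not_not, Set.mem_ofPred_eq,
      not_and] at hc
    exact h2 (by rw [hc.1, hc.2 hl])
  have : ∀ᶠ s in nhdsWithin t (Set.Iio t), ∀ l ∈ {l ∈ N | f l ≠ cob g l}, M l < s := by
    rw [Filter.eventually_all_finite hfin]
    rintro l ⟨hl, h2⟩
    have : M l < t := by
      by_contra h3
      exact h2 (hfg l hl (not_lt.1 h3))
    exact nhdsWithin_le_nhds (eventually_gt_nhds this)
  obtain ⟨s, hs1, hs2, hs3⟩ := (this.and (Ico_mem_nhdsLT h)).exists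
  refine absurd (csInf_le hbdd (show s ∈ T from ⟨hs2, g, hg, fun l hl hsl => ?_⟩)) (not_le.2 hs3)
  by_contra h3
  exact absurd hsl (not_le.2 (hs1 l ⟨hl, h3⟩))

end Sweep

end SpTop

namespace SpTop

section Nerve

variable {Y E : Type*}

/-- `f` is a coboundary on `N`. -/
def Cob (c : Prop) (k : ℤ) (N : Set (List Y)) (f : List Y → ℚ) : Prop :=
  ∃ g, Adm c (k - 1) g ∧ ∀ l ∈ N, f l = cob g l

/-- `f` is a cocycle on `N`. -/
def Coc (N : Set (List Y)) (f : List Y → ℚ) : Prop := ∀ l ∈ N, cob f l = 0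

/-- The class of `U` spans the cohomology of `N` in degree `k`. -/
def Span (c : Prop) (k : ℤ) (N : Set (List Y)) (U : List Y → ℚ) : Prop :=
  ∀ f, Adm c k f → Coc N f → ∃ r : ℚ, Cob c k N (f - r • U)

/-- The lists of members of `S` with a common point in `Z`. -/
def Nv (c : Prop) (V : Y → Set E) (S : Set Y) (Z : Set E) : Set (List Y) :=
  {l | (c → l ≠ []) ∧ (∀ a ∈ l, a ∈ S) ∧ ∃ p ∈ Z, ∀ a ∈ l, p ∈ V a}

lemma Nv_mono {c : Prop} {V : Y → Set E} {S S' : Set Y} {Z Z' : Set E} (hS : S ⊆ S')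
    (hZ : Z ⊆ Z') : Nv c V S Z ⊆ Nv c V S' Z' :=
  fun _ ⟨h, h1, p, hp, h2⟩ => ⟨h, fun a ha => hS (h1 a ha), p, hZ hp, h2⟩

lemma Coc.mono {N N' : Set (List Y)} {f : List Y → ℚ} (h : Coc N f) (hN : N' ⊆ N) : Coc N' f :=
  fun l hl => h l (hN hl)

open Classical in
lemma Cob.glue {c : Prop} {k : ℤ} {N₁ N₂ : Set (List Y)} (h₁ : Cplx c N₁) (h₂ : Cplx c N₂)
    {f g₁ g₂ : List Y → ℚ} (hg₁ : Adm c (k - 1) g₁) (hg₂ : Adm c (k - 1) g₂)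
    (hf₁ : ∀ l ∈ N₁, f l = cob g₁ l) (hf₂ : ∀ l ∈ N₂, f l = cob g₂ l)
    (h : Cob c (k - 1) (N₁ ∩ N₂) (g₁ - g₂)) : Cob c k (N₁ ∪ N₂) f := by
  obtain ⟨e, he, hge⟩ := h
  have hce := h₁.adm_cob he
  rw [sub_add_cancel] at hce
  set ce : List Y → ℚ := fun l => if l ∈ N₁ then cob e l else 0 with hce'
  have hcee : ∀ l ∈ N₁, ce l = cob e l := fun l hl => by simp [hce', hl]
  set G : List Y → ℚ := fun l => if l ∈ N₁ then (g₁ - ce) l else g₂ l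
  have hG : Adm c (k - 1) G := (hg₁.sub hce).ite hg₂ h₁.perm
  refine ⟨G, hG, fun l hl => ?_⟩
  by_cases h1 : l ∈ N₁
  · have : cob G l = cob (g₁ - ce) l := h₁.cob_congr hG.nil (hg₁.sub hce).nil h1
      fun l' hl' hs' => by simp only [G]; rw [if_pos hl']
    have hcce : cob ce l = 0 := by
      rw [← cob_cob e l]
      exact h₁.cob_congr hce.nil (fun _ => by simp) h1 fun l' hl' _ => hcee l' hl'
    rw [this, cob_sub, hcce, hf₁ l h1, sub_zero]
  · have h2 : l ∈ N₂ := hl.resolve_left h1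
    rw [hf₂ l h2]
    refine h₂.cob_congr hg₂.nil hG.nil h2 fun l' hl' hs' => ?_
    simp only [G]
    split_ifs with h3
    · have := hge l' ⟨h3, hl'⟩
      simp only [Pi.sub_apply, hcee l' h3] at this ⊢
      linarith
    · rfl

/-- The connecting map of a Mayer-Vietoris sequence is onto. -/
lemma Span.conn {c : Prop} {k : ℤ} {N₁ N₂ : Set (List Y)} (h₁ : Cplx c N₁) (h₂ : Cplx c N₂)
    (ht₁ : ∀ k f, Adm c k f → Coc N₁ f → Cob c k N₁ f)
    (ht₂ : ∀ k f, Adm c k f → Coc N₂ f → Cob c k N₂ f)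
    {c₀ u : List Y → ℚ} (hc₀ : Adm c (k - 1) c₀) (hu₁ : ∀ l ∈ N₁, u l = cob c₀ l)
    (hu₂ : ∀ l ∈ N₂, u l = 0) (h : Span c (k - 1) (N₁ ∩ N₂) c₀) : Span c k (N₁ ∪ N₂) u := by
  intro f hf hfc
  obtain ⟨g₁, hg₁, hf₁⟩ := ht₁ k f hf (hfc.mono Set.subset_union_left)
  obtain ⟨g₂, hg₂, hf₂⟩ := ht₂ k f hf (hfc.mono Set.subset_union_right)
  obtain ⟨r, hr⟩ := h (g₁ - g₂) (hg₁.sub hg₂) fun l hl => by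
    rw [cob_sub, ← hf₁ l hl.1, ← hf₂ l hl.2, sub_self]
  refine ⟨r, Cob.glue h₁ h₂ (g₁ := g₁ - r • c₀) (g₂ := g₂) (hg₁.sub (hc₀.smul r)) hg₂
    (fun l hl => ?_) (fun l hl => ?_) ?_⟩
  · rw [cob_sub, cob_smul, ← hf₁ l hl, ← hu₁ l hl]; rfl
  · rw [← hf₂ l hl]; simp [hu₂ l hl]
  · rwa [sub_right_comm]

/-- The connecting map of a Mayer-Vietoris sequence is injective. -/
lemma Cob.conn {c : Prop} {k : ℤ} {N₁ N₂ : Set (List Y)}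
    (ht₁ : ∀ k f, Adm c k f → Coc N₁ f → Cob c k N₁ f)
    (ht₂ : ∀ k f, Adm c k f → Coc N₂ f → Cob c k N₂ f)
    {c₀ u : List Y → ℚ} (hc₀ : Adm c (k - 1) c₀) (hu₁ : ∀ l ∈ N₁, u l = cob c₀ l)
    (hu₂ : ∀ l ∈ N₂, u l = 0) (h : Cob c k (N₁ ∪ N₂) u) : Cob c (k - 1) (N₁ ∩ N₂) c₀ := by
  obtain ⟨g, hg, hug⟩ := h
  obtain ⟨e₁, he₁, h1⟩ := ht₁ _ (g - c₀) (hg.sub hc₀) fun l hl => by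
    rw [cob_sub, ← hu₁ l hl, hug l (Or.inl hl), sub_self]
  obtain ⟨e₂, he₂, h2⟩ := ht₂ _ g hg fun l hl => by
    rw [← hug l (Or.inr hl), hu₂ l hl]
  refine ⟨e₂ - e₁, he₂.sub he₁, fun l hl => ?_⟩
  rw [cob_sub, ← h1 l hl.1, ← h2 l hl.2]; simp

variable [NormedAddCommGroup E] [NormedSpace ℝ E] [FiniteDimensional ℝ E]

/-- Sweeping a convex set by the levels of a functional. -/
theorem sweep_levels {c : Prop} {V : Y → Set E} {S : Set Y} {Z : Set E}
    (hV : ∀ a, Convex ℝ (V a)) (hZ : Convex ℝ Z) (hN : Cplx c (Nv c V S Z))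
    (hcpt : ∀ l ∈ Nv c V S Z, IsCompact {p | p ∈ Z ∧ ∀ a ∈ l, p ∈ V a})
    (ξ : E →ₗ[ℝ] ℝ) (a : ℝ)
    (H : ∀ t ≥ a, (∃ p ∈ Z, t ≤ ξ p) → ∃ b > t, ∀ k : ℤ, ∃ U, Adm c k U ∧
      Coc (Nv c V S (Z ∩ {p | t ≤ ξ p ∧ ξ p ≤ b})) U ∧ ∀ s, t ≤ s → s ≤ b →
        Span c k (Nv c V S (Z ∩ {p | ξ p = s})) U ∧
        (U = 0 ∨ ¬ Cob c k (Nv c V S (Z ∩ {p | ξ p = s})) U))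
    (k : ℤ) (f : List Y → ℚ) (hf : Adm c k f) (hcoc : Coc (Nv c V S (Z ∩ {p | a ≤ ξ p})) f) :
    Cob c k (Nv c V S (Z ∩ {p | a ≤ ξ p})) f := by
  have hξ : Continuous ξ := ξ.continuous_of_finiteDimensional
  set K : List Y → Set E := fun l => {p | p ∈ Z ∧ ∀ a ∈ l, p ∈ V a} with hK
  have hKne : ∀ l ∈ Nv c V S Z, (K l).Nonempty := fun l ⟨_, _, p, h1, h2⟩ => ⟨p, h1, h2⟩
  have hKconv : ∀ l, Convex ℝ (K l) := fun l x hx y hy s t hs ht hst =>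
    ⟨hZ hx.1 hy.1 hs ht hst, fun a ha => hV a (hx.2 a ha) (hy.2 a ha) hs ht hst⟩
  have hanti : ∀ l l' : List Y, l'.Sublist l → K l ⊆ K l' := fun l l' h p hp =>
    ⟨hp.1, fun a ha => hp.2 a (h.subset ha)⟩
  have hIm : ∀ l ∈ Nv c V S Z, IsCompact (ξ '' K l) := fun l hl => (hcpt l hl).image hξ
  set m : List Y → ℝ := fun l => sInf (ξ '' K l) with hm
  set M : List Y → ℝ := fun l => sSup (ξ '' K l) with hM
  have hM1 : ∀ l ∈ Nv c V S Z, ∀ t, t ≤ M l ↔ ∃ p ∈ K l, t ≤ ξ p := by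
    intro l hl t
    constructor
    · intro h
      obtain ⟨p, hp, hp2⟩ := (hIm l hl).sSup_mem ((hKne l hl).image ξ)
      exact ⟨p, hp, hp2 ▸ h⟩
    · rintro ⟨p, hp, h⟩
      exact h.trans (le_csSup (hIm l hl).bddAbove ⟨p, hp, rfl⟩)
  have hm1 : ∀ l ∈ Nv c V S Z, ∀ t, m l ≤ t ↔ ∃ p ∈ K l, ξ p ≤ t := by
    intro l hl t
    constructor
    · intro h
      obtain ⟨p, hp, hp2⟩ := (hIm l hl).sInf_mem ((hKne l hl).image ξ)
      exact ⟨p, hp, hp2 ▸ h⟩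
    · rintro ⟨p, hp, h⟩
      exact (csInf_le (hIm l hl).bddBelow ⟨p, hp, rfl⟩).trans h
  have hmid : ∀ l ∈ Nv c V S Z, ∀ t b, t ≤ b → m l ≤ b → t ≤ M l →
      l ∈ Nv c V S (Z ∩ {p | t ≤ ξ p ∧ ξ p ≤ b}) := by
    intro l hl t b htb h1 h2
    obtain ⟨p, hp, hp1⟩ := (hM1 l hl t).1 h2
    obtain ⟨q, hq, hq1⟩ := (hm1 l hl b).1 h1
    suffices ∃ r ∈ K l, t ≤ ξ r ∧ ξ r ≤ b from
      let ⟨r, hr, h3⟩ := this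
      ⟨hl.1, hl.2.1, r, ⟨hr.1, h3⟩, hr.2⟩
    by_cases h3 : ξ p ≤ b
    · exact ⟨p, hp, hp1, h3⟩
    by_cases h4 : t ≤ ξ q
    · exact ⟨q, hq, h4, hq1⟩
    have : (ξ '' K l).OrdConnected :=
      ((hKconv l).isPreconnected.image ξ hξ.continuousOn).ordConnected
    obtain ⟨r, hr, hr1⟩ := this.out ⟨q, hq, rfl⟩ ⟨p, hp, rfl⟩ ⟨(not_le.1 h4).le, hp1⟩
    exact ⟨r, hr, hr1.ge, hr1.le.trans htb⟩
  have hge : ∀ t, ∀ l, l ∈ Nv c V S (Z ∩ {p | t ≤ ξ p}) ↔ l ∈ Nv c V S Z ∧ t ≤ M l := by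
    intro t l
    constructor
    · rintro ⟨h1, h2, p, ⟨h3, h4⟩, h5⟩
      have : l ∈ Nv c V S Z := ⟨h1, h2, p, h3, h5⟩
      exact ⟨this, (hM1 l this t).2 ⟨p, ⟨h3, h5⟩, h4⟩⟩
    · rintro ⟨h, h1⟩
      obtain ⟨p, hp, h2⟩ := (hM1 l h t).1 h1
      exact ⟨h.1, h.2.1, p, ⟨hp.1, h2⟩, hp.2⟩
  have heq : ∀ t, ∀ l, l ∈ Nv c V S (Z ∩ {p | ξ p = t}) ↔
      l ∈ Nv c V S Z ∧ m l ≤ t ∧ t ≤ M l := by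
    intro t l
    constructor
    · rintro ⟨h1, h2, p, ⟨h3, h4⟩, h5⟩
      have : l ∈ Nv c V S Z := ⟨h1, h2, p, h3, h5⟩
      exact ⟨this, (hm1 l this t).2 ⟨p, ⟨h3, h5⟩, h4.le⟩, (hM1 l this t).2 ⟨p, ⟨h3, h5⟩, h4.ge⟩⟩
    · rintro ⟨h, h1, h2⟩
      refine Nv_mono le_rfl (Set.inter_subset_inter_right _ ?_) (hmid l h t t le_rfl h1 h2)
      exact fun p hp => le_antisymm hp.2 hp.1
  obtain ⟨g, hg, hfg⟩ := sweep hN m M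
    (fun l hl => by
      obtain ⟨p, hp⟩ := hKne l hl
      exact (csInf_le (hIm l hl).bddBelow ⟨p, hp, rfl⟩).trans
        (le_csSup (hIm l hl).bddAbove ⟨p, hp, rfl⟩))
    (fun l hl l' hl' hs => ⟨csInf_le_csInf (hIm l' hl').bddBelow ((hKne l hl).image ξ)
        (Set.image_mono (hanti l l' hs)),
      csSup_le_csSup (hIm l' hl').bddAbove ((hKne l hl).image ξ)
        (Set.image_mono (hanti l l' hs))⟩)
    (fun l _ l' hp => by
      have : K l = K l' := by
        ext p
        simp only [hK, Set.mem_ofPred_eq, hp.mem_iff]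
      simp only [hM, this]) a
    (fun t hta ⟨l, hl, hlt⟩ => by
      obtain ⟨p, hp, hp1⟩ := (hM1 l hl t).1 hlt
      obtain ⟨b, hb, hU⟩ := H t hta ⟨p, hp.1, hp1⟩
      refine ⟨b, hb, fun k => ?_⟩
      obtain ⟨U, hU1, hU2, hU3⟩ := hU k
      refine ⟨U, hU1, fun l hl h1 h2 => hU2 l (hmid l hl t b hb.le h1 h2), fun s hs1 hs2 =>
        ⟨fun f hf hfc => ?_, (hU3 s hs1 hs2).2.imp id fun h ⟨g, hg, hfg⟩ => h ⟨g, hg, ?_⟩⟩⟩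
      · obtain ⟨r, g, hg, hfg⟩ := (hU3 s hs1 hs2).1 f hf fun l hl =>
          have := (heq s l).1 hl
          hfc l this.1 this.2.1 this.2.2
        refine ⟨r, g, hg, fun l hl h1 h2 => ?_⟩
        rw [← hfg l ((heq s l).2 ⟨hl, h1, h2⟩)]
        simp
      · intro l hl
        have := (heq s l).1 hl
        exact hfg l this.1 this.2.1 this.2.2)
    k f hf (fun l hl h => hcoc l ((hge a l).2 ⟨hl, h⟩))
  exact ⟨g, hg, fun l hl => hfg l ((hge a l).1 hl).1 ((hge a l).1 hl).2⟩

end Nerve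

end SpTop

namespace SpTop

section Covers

variable {Y E : Type*}

lemma Cplx.of_star {c : Prop} {V : Y → Set E} {S : Set Y} {Z : Set E}
    (h : ∀ a ∈ S, {b ∈ S | (V a ∩ V b ∩ Z).Nonempty}.Finite) (hS : c ∨ S.Finite) :
    Cplx c (Nv c V S Z) := by
  refine ⟨fun l ⟨h1, h2, p, h3, h4⟩ l' hl => ?_, fun l l' hp ⟨h1, h2, p, h3, h4⟩ => ?_,
    fun g hg hg0 => ?_⟩
  · by_cases h5 : c ∧ l' = []
    · exact Or.inr h5
    · exact Or.inl ⟨fun hc h6 => h5 ⟨hc, h6⟩, fun a ha => h2 a (hl.subset ha), p, h3,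
        fun a ha => h4 a (hl.subset ha)⟩
  · exact ⟨fun hc h5 => h1 hc (by simpa [h5] using hp.length_eq),
      fun a ha => h2 a (hp.mem_iff.2 ha), p, h3, fun a ha => h4 a (hp.mem_iff.2 ha)⟩
  · have key : ∀ (T : Set Y) (n : ℕ), T.Finite →
        {l : List Y | l.length = n ∧ ∀ a ∈ l, a ∈ T}.Finite := by
      intro T n hT
      have := hT.to_subtype
      refine ((List.finite_length_eq T n).image (List.map Subtype.val)).subset ?_
      rintro l ⟨h1, h2⟩
      exact ⟨l.attachWith (· ∈ T) h2, by simpa using h1, by simp⟩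
    have hfin : ∀ l' ∈ Function.support g,
        {l ∈ Nv c V S Z | l'.Sublist l ∧ l'.length + 1 = l.length}.Finite := by
      intro l' hl'
      rcases hS with hc | hS
      · cases l' with
        | nil => exact absurd (hg0 hc) hl'
        | cons a l' =>
          by_cases ha : a ∈ S
          · refine (key _ (l'.length + 2) (h a ha)).subset ?_
            rintro l ⟨⟨-, h2, p, h3, h4⟩, h5, h6⟩
            refine ⟨by simpa using h6.symm, fun b hb => ⟨h2 b hb, p, ⟨h4 a ?_, h4 b hb⟩, h3⟩⟩
            exact h5.subset (by simp)
          · refine Set.finite_empty.subset ?_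
            rintro l ⟨⟨-, h2, -⟩, h5, -⟩
            exact ha (h2 a (h5.subset (by simp)))
      · refine (key S (l'.length + 1) hS).subset ?_
        rintro l ⟨⟨-, h2, -⟩, -, h6⟩
        exact ⟨h6.symm, h2⟩
    refine (Set.Finite.biUnion hg hfin).subset ?_
    rintro l ⟨hl, hl0⟩
    by_contra hc
    refine hl0 (cob_eq_zero fun l' h1 h2 => ?_)
    by_contra h3
    exact hc (Set.mem_biUnion (show l' ∈ Function.support g from h3) ⟨hl, h1, h2⟩)

variable [NormedAddCommGroup E] [NormedSpace ℝ E]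

lemma Nv_union {c : Prop} {V : Y → Set E} {S : Set Y} {Z : Set E} (ξ : E →ₗ[ℝ] ℝ) (a : ℝ) :
    Nv c V S (Z ∩ {p | a ≤ ξ p}) ∪ Nv c V S (Z ∩ {p | ξ p ≤ a}) = Nv c V S Z := by
  apply le_antisymm
  · exact Set.union_subset (Nv_mono le_rfl Set.inter_subset_left)
      (Nv_mono le_rfl Set.inter_subset_left)
  · rintro l ⟨h, h1, p, hp, h2⟩
    rcases le_total a (ξ p) with h3 | h3
    · exact Or.inl ⟨h, h1, p, ⟨hp, h3⟩, h2⟩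
    · exact Or.inr ⟨h, h1, p, ⟨hp, h3⟩, h2⟩

lemma exists_level {Z : Set E} (hZ : Convex ℝ Z) (ξ : E →ₗ[ℝ] ℝ) {p q : E} (hp : p ∈ Z)
    (hq : q ∈ Z) {a : ℝ} (h1 : ξ p ≤ a) (h2 : a ≤ ξ q) : ∃ r ∈ Z, ξ r = a := by
  have h3 : a ∈ segment ℝ (ξ p) (ξ q) := by
    rw [segment_eq_Icc (h1.trans h2)]; exact ⟨h1, h2⟩
  obtain ⟨s, t, hs, ht, hst, h⟩ := h3
  exact ⟨s • p + t • q, hZ hp hq hs ht hst, by simpa using h⟩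

lemma Nv_inter {c : Prop} {V : Y → Set E} (hV : ∀ a, Convex ℝ (V a)) {S : Set Y} {Z : Set E}
    (hZ : Convex ℝ Z) (ξ : E →ₗ[ℝ] ℝ) (a : ℝ) :
    Nv c V S (Z ∩ {p | a ≤ ξ p}) ∩ Nv c V S (Z ∩ {p | ξ p ≤ a}) =
      Nv c V S (Z ∩ {p | ξ p = a}) := by
  apply le_antisymm
  · rintro l ⟨⟨h, h1, p, ⟨hp, hp1⟩, h2⟩, -, -, q, ⟨hq, hq1⟩, h3⟩
    have hK : Convex ℝ (Z ∩ ⋂ a ∈ l, V a) := hZ.inter (convex_iInter₂ fun a _ => hV a)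
    obtain ⟨r, hr, hr1⟩ := exists_level hK ξ ⟨hq, by simpa using h3⟩ ⟨hp, by simpa using h2⟩ hq1 hp1
    exact ⟨h, h1, r, ⟨hr.1, hr1⟩, by simpa using hr.2⟩
  · exact Set.subset_inter (Nv_mono le_rfl fun p hp => ⟨hp.1, hp.2.ge⟩)
      (Nv_mono le_rfl fun p hp => ⟨hp.1, hp.2.le⟩)

/-- Locally finite families of compact convex subsets of a convex set without boundary. -/
structure LF (X : Set E) (V : Y → Set E) : Prop where
  sub : ∀ a, V a ⊆ X
  conv : ∀ a, Convex ℝ (V a)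
  cpt : ∀ a, IsCompact (V a)
  star : ∀ a, {b | (V a ∩ V b).Nonempty}.Finite
  seg : ∀ p ∈ X, ∀ q ∈ X, {a | (segment ℝ p q ∩ V a).Nonempty}.Finite

/-- Convex relatively open sets with direction `W`, closed in `X`. -/
structure Flat (X : Set E) (W : Submodule ℝ E) (Z : Set E) : Prop where
  sub : Z ⊆ X
  conv : Convex ℝ Z
  diff : ∀ x ∈ Z, ∀ y ∈ Z, x - y ∈ W
  opn : ∀ x ∈ Z, ∀ w ∈ W, ∃ ε : ℝ, 0 < ε ∧ x + ε • w ∈ Z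
  cpt : ∀ K ⊆ X, IsCompact K → IsCompact (K ∩ Z)

lemma LF.cplx {X : Set E} {V : Y → Set E} (h : LF X V) (S : Set Y) (Z : Set E) :
    Cplx True (Nv True V S Z) :=
  Cplx.of_star (fun a _ => (h.star a).subset fun _ ⟨_, p, hp, _⟩ => ⟨p, hp⟩) (Or.inl trivial)

open Classical in
/-- Extending a class from a wall to a class of one degree more. -/
lemma exists_suspension {X Z : Set E} {V : Y → Set E} (hV : LF X V) (hZ : Convex ℝ Z)
    (η : E →ₗ[ℝ] ℝ) (a : ℝ) {k : ℤ} {c : List Y → ℚ} (hc : Adm True k c)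
    (hcc : Coc (Nv True V Set.univ (Z ∩ {p | η p = a})) c) :
    ∃ U c', Adm True (k + 1) U ∧ Adm True k c' ∧ Coc (Nv True V Set.univ Z) U ∧
      (∀ l ∈ Nv True V Set.univ (Z ∩ {p | η p = a}), c' l = c l) ∧
      (∀ l ∈ Nv True V Set.univ (Z ∩ {p | a ≤ η p}), U l = cob c' l) ∧
      ∀ l ∈ Nv True V Set.univ (Z ∩ {p | η p ≤ a}), U l = 0 := by
  set N₀ := Nv True V Set.univ (Z ∩ {p | η p = a}) with hN₀
  set N₁ := Nv True V Set.univ (Z ∩ {p | a ≤ η p}) with hN₁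
  set N₂ := Nv True V Set.univ (Z ∩ {p | η p ≤ a}) with hN₂
  have hi : N₁ ∩ N₂ = N₀ := Nv_inter hV.conv hZ η a
  have hu : N₁ ∪ N₂ = Nv True V Set.univ Z := Nv_union η a
  have h₀ : Cplx True N₀ := hV.cplx ..
  have h₁ : Cplx True N₁ := hV.cplx ..
  have h₂ : Cplx True N₂ := hV.cplx ..
  set c' : List Y → ℚ := fun l => if l ∈ N₀ then c l else (0 : List Y → ℚ) l with hc'
  have hc'A : Adm True k c' := hc.ite (Adm.zero _ _) h₀.perm
  set U : List Y → ℚ := fun l => if l ∈ N₁ then cob c' l else 0 with hU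
  have hUA : Adm True (k + 1) U := h₁.adm_cob hc'A
  have hU1 : ∀ l ∈ N₁, U l = cob c' l := fun l hl => by simp only [hU]; rw [if_pos hl]
  have hU2 : ∀ l ∈ N₂, U l = 0 := fun l hl => by
    by_cases h : l ∈ N₁
    · have hl0 : l ∈ N₀ := hi ▸ ⟨h, hl⟩
      rw [hU1 l h, ← hcc l hl0]
      exact h₀.cob_congr hc'A.nil hc.nil hl0 fun l' hl' _ => by simp only [hc']; rw [if_pos hl']
    · simp only [hU]; rw [if_neg h]
  refine ⟨U, c', hUA, hc'A, fun l hl => ?_, fun l hl => ?_, hU1, hU2⟩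
  · rcases (hu ▸ hl : l ∈ N₁ ∪ N₂) with h | h
    · rw [← cob_cob c' l]
      exact h₁.cob_congr hUA.nil (fun _ => by simp) h fun l' hl' _ => hU1 l' hl'
    · rw [← cob_zero l]
      exact h₂.cob_congr hUA.nil (fun _ => rfl) h fun l' hl' _ => hU2 l' hl'
  · simp only [hc']; rw [if_pos hl]

variable [FiniteDimensional ℝ E]

lemma Flat.slice {X Z : Set E} {W : Submodule ℝ E} (h : Flat X W Z) (ξ : E →ₗ[ℝ] ℝ) (s : ℝ) :
    Flat X (W ⊓ ξ.ker) (Z ∩ {p | ξ p = s}) where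
  sub := Set.inter_subset_left.trans h.sub
  conv := h.conv.inter (convex_hyperplane ξ.isLinear s)
  diff x hx y hy := ⟨h.diff x hx.1 y hy.1, by
    have h1 : ξ x = s := hx.2
    have h2 : ξ y = s := hy.2
    simp [h1, h2]⟩
  opn x hx w hw := by
    obtain ⟨ε, hε, h1⟩ := h.opn x hx.1 w hw.1
    have h2 : ξ x = s := hx.2
    have h3 : ξ w = 0 := hw.2
    exact ⟨ε, hε, h1, by simp [h2, h3]⟩
  cpt K hK hKc := by
    have := (h.cpt K hK hKc).inter_right
      (isClosed_eq ξ.continuous_of_finiteDimensional (continuous_const (y := s)))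
    rwa [Set.inter_assoc] at this

lemma finrank_inf_ker {W : Submodule ℝ E} {ξ : E →ₗ[ℝ] ℝ} {w : E} (hw : w ∈ W) (h : ξ w ≠ 0)
    {m : ℕ} (hW : Module.finrank ℝ W = m + 1) :
    Module.finrank ℝ (W ⊓ ξ.ker : Submodule ℝ E) = m := by
  have h1 := LinearMap.finrank_range_add_finrank_ker (ξ.domRestrict W)
  have h2 : Module.finrank ℝ (LinearMap.range (ξ.domRestrict W)) = 1 := by
    rw [LinearMap.range_eq_top.2, finrank_top, Module.finrank_self]
    intro r
    exact ⟨(r / ξ w) • ⟨w, hw⟩, by simp [h]⟩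
  have h3 : (LinearMap.ker (ξ.domRestrict W)).map W.subtype = W ⊓ ξ.ker := by
    rw [LinearMap.domRestrict, LinearMap.ker_comp, Submodule.map_comap_subtype]
  have h4 := Submodule.finrank_map_subtype_eq W (LinearMap.ker (ξ.domRestrict W))
  rw [h3] at h4
  omega

/-- Vanishing of the compactly supported cohomology of flats of dimension `m` outside of
degree `m`. -/
def VanAt (X : Set E) (V : Y → Set E) (m : ℕ) : Prop :=
  ∀ (W : Submodule ℝ E) (Z : Set E), Flat X W Z → Z.Nonempty → Module.finrank ℝ W = m →
    ∀ S : Set Y, (∀ x ∈ X, ∃ a ∈ S, x ∈ V a) → ∀ k : ℤ, k ≠ m + 1 → ∀ f, Adm True k f →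
      Coc (Nv True V S Z) f → Cob True k (Nv True V S Z) f

/-- Slabs in flats of dimension `m + 1` carry a generator of the compactly supported cohomology
of all the slices simultaneously. -/
def GenAt (X : Set E) (V : Y → Set E) (m : ℕ) : Prop :=
  ∀ (W : Submodule ℝ E) (Z : Set E), Flat X W Z → Module.finrank ℝ W = m + 1 →
    ∀ (ξ : E →ₗ[ℝ] ℝ), ∀ p ∈ Z, ∀ q ∈ Z, ξ p < ξ q → ∃ U, Adm True (m + 1) U ∧
      Coc (Nv True V Set.univ (Z ∩ {x | ξ p ≤ ξ x ∧ ξ x ≤ ξ q})) U ∧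
      ∀ s, ξ p ≤ s → s ≤ ξ q → ∀ S : Set Y, (∀ x ∈ X, ∃ a ∈ S, x ∈ V a) →
        Span True (m + 1) (Nv True V S (Z ∩ {x | ξ x = s})) U ∧
        ¬ Cob True (m + 1) (Nv True V S (Z ∩ {x | ξ x = s})) U

lemma half_exact {X : Set E} {V : Y → Set E} (hV : LF X V) {m : ℕ} (h1 : VanAt X V m)
    (h2 : GenAt X V m) {W : Submodule ℝ E} {Z : Set E} (hZ : Flat X W Z)
    (hW : Module.finrank ℝ W = m + 1) (ξ : E →ₗ[ℝ] ℝ) {w : E} (hw : w ∈ W) (hξw : ξ w ≠ 0)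
    {p : E} (hp : p ∈ Z) {S : Set Y} (hS : ∀ x ∈ X, ∃ a ∈ S, x ∈ V a) (k : ℤ)
    (f : List Y → ℚ) (hf : Adm True k f) (hfc : Coc (Nv True V S (Z ∩ {x | ξ p ≤ ξ x})) f) :
    Cob True k (Nv True V S (Z ∩ {x | ξ p ≤ ξ x})) f := by
  obtain ⟨w, hw, hξw⟩ : ∃ w ∈ W, 0 < ξ w := by
    rcases hξw.lt_or_gt with h | h
    · exact ⟨-w, W.neg_mem hw, by simpa using h⟩
    · exact ⟨w, hw, h⟩
  refine sweep_levels hV.conv hZ.conv (hV.cplx S Z) ?_ ξ (ξ p) ?_ k f hf hfc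
  · rintro l ⟨hl, -⟩
    obtain ⟨a, l, rfl⟩ := List.exists_cons_of_ne_nil (hl trivial)
    have hcl : ∀ l : List Y, IsClosed {x | ∀ a ∈ l, x ∈ V a} := fun l => by
      simp only [Set.ofPred_forall]
      exact isClosed_biInter fun a _ => (hV.cpt a).isClosed
    have := (hZ.cpt _ (hV.sub a) (hV.cpt a)).inter_right (hcl l)
    convert this using 1
    ext x
    simp only [Set.mem_ofPred_eq, List.mem_cons, forall_eq_or_imp, Set.mem_inter_iff]
    tauto
  · rintro t ht ⟨q, hq, hqt⟩
    obtain ⟨r, hr, hrt⟩ := exists_level hZ.conv ξ hp hq ht hqt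
    obtain ⟨ε, hε, hr'⟩ := hZ.opn r hr w hw
    have hlt : ξ r < ξ (r + ε • w) := by simp; positivity
    refine ⟨ξ (r + ε • w), hrt ▸ hlt, fun k => ?_⟩
    by_cases hk : k = m + 1
    · subst hk
      obtain ⟨U, hU1, hU2, hU3⟩ := h2 W Z hZ hW ξ r hr _ hr' hlt
      rw [hrt] at hU2 hU3
      exact ⟨U, hU1, hU2.mono (Nv_mono (Set.subset_univ _) le_rfl), fun s hs1 hs2 =>
        ⟨(hU3 s hs1 hs2 S hS).1, Or.inr (hU3 s hs1 hs2 S hS).2⟩⟩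
    · refine ⟨0, Adm.zero _ _, fun l _ => cob_zero l, fun s hs1 hs2 => ⟨fun f hf hfc => ⟨0, ?_⟩,
        Or.inl rfl⟩⟩
      rw [smul_zero, sub_zero]
      obtain ⟨x, hx, hxs⟩ := exists_level hZ.conv ξ hr hr' (hrt.le.trans hs1) hs2
      exact h1 _ _ (hZ.slice ξ s) ⟨x, hx, hxs⟩ (finrank_inf_ker hw hξw.ne' hW) S hS k hk f hf hfc

lemma half_exact' {X : Set E} {V : Y → Set E} (hV : LF X V) {m : ℕ} (h1 : VanAt X V m)
    (h2 : GenAt X V m) {W : Submodule ℝ E} {Z : Set E} (hZ : Flat X W Z)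
    (hW : Module.finrank ℝ W = m + 1) (ξ : E →ₗ[ℝ] ℝ) {w : E} (hw : w ∈ W) (hξw : ξ w ≠ 0)
    {p : E} (hp : p ∈ Z) {S : Set Y} (hS : ∀ x ∈ X, ∃ a ∈ S, x ∈ V a) (k : ℤ)
    (f : List Y → ℚ) (hf : Adm True k f) (hfc : Coc (Nv True V S (Z ∩ {x | ξ x ≤ ξ p})) f) :
    Cob True k (Nv True V S (Z ∩ {x | ξ x ≤ ξ p})) f := by
  have := half_exact hV h1 h2 hZ hW (-ξ) hw (by simpa using hξw) hp hS k f hf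
  simp only [LinearMap.neg_apply, neg_le_neg_iff] at this
  exact this hfc

lemma VanAt.succ {X : Set E} {V : Y → Set E} (hV : LF X V) {m : ℕ} (h1 : VanAt X V m)
    (h2 : GenAt X V m) : VanAt X V (m + 1) := by
  rintro W Z hZ ⟨p, hp⟩ hW S hS k hk f hf hfc
  obtain ⟨w, hw, hw0⟩ : ∃ w ∈ W, w ≠ 0 := by
    have : W ≠ ⊥ := by rintro rfl; simp at hW
    exact Submodule.exists_mem_ne_zero_of_ne_bot this
  obtain ⟨ξ, hξ⟩ : ∃ ξ : E →ₗ[ℝ] ℝ, ξ w ≠ 0 := by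
    by_contra hc
    push Not at hc
    exact hw0 ((Module.forall_dual_apply_eq_zero_iff ℝ w).1 hc)
  have hu := Nv_union (c := True) (V := V) (S := S) (Z := Z) ξ (ξ p)
  rw [← hu] at hfc ⊢
  have := Span.conn (k := k) (c₀ := 0) (u := 0) (hV.cplx ..) (hV.cplx ..)
    (half_exact hV h1 h2 hZ hW ξ hw hξ hp hS) (half_exact' hV h1 h2 hZ hW ξ hw hξ hp hS)
    (Adm.zero _ _) (fun l _ => (cob_zero l).symm) (fun _ _ => rfl) ?_ f hf hfc
  · obtain ⟨r, hr⟩ := this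
    rwa [smul_zero, sub_zero] at hr
  · intro g hg hgc
    refine ⟨0, ?_⟩
    rw [smul_zero, sub_zero]
    rw [Nv_inter hV.conv hZ.conv] at hgc ⊢
    exact h1 _ _ (hZ.slice ξ _) ⟨p, hp, rfl⟩ (finrank_inf_ker hw hξ hW) S hS _
      (by push_cast at hk; omega) g hg hgc

lemma gen_conn {X : Set E} {V : Y → Set E} (hV : LF X V) {m : ℕ} (h1 : VanAt X V m)
    (h2 : GenAt X V m) {W : Submodule ℝ E} {Z : Set E} (hZ : Flat X W Z)
    (hW : Module.finrank ℝ W = m + 1) (ξ : E →ₗ[ℝ] ℝ) {w : E} (hw : w ∈ W) (hξw : ξ w ≠ 0)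
    {p : E} (hp : p ∈ Z) {S : Set Y} (hS : ∀ x ∈ X, ∃ a ∈ S, x ∈ V a) {c c' u : List Y → ℚ}
    (hc : Adm True (m + 1) c')
    (hcc : ∀ l ∈ Nv True V S (Z ∩ {x | ξ x = ξ p}), c' l = c l)
    (hu₁ : ∀ l ∈ Nv True V S (Z ∩ {x | ξ p ≤ ξ x}), u l = cob c' l)
    (hu₂ : ∀ l ∈ Nv True V S (Z ∩ {x | ξ x ≤ ξ p}), u l = 0)
    (h : Span True (m + 1) (Nv True V S (Z ∩ {x | ξ x = ξ p})) c)
    (h' : ¬ Cob True (m + 1) (Nv True V S (Z ∩ {x | ξ x = ξ p})) c) :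
    Span True ((m + 1 : ℕ) + 1) (Nv True V S Z) u ∧
      ¬ Cob True ((m + 1 : ℕ) + 1) (Nv True V S Z) u := by
  have hu := Nv_union (c := True) (V := V) (S := S) (Z := Z) ξ (ξ p)
  have hk : (((m + 1 : ℕ) : ℤ) + 1) - 1 = m + 1 := by push_cast; ring
  rw [← hu]
  have e1 := half_exact hV h1 h2 hZ hW ξ hw hξw hp hS
  have e2 := half_exact' hV h1 h2 hZ hW ξ hw hξw hp hS
  constructor
  · refine Span.conn (hV.cplx ..) (hV.cplx ..) e1 e2 (c₀ := c') (hk ▸ hc) hu₁ hu₂ ?_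
    rw [hk, Nv_inter hV.conv hZ.conv]
    intro f hf hfc
    obtain ⟨r, g, hg, hfg⟩ := h f hf hfc
    exact ⟨r, g, hg, fun l hl => by rw [← hfg l hl]; simp [hcc l hl]⟩
  · intro hcob
    have := Cob.conn e1 e2 (c₀ := c') (hk ▸ hc) hu₁ hu₂ hcob
    rw [hk, Nv_inter hV.conv hZ.conv] at this
    obtain ⟨g, hg, hfg⟩ := this
    exact h' ⟨g, hg, fun l hl => by rw [← hfg l hl, hcc l hl]⟩

lemma GenAt.succ {X : Set E} {V : Y → Set E} (hV : LF X V) {m : ℕ} (h1 : VanAt X V m)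
    (h2 : GenAt X V m) : GenAt X V (m + 1) := by
  intro W Z hZ hW ξ p hp q hq hpq
  have hd : q - p ∈ W := hZ.diff q hq p hp
  have hξd : ξ (q - p) ≠ 0 := by simp; linarith
  have hW1 := finrank_inf_ker hd hξd hW
  obtain ⟨w, hw, hw0⟩ : ∃ w ∈ W ⊓ ξ.ker, w ≠ 0 := by
    have : W ⊓ ξ.ker ≠ ⊥ := by intro h0; rw [h0] at hW1; simp at hW1
    exact Submodule.exists_mem_ne_zero_of_ne_bot this
  obtain ⟨η, hηw, hηd⟩ : ∃ η : E →ₗ[ℝ] ℝ, η w ≠ 0 ∧ η (q - p) = 0 := by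
    obtain ⟨η, hη⟩ : ∃ ξ : E →ₗ[ℝ] ℝ, ξ w ≠ 0 := by
      by_contra hc
      push Not at hc
      exact hw0 ((Module.forall_dual_apply_eq_zero_iff ℝ w).1 hc)
    have hξw : ξ w = 0 := hw.2
    refine ⟨η - (η (q - p) / ξ (q - p)) • ξ, by simpa [hξw] using hη, ?_⟩
    rw [LinearMap.sub_apply, LinearMap.smul_apply, smul_eq_mul, div_mul_cancel₀ _ hξd, sub_self]
  have hηpq : η q = η p := by rw [map_sub] at hηd; linarith
  obtain ⟨c, hc1, hc2, hc3⟩ := h2 _ _ (hZ.slice η (η p))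
    (finrank_inf_ker hw.1 hηw hW) ξ p ⟨hp, rfl⟩ q ⟨hq, hηpq⟩ hpq
  have hconv : Convex ℝ (Z ∩ {x | ξ p ≤ ξ x ∧ ξ x ≤ ξ q}) := by
    refine hZ.conv.inter ?_
    exact (convex_halfSpace_ge ξ.isLinear _).inter (convex_halfSpace_le ξ.isLinear _)
  obtain ⟨U, c', hU, hc', hUc, hcc', hU1, hU2⟩ := exists_suspension hV hconv η (η p) hc1 (by
    rwa [Set.inter_right_comm])
  refine ⟨U, by exact_mod_cast hU, hUc, fun s hs1 hs2 S hS => ?_⟩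
  obtain ⟨x, ⟨hx, hxη⟩, hxs⟩ := exists_level (hZ.slice η (η p)).conv ξ ⟨hp, rfl⟩ ⟨hq, hηpq⟩ hs1 hs2
  have hxη : η x = η p := hxη
  have hsub : ∀ A : Set E, Nv True V S (Z ∩ {x | ξ x = s} ∩ A) ⊆
      Nv True V Set.univ (Z ∩ {x | ξ p ≤ ξ x ∧ ξ x ≤ ξ q} ∩ A) := fun A =>
    Nv_mono (Set.subset_univ _) fun y hy => by
      have : ξ y = s := hy.1.2
      exact ⟨⟨hy.1.1, by simp [this, hs1, hs2]⟩, hy.2⟩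
  have hgen := hc3 s hs1 hs2 S hS
  rw [Set.inter_right_comm] at hgen
  exact gen_conn hV h1 h2 (hZ.slice ξ s) hW1 η hw hηw
    (p := x) ⟨hx, hxs⟩ hS hc' (fun l hl => hcc' l (hsub _ (by rwa [hxη] at hl)))
    (fun l hl => hU1 l (hsub _ (by rwa [hxη] at hl)))
    (fun l hl => hU2 l (hsub _ (by rwa [hxη] at hl)))
    (by rw [hxη]; exact hgen.1) (by rw [hxη]; exact hgen.2)

end Covers

end SpTop

namespace SpTop

section TopClass

variable {Y E : Type*} [NormedAddCommGroup E] [NormedSpace ℝ E]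

lemma Adm.cons {k : ℤ} {f : List Y → ℚ} (hf : Adm True k f) {a : Y} (h : f [a] = 0) :
    Adm True (k - 1) fun l => f (a :: l) where
  fin := hf.fin.preimage (fun _ _ _ _ h => (List.cons.inj h).2)
  len l h := by
    have := hf.len _ h
    simp at this
    omega
  nil _ := h
  alt _ := (hf.alt trivial).cons a

lemma cob_cons_of_coc {E : Type*} {V : Y → Set E} {S : Set Y} {p : E} {a : Y} (haS : a ∈ S)
    (ha : p ∈ V a) {f : List Y → ℚ} (hfc : Coc (Nv True V S {p}) f) {l : List Y}
    (hl : l ∈ Nv True V S {p}) : f l = cob (fun m => f (a :: m)) l := by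
  obtain ⟨h1, h2, x, rfl, h3⟩ := hl
  have := hfc (a :: l) ⟨by simp, by simpa using ⟨haS, h2⟩, x, rfl, by simpa using ⟨ha, h3⟩⟩
  rw [cob_cons] at this
  linarith

lemma VanAt.base [FiniteDimensional ℝ E] {X : Set E} (V : Y → Set E) : VanAt X V 0 := by
  rintro W Z hZ ⟨p, hp⟩ hW S hS k hk f hf hfc
  have hZp : Z = {p} := by
    ext x
    refine ⟨fun hx => ?_, fun hx => hx ▸ hp⟩
    have h1 := hZ.diff x hx p hp
    have h2 := finrank_zero_iff_forall_zero.1 hW ⟨_, h1⟩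
    exact sub_eq_zero.1 (congrArg Subtype.val h2)
  subst hZp
  obtain ⟨a, haS, ha⟩ := hS p (hZ.sub hp)
  have h0 : f [a] = 0 := by
    by_contra h
    have := hf.len _ h
    simp at this
    push_cast at hk
    omega
  exact ⟨_, hf.cons h0, fun l hl => cob_cons_of_coc haS ha hfc hl⟩

open Classical in
lemma GenAt.base {X : Set E} {V : Y → Set E} (hV : LF X V) : GenAt X V 0 := by
  intro W Z hZ hW ξ p hp q hq hpq
  set P : Y → Prop := fun a => (segment ℝ p q ∩ V a).Nonempty with hP
  have hseg : ∀ x ∈ Z, ξ p ≤ ξ x → ξ x ≤ ξ q → x ∈ segment ℝ p q := by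
    intro x hx h1 h2
    have hd : ξ q - ξ p ≠ 0 := by linarith
    have h0 : (⟨q - p, hZ.diff q hq p hp⟩ : W) ≠ 0 := by
      intro h
      have := congrArg (fun w : W => ξ w) h
      simp at this
      exact hd this
    obtain ⟨r, hr⟩ := exists_smul_eq_of_finrank_eq_one (by simpa using hW) h0
      ⟨x - p, hZ.diff x hx p hp⟩
    have hr' : r • (q - p) = x - p := congrArg Subtype.val hr
    have hr2 := congrArg ξ hr'
    simp only [map_smul, map_sub, smul_eq_mul] at hr2
    rw [segment_eq_image']
    refine ⟨r, ⟨?_, ?_⟩, by simp only [hr']; abel⟩ <;> nlinarith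
  set U : List Y → ℚ := fun l => if ∃ a, l = [a] ∧ P a then 1 else 0 with hU
  have hU1 : ∀ a, P a → U [a] = 1 := fun a ha => if_pos ⟨a, rfl, ha⟩
  have hU0 : ∀ l : List Y, l.length ≠ 1 → U l = 0 := fun l hl =>
    if_neg fun ⟨a, h, _⟩ => hl (by simp [h])
  have hUA : Adm True ((0 : ℕ) + 1) U := by
    refine ⟨?_, fun l h => ?_, fun _ => hU0 _ (by simp), fun _ l₁ a b l₂ => ?_⟩
    · refine ((hV.seg p (hZ.sub hp) q (hZ.sub hq)).image fun a => [a]).subset fun l h => ?_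
      by_cases h' : ∃ a, l = [a] ∧ P a
      · obtain ⟨a, rfl, h1⟩ := h'
        exact ⟨a, h1, rfl⟩
      · exact absurd (if_neg h') h
    · by_contra hc
      exact h (hU0 l (by intro h1; exact hc (by simp [h1])))
    · rw [hU0, hU0, neg_zero] <;> simp <;> omega
  refine ⟨U, hUA, ?_, fun s hs1 hs2 S hS => ?_⟩
  · rintro l ⟨h1, -, x, ⟨hx, hx1, hx2⟩, h2⟩
    have hx' := hseg x hx hx1 hx2
    have hPl : ∀ a ∈ l, P a := fun a ha => ⟨x, hx', h2 a ha⟩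
    match l, h1, hPl with
    | [], h1, _ => exact absurd rfl (h1 trivial)
    | [a], _, _ => simp [cob_cons, hU0]
    | [a, b], _, hPl => simp [cob_cons, hU0, hU1 a (hPl a (by simp)), hU1 b (hPl b (by simp))]
    | a :: b :: c :: l, _, _ =>
      exact cob_eq_zero fun l' _ h => hU0 l' (by simp at h; omega)
  · obtain ⟨x, hx, hxs⟩ := exists_level hZ.conv ξ hp hq hs1 hs2
    have hZx : Z ∩ {x | ξ x = s} = {x} := by
      ext y
      refine ⟨fun hy => ?_, fun hy => hy ▸ ⟨hx, hxs⟩⟩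
      have hy2 : ξ y = s := hy.2
      have hd : ξ q - ξ p ≠ 0 := by linarith
      have h0 : (⟨q - p, hZ.diff q hq p hp⟩ : W) ≠ 0 := by
        intro h
        have := congrArg (fun w : W => ξ w) h
        simp at this
        exact hd this
      obtain ⟨r, hr⟩ := exists_smul_eq_of_finrank_eq_one (by simpa using hW) h0
        ⟨y - x, hZ.diff y hy.1 x hx⟩
      have hr' : r • (q - p) = y - x := congrArg Subtype.val hr
      have hr2 := congrArg ξ hr'
      simp only [map_smul, map_sub, smul_eq_mul, hy2, hxs, sub_self, mul_eq_zero, hd,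
        or_false] at hr2
      rw [hr2, zero_smul] at hr'
      exact (sub_eq_zero.1 hr'.symm)
    rw [hZx]
    obtain ⟨a, haS, ha⟩ := hS x (hZ.sub hx)
    have hPa : P a := ⟨x, hseg x hx (hxs ▸ hs1) (hxs ▸ hs2), ha⟩
    constructor
    · intro f hf hfc
      have hfU : Coc (Nv True V S {x}) (f - f [a] • U) := by
        intro l hl
        rw [cob_sub, cob_smul, hfc l hl]
        have : cob U l = 0 := by
          obtain ⟨h1, -, y, rfl, h2⟩ := hl
          have hPl : ∀ a ∈ l, P a := fun a ha =>
            ⟨y, hseg y hx (hxs ▸ hs1) (hxs ▸ hs2), h2 a ha⟩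
          match l, h1, hPl with
          | [], h1, _ => exact absurd rfl (h1 trivial)
          | [a], _, _ => simp [cob_cons, hU0]
          | [a, b], _, hPl =>
            simp [cob_cons, hU0, hU1 a (hPl a (by simp)), hU1 b (hPl b (by simp))]
          | a :: b :: c :: l, _, _ =>
            exact cob_eq_zero fun l' _ h => hU0 l' (by simp at h; omega)
        rw [this]; ring
      refine ⟨f [a], _, (hf.sub (hUA.smul _)).cons (a := a) (by simp [hU1 a hPa]), fun l hl =>
        cob_cons_of_coc haS ha hfU hl⟩
    · rintro ⟨g, hg, hgU⟩
      have h1 := hgU [a] ⟨by simp, by simpa using haS, x, rfl, by simpa using ha⟩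
      rw [hU1 a hPa, cob_cons, hg.nil trivial, cob_nil] at h1
      norm_num at h1

variable [FiniteDimensional ℝ E]

lemma vanAt_genAt {X : Set E} {V : Y → Set E} (hV : LF X V) (m : ℕ) :
    VanAt X V m ∧ GenAt X V m := by
  induction m with
  | zero => exact ⟨VanAt.base V, GenAt.base hV⟩
  | succ m ih => exact ⟨ih.1.succ hV ih.2, GenAt.succ hV ih.1 ih.2⟩

/-- The nerve of a locally finite cover of an open cell by compact convex sets has the compactly
supported cohomology of the cell, compatibly with the passage to subcovers. -/
theorem exists_top_class {X : Set E} {V : Y → Set E} (hV : LF X V) (hX : Flat X ⊤ X)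
    (hne : X.Nonempty) {m : ℕ} (hm : Module.finrank ℝ E = m + 1) :
    (∀ S : Set Y, (∀ x ∈ X, ∃ a ∈ S, x ∈ V a) → ∀ k : ℤ, k ≠ m + 2 → ∀ f, Adm True k f →
      Coc (Nv True V S X) f → Cob True k (Nv True V S X) f) ∧
    ∃ u, Adm True (m + 2) u ∧ Coc (Nv True V Set.univ X) u ∧
      ∀ S : Set Y, (∀ x ∈ X, ∃ a ∈ S, x ∈ V a) →
        Span True (m + 2) (Nv True V S X) u ∧ ¬ Cob True (m + 2) (Nv True V S X) u := by
  have hW : Module.finrank ℝ (⊤ : Submodule ℝ E) = m + 1 := by rw [finrank_top, hm]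
  have hk : (((m + 1 : ℕ) : ℤ) + 1) = m + 2 := by push_cast; ring
  constructor
  · intro S hS k hk' f hf hfc
    exact (vanAt_genAt hV (m + 1)).1 ⊤ X hX hne hW S hS k (by rwa [hk]) f hf hfc
  obtain ⟨h1, h2⟩ := vanAt_genAt hV m
  obtain ⟨p, hp⟩ := hne
  obtain ⟨w, hw⟩ : ∃ w : E, w ≠ 0 := by
    have : Nontrivial E := Module.nontrivial_of_finrank_pos (R := ℝ) (by omega)
    exact exists_ne 0
  obtain ⟨ξ, hξ⟩ : ∃ ξ : E →ₗ[ℝ] ℝ, 0 < ξ w := by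
    by_contra hc
    push Not at hc
    refine hw ((Module.forall_dual_apply_eq_zero_iff ℝ w).1 fun ξ => le_antisymm (hc ξ) ?_)
    have := hc (-ξ)
    simpa using this
  obtain ⟨ε, hε, hq⟩ := hX.opn p hp w trivial
  have hlt : ξ p < ξ (p + ε • w) := by simp; positivity
  obtain ⟨c, hc1, hc2, hc3⟩ := h2 ⊤ X hX hW ξ p hp _ hq hlt
  obtain ⟨U, c', hU, hc', hUc, hcc', hU1, hU2⟩ := exists_suspension hV hX.conv ξ (ξ p) hc1
    (hc2.mono (Nv_mono le_rfl (Set.inter_subset_inter_right _ fun x hx => by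
      have : ξ x = ξ p := hx
      simp only [Set.mem_ofPred_eq, this, le_refl, true_and]
      exact hlt.le)))
  have hk2 : (m : ℤ) + 1 + 1 = m + 2 := by ring
  refine ⟨U, hk2 ▸ hU, hUc, fun S hS => ?_⟩
  have hmono : ∀ A : Set E, Nv True V S A ⊆ Nv True V Set.univ A := fun A =>
    Nv_mono (Set.subset_univ _) le_rfl
  rw [← hk]
  obtain ⟨hs, hn⟩ := hc3 (ξ p) le_rfl hlt.le S hS
  exact gen_conn hV h1 h2 hX hW ξ (w := w) trivial hξ.ne' hp hS hc'
    (fun l hl => hcc' l (hmono _ hl)) (fun l hl => hU1 l (hmono _ hl))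
    (fun l hl => hU2 l (hmono _ hl)) hs hn

end TopClass

section Acyclic

variable {Y E : Type*} [NormedAddCommGroup E] [NormedSpace ℝ E] [FiniteDimensional ℝ E]

lemma acyclic_cochains [Finite Y] {V : Y → Set E} (hV : ∀ a, Convex ℝ (V a))
    (hVc : ∀ a, IsClosed (V a)) (m : ℕ) : ∀ (W : Submodule ℝ E), Module.finrank ℝ W = m →
    ∀ Z : Set E, Convex ℝ Z → IsCompact Z → Z.Nonempty → (∀ x ∈ Z, ∀ y ∈ Z, x - y ∈ W) →
    (∀ x ∈ Z, ∃ a, x ∈ V a) → ∀ (k : ℤ) (f : List Y → ℚ), Adm False k f →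
    Coc (Nv False V Set.univ Z) f → Cob False k (Nv False V Set.univ Z) f := by
  induction m with
  | zero =>
    rintro W hW Z - - ⟨p, hp⟩ hd hS k f hf hfc
    have hZp : ∀ x ∈ Z, x = p := by
      intro x hx
      have h1 := hd x hx p hp
      have h2 := finrank_zero_iff_forall_zero.1 hW ⟨_, h1⟩
      exact sub_eq_zero.1 (congrArg Subtype.val h2)
    obtain ⟨a, ha⟩ := hS p hp
    refine ⟨fun l => f (a :: l), ⟨hf.fin.preimage (fun _ _ _ _ h => (List.cons.inj h).2),
      fun l h => ?_, fun h => h.elim, fun h => h.elim⟩, fun l hl => ?_⟩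
    · have := hf.len _ h
      simp at this
      omega
    · obtain ⟨-, -, x, hx, h3⟩ := hl
      have := hfc (a :: l) ⟨by simp, by simp, x, hx, by
        simpa using ⟨hZp x hx ▸ ha, h3⟩⟩
      rw [cob_cons] at this
      linarith
  | succ m ih =>
    intro W hW Z hZ hZc hne hd hS k f hf hfc
    obtain ⟨w, hw, hw0⟩ : ∃ w ∈ W, w ≠ 0 := by
      have : W ≠ ⊥ := by rintro rfl; simp at hW
      exact Submodule.exists_mem_ne_zero_of_ne_bot this
    obtain ⟨ξ, hξ⟩ : ∃ ξ : E →ₗ[ℝ] ℝ, ξ w ≠ 0 := by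
      by_contra hc
      push Not at hc
      exact hw0 ((Module.forall_dual_apply_eq_zero_iff ℝ w).1 hc)
    have hc : Continuous ξ := ξ.continuous_of_finiteDimensional
    obtain ⟨p, hp, hpmin⟩ := hZc.exists_isMinOn hne hc.continuousOn
    have hall : Z ∩ {x | ξ p ≤ ξ x} = Z := Set.inter_eq_left.2 fun x hx => hpmin hx
    have key := sweep_levels (c := False) (S := Set.univ) hV hZ
      (Cplx.of_star (fun a _ => Set.toFinite _) (Or.inr (Set.toFinite _))) (fun l _ => ?_) ξ (ξ p)
      (fun t ht _ => ⟨t + 1, by simp, fun k => ⟨0, Adm.zero _ _, fun l _ => cob_zero l,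
        fun s hs1 hs2 => ⟨fun f hf hfc => ⟨0, ?_⟩, Or.inl rfl⟩⟩⟩) k f hf (by rwa [hall])
    · rwa [hall] at key
    · have hcl : IsClosed {x | ∀ a ∈ l, x ∈ V a} := by
        simp only [Set.ofPred_forall]
        exact isClosed_biInter fun a _ => hVc a
      exact hZc.inter_right hcl
    · rw [smul_zero, sub_zero]
      rcases (Z ∩ {x | ξ x = s}).eq_empty_or_nonempty with h0 | h0
      · rw [h0]
        refine ⟨0, Adm.zero _ _, ?_⟩
        rintro l ⟨-, -, x, hx, -⟩
        exact hx.elim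
      · refine ih _ (finrank_inf_ker hw hξ hW) _ (hZ.inter (convex_hyperplane ξ.isLinear s))
          (hZc.inter_right (isClosed_eq hc continuous_const)) h0
          (fun x hx y hy => ⟨hd x hx.1 y hy.1, ?_⟩)
          (fun x hx => hS x hx.1) k f hf hfc
        have h1 : ξ x = s := hx.2
        have h2 : ξ y = s := hy.2
        simp [h1, h2]

/-- Nerves of finite covers of compact convex sets by closed convex sets are acyclic. -/
theorem acyclic_chains [Finite Y] {V : Y → Set E} (hV : ∀ a, Convex ℝ (V a))
    (hVc : ∀ a, IsClosed (V a)) {Z : Set E} (hZ : Convex ℝ Z) (hZc : IsCompact Z)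
    (hne : Z.Nonempty) (hcov : ∀ x ∈ Z, ∃ a, x ∈ V a) (z : List Y →₀ ℚ) (k : ℕ)
    (hz : ∀ l ∈ z.support, l.length = k ∧ l ∈ Nv False V Set.univ Z) (hbd : bd z = 0) :
    ∃ w : List Y →₀ ℚ, (∀ l ∈ w.support, l.length = k + 1 ∧ l ∈ Nv False V Set.univ Z) ∧
      bd w = z := by
  classical
  set B : Submodule ℚ (List Y →₀ ℚ) :=
    (Finsupp.supported ℚ ℚ {l | l.length = k + 1 ∧ l ∈ Nv False V Set.univ Z}).map bd with hB
  suffices z ∈ B by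
    obtain ⟨w, hw, hwz⟩ := this
    exact ⟨w, fun l hl => (Finsupp.mem_supported ℚ w).1 hw hl, hwz⟩
  by_contra hzB
  obtain ⟨φ, hφz, hφB⟩ := Submodule.exists_le_ker_of_notMem hzB
  set f : List Y → ℚ := fun l => if l.length = k ∧ l ∈ Nv False V Set.univ Z then
    φ (Finsupp.single l 1) else 0 with hf
  have hfφ : ∀ y : List Y →₀ ℚ, (∀ l ∈ y.support, l.length = k ∧ l ∈ Nv False V Set.univ Z) →
      ev f y = φ y := by
    intro y hy
    rw [ev, Finsupp.linearCombination_apply]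
    conv_rhs => rw [← Finsupp.sum_single y, Finsupp.sum, map_sum]
    refine Finset.sum_congr rfl fun l hl => ?_
    simp only [hf, if_pos (hy l hl), smul_eq_mul]
    rw [← smul_eq_mul, ← map_smul, Finsupp.smul_single, smul_eq_mul, mul_one]
  have hface : ∀ l ∈ Nv False V Set.univ Z, ∀ l' : List Y, l'.Sublist l →
      l' ∈ Nv False V Set.univ Z := by
    rintro l ⟨_, _, p, hp, h⟩ l' hl'
    exact ⟨by simp, by simp, p, hp, fun a ha => h a (hl'.subset ha)⟩
  have hfc : Coc (Nv False V Set.univ Z) f := by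
    intro l hl
    by_cases hlk : l.length = k + 1
    · rw [cob, hfφ]
      · have : φ (bd (Finsupp.single l 1)) = 0 := hφB ⟨_, by
          simpa using Finsupp.single_mem_supported ℚ (1 : ℚ) (show l ∈ {l | l.length = k + 1 ∧
            l ∈ Nv False V Set.univ Z} from ⟨hlk, hl⟩), rfl⟩
        simpa using this
      · intro l' hl'
        have := mem_bdl hl'
        exact ⟨by omega, hface l hl l' this.1⟩
    · exact cob_eq_zero fun l' _ h => if_neg fun h' => hlk (by omega)
  have hfA : Adm False k f := by
    refine ⟨(List.finite_length_eq Y k).subset fun l hl => ?_, fun l hl => ?_, fun h => h.elim,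
      fun h => h.elim⟩
    · by_contra hc
      exact hl (if_neg fun h' => hc h'.1)
    · by_contra hc
      exact hl (if_neg fun h' => hc (by exact_mod_cast h'.1))
  obtain ⟨g, -, hg⟩ := acyclic_cochains hV hVc _ ⊤ rfl Z hZ hZc hne (fun _ _ _ _ => trivial) hcov
    k f hfA hfc
  refine hφz ?_
  rw [← hfφ z hz]
  have : ev f z = ev (cob g) z := by
    simp only [ev, Finsupp.linearCombination_apply, Finsupp.sum]
    exact Finset.sum_congr rfl fun l hl => by rw [hg l (hz l hl).2]
  rw [this, ← ev_bd, hbd, map_zero]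

end Acyclic

end SpTop

namespace SpTop

section Prism

variable {A B : Type*}

lemma map_mem_of_supported {M : Type*} [AddCommGroup M] [Module ℚ M] {s : Set A}
    {N : Submodule ℚ M} (T : (A →₀ ℚ) →ₗ[ℚ] M) (h : ∀ l ∈ s, T (Finsupp.single l 1) ∈ N)
    {z : A →₀ ℚ} (hz : z ∈ Finsupp.supported ℚ ℚ s) : T z ∈ N := by
  rw [Finsupp.supported_eq_span_single] at hz
  have : Submodule.span ℚ ((fun i => Finsupp.single i (1 : ℚ)) '' s) ≤ N.comap T :=
    Submodule.span_le.2 (by rintro _ ⟨l, hl, rfl⟩; exact h l hl)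
  exact this hz

lemma cn_mem {s t : Set (List A)} {a : A} (h : ∀ l ∈ s, a :: l ∈ t) {z : List A →₀ ℚ}
    (hz : z ∈ Finsupp.supported ℚ ℚ s) : cn a z ∈ Finsupp.supported ℚ ℚ t :=
  map_mem_of_supported _ (fun l hl => by
    rw [cn_single]; exact Finsupp.single_mem_supported ℚ 1 (h l hl)) hz

lemma mp_mem {s : Set (List A)} {t : Set (List B)} {r : A → B} (h : ∀ l ∈ s, l.map r ∈ t)
    {z : List A →₀ ℚ} (hz : z ∈ Finsupp.supported ℚ ℚ s) : mp r z ∈ Finsupp.supported ℚ ℚ t :=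
  map_mem_of_supported _ (fun l hl => by
    rw [mp_single]; exact Finsupp.single_mem_supported ℚ 1 (h l hl)) hz

lemma bdl_mem {t : Set (List A)} {l : List A}
    (h : ∀ l', l'.Sublist l → l'.length + 1 = l.length → l' ∈ t) :
    bdl l ∈ Finsupp.supported ℚ ℚ t :=
  (Finsupp.mem_supported ℚ _).2 fun l' hl' => h l' (mem_bdl hl').1 (mem_bdl hl').2

lemma bd_mem {s t : Set (List A)}
    (h : ∀ l ∈ s, ∀ l', l'.Sublist l → l'.length + 1 = l.length → l' ∈ t) {z : List A →₀ ℚ}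
    (hz : z ∈ Finsupp.supported ℚ ℚ s) : bd z ∈ Finsupp.supported ℚ ℚ t :=
  map_mem_of_supported _ (fun l hl => by rw [bd_single, one_smul]; exact bdl_mem (h l hl)) hz

/-- The prism operator between two vertex maps. -/
noncomputable def pr (f g : A → B) : List A → (List B →₀ ℚ)
  | [] => 0
  | a :: l => Finsupp.single (f a :: g a :: l.map g) 1 - cn (f a) (pr f g l)

/-- Linear extension of the prism operator. -/
noncomputable def prism (f g : A → B) : (List A →₀ ℚ) →ₗ[ℚ] (List B →₀ ℚ) :=
  Finsupp.linearCombination ℚ (pr f g)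

@[simp] lemma prism_single (f g : A → B) (l : List A) (c : ℚ) :
    prism f g (Finsupp.single l c) = c • pr f g l := by
  simp [prism]

lemma prism_cn (f g : A → B) (a : A) (z : List A →₀ ℚ) :
    prism f g (cn a z) = cn (f a) (cn (g a) (mp g z)) - cn (f a) (prism f g z) := by
  induction z using Finsupp.induction_linear with
  | zero => simp
  | add x y hx hy => simp only [map_add, hx, hy]; abel
  | single l c => simp [pr, smul_sub]

lemma bd_pr (f g : A → B) (l : List A) : bd (pr f g l) + prism f g (bdl l) =
    Finsupp.single (l.map g) 1 - Finsupp.single (l.map f) 1 := by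
  induction l with
  | nil => simp [pr]
  | cons a l ih =>
    have h1 : Finsupp.single (f a :: g a :: l.map g) (1 : ℚ) =
        cn (f a) (cn (g a) (Finsupp.single (l.map g) 1)) := by simp
    rw [pr, bdl_cons, h1, map_sub, map_sub, prism_cn, bd_cn, bd_cn, bd_cn, mp_bdl, prism_single,
      one_smul, bd_single, one_smul]
    have h2 := congrArg (cn (f a)) ih
    simp only [map_add, map_sub, cn_single] at h2 ⊢
    rw [List.map_cons, List.map_cons]
    rw [← sub_eq_zero] at h2 ⊢
    rw [← h2]
    abel

lemma bd_prism (f g : A → B) (z : List A →₀ ℚ) :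
    bd (prism f g z) + prism f g (bd z) = mp g z - mp f z := by
  induction z using Finsupp.induction_linear with
  | zero => simp
  | add x y hx hy =>
    simp only [map_add]
    rw [add_sub_add_comm, ← hx, ← hy]
    abel
  | single l c =>
    have := congrArg (c • ·) (bd_pr f g l)
    simpa [smul_sub] using this

lemma pr_mem (f g : A → B) (l : List A) : pr f g l ∈ Finsupp.supported ℚ ℚ
    {l' | l'.length = l.length + 1 ∧ ∀ b ∈ l', ∃ a ∈ l, b = f a ∨ b = g a} := by
  induction l with
  | nil => simp [pr]
  | cons a l ih =>
    rw [pr]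
    refine Submodule.sub_mem _ (Finsupp.single_mem_supported ℚ 1 ?_)
      (cn_mem (fun l' hl' => ?_) ih)
    · refine ⟨by simp, ?_⟩
      intro b hb
      simp only [List.mem_cons, List.mem_map] at hb
      rcases hb with rfl | rfl | ⟨c, hc, rfl⟩
      · exact ⟨a, by simp, by simp⟩
      · exact ⟨a, by simp, by simp⟩
      · exact ⟨c, by simp [hc], by simp⟩
    · refine ⟨by simpa using hl'.1, fun b hb => ?_⟩
      rcases List.mem_cons.1 hb with rfl | hb
      · exact ⟨a, by simp, by simp⟩
      · obtain ⟨c, hc, h⟩ := hl'.2 b hb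
        exact ⟨c, by simp [hc], h⟩

lemma prism_mem {f g : A → B} {s : Set (List A)} {t : Set (List B)}
    (h : ∀ l ∈ s, ∀ l', l'.length = l.length + 1 → (∀ b ∈ l', ∃ a ∈ l, b = f a ∨ b = g a) → l' ∈ t)
    {z : List A →₀ ℚ} (hz : z ∈ Finsupp.supported ℚ ℚ s) :
    prism f g z ∈ Finsupp.supported ℚ ℚ t :=
  map_mem_of_supported _ (fun l hl => by
    rw [prism_single, one_smul]
    exact Finsupp.supported_mono (fun l' hl' => h l hl l' hl'.1 hl'.2) (pr_mem f g l)) hz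

end Prism

section Building

section Apartment

variable {A B : Type*}

/-- The apartment associated with a list of hyperbolic pairs. -/
noncomputable def apt : List (A × A) → (List A →₀ ℚ)
  | [] => Finsupp.single [] 1
  | p :: s => cn p.1 (apt s) - cn p.2 (apt s)

lemma bd_apt (s : List (A × A)) : bd (apt s) = 0 := by
  induction s with
  | nil => simp [apt]
  | cons p s ih => simp [apt, bd_cn, ih]

lemma mp_apt (r : A → B) (s : List (A × A)) : mp r (apt s) = apt (s.map (Prod.map r r)) := by
  induction s with
  | nil => simp [apt]
  | cons p s ih => simp [apt, mp_cn, ih]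

end Apartment

variable {L : Type*} [AddCommGroup L] (ω : L →ₗ[ℤ] L →ₗ[ℤ] ℤ)

/-- Lists of length `q` of pairwise orthogonal vectors in `S`. -/
def Orth (S : Set L) (q : ℕ) : Set (List L) :=
  {l | l.length = q ∧ ∀ a ∈ l, a ∈ S ∧ ∀ b ∈ l, ω a b = 0}

/-- Chains on lists of pairwise orthogonal vectors. -/
noncomputable abbrev OC (S : Set L) (q : ℕ) : Submodule ℚ (List L →₀ ℚ) :=
  Finsupp.supported ℚ ℚ (Orth ω S q)

/-- Lists of mutually orthogonal hyperbolic pairs of vectors in `S`. -/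
def Hyp (S : Set L) (s : List (L × L)) : Prop :=
  (∀ p ∈ s, p.1 ∈ S ∧ p.2 ∈ S ∧ ω p.1 p.2 = 1) ∧
    s.Pairwise fun p p' => ω p.1 p'.1 = 0 ∧ ω p.1 p'.2 = 0 ∧ ω p.2 p'.1 = 0 ∧ ω p.2 p'.2 = 0

variable {ω}

lemma Orth.mono {S S' : Set L} (h : S ⊆ S') (q : ℕ) : Orth ω S q ⊆ Orth ω S' q :=
  fun _ hl => ⟨hl.1, fun a ha => ⟨h (hl.2 a ha).1, (hl.2 a ha).2⟩⟩

lemma OC.mono {S S' : Set L} (h : S ⊆ S') (q : ℕ) : OC ω S q ≤ OC ω S' q :=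
  Finsupp.supported_mono (Orth.mono h q)

lemma Orth.cons (hω : ∀ v, ω v v = 0) {S : Set L} {v : L} (hv : v ∈ S) {q : ℕ} {l : List L}
    (hl : l ∈ Orth ω {w | w ∈ S ∧ ω v w = 0} q) : v :: l ∈ Orth ω S (q + 1) := by
  have hsw : ∀ a b, ω a b = 0 → ω b a = 0 := fun a b h => by
    rw [← (LinearMap.IsAlt.neg (B := ω) hω a b), h, neg_zero]
  refine ⟨by simp [hl.1], fun a ha => ?_⟩
  rcases List.mem_cons.1 ha with h | ha
  · subst h
    refine ⟨hv, fun b hb => ?_⟩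
    rcases List.mem_cons.1 hb with rfl | hb
    · exact hω _
    · exact (hl.2 b hb).1.2
  · refine ⟨(hl.2 a ha).1.1, fun b hb => ?_⟩
    rcases List.mem_cons.1 hb with h | hb
    · exact h ▸ hsw _ _ (hl.2 a ha).1.2
    · exact (hl.2 a ha).2 b hb

lemma OC.cn (hω : ∀ v, ω v v = 0) {S : Set L} {v : L} (hv : v ∈ S) {q : ℕ} {z : List L →₀ ℚ}
    (hz : z ∈ OC ω {w | w ∈ S ∧ ω v w = 0} q) : cn v z ∈ OC ω S (q + 1) :=
  cn_mem (fun _ hl => Orth.cons hω hv hl) hz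

lemma Hyp.apt_mem (hω : ∀ v, ω v v = 0) {S : Set L} {s : List (L × L)} (hs : Hyp ω S s) :
    apt s ∈ OC ω S s.length := by
  induction s generalizing S with
  | nil => exact Finsupp.single_mem_supported ℚ 1 ⟨rfl, by simp⟩
  | cons p s ih =>
    obtain ⟨h1, h2⟩ := hs
    rw [List.pairwise_cons] at h2
    rw [List.forall_mem_cons] at h1
    refine Submodule.sub_mem _ (OC.cn hω h1.1.1 (ih ⟨fun p' hp' => ?_, h2.2⟩))
      (OC.cn hω h1.1.2.1 (ih ⟨fun p' hp' => ?_, h2.2⟩))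
    · exact ⟨⟨(h1.2 p' hp').1, (h2.1 p' hp').1⟩, ⟨(h1.2 p' hp').2.1, (h2.1 p' hp').2.1⟩,
        (h1.2 p' hp').2.2⟩
    · exact ⟨⟨(h1.2 p' hp').1, (h2.1 p' hp').2.2.1⟩, ⟨(h1.2 p' hp').2.1, (h2.1 p' hp').2.2.2⟩,
        (h1.2 p' hp').2.2⟩

end Building

end SpTop

namespace SpTop

section Building

variable {L : Type*} [AddCommGroup L] {ω : L →ₗ[ℤ] L →ₗ[ℤ] ℤ}

variable (ω) in
/-- Boundaries and, in the top degree, combinations of apartments. -/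
noncomputable def Tgt (S : Set L) (n q : ℕ) : Submodule ℚ (List L →₀ ℚ) :=
  (OC ω S (q + 1)).map bd ⊔
    Submodule.span ℚ {z | ∃ s, Hyp ω S s ∧ s.length = n ∧ n = q ∧ apt s = z}

lemma Tgt.bd_mem {S : Set L} {n q : ℕ} {z : List L →₀ ℚ} (hz : z ∈ OC ω S (q + 1)) :
    bd z ∈ Tgt ω S n q :=
  Submodule.mem_sup_left ⟨z, hz, rfl⟩

lemma Tgt.apt_mem {S : Set L} {n : ℕ} {s : List (L × L)} (hs : Hyp ω S s) (hn : s.length = n) :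
    apt s ∈ Tgt ω S n n :=
  Submodule.mem_sup_right (Submodule.subset_span ⟨s, hs, hn, rfl, rfl⟩)

lemma Tgt.le {S : Set L} {n q : ℕ} {N : Submodule ℚ (List L →₀ ℚ)}
    (h1 : ∀ z ∈ OC ω S (q + 1), bd z ∈ N)
    (h2 : ∀ s, Hyp ω S s → s.length = n → n = q → apt s ∈ N) : Tgt ω S n q ≤ N := by
  refine sup_le ?_ (Submodule.span_le.2 ?_)
  · rintro _ ⟨z, hz, rfl⟩
    exact h1 z hz
  · rintro _ ⟨s, hs, h3, h4, rfl⟩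
    exact h2 s hs h3 h4

lemma Tgt.bd_eq_zero {S : Set L} {n q : ℕ} {z : List L →₀ ℚ} (hz : z ∈ Tgt ω S n q) :
    bd z = 0 := by
  have : Tgt ω S n q ≤ LinearMap.ker bd := Tgt.le (fun z _ => by simp) fun s _ _ _ => bd_apt s
  exact this hz

lemma Tgt.mp {S S' : Set L} {r : L → L} (h1 : ∀ a ∈ S, r a ∈ S')
    (h2 : ∀ a ∈ S, ∀ b ∈ S, ω (r a) (r b) = ω a b) {n q : ℕ} {z : List L →₀ ℚ}
    (hz : z ∈ Tgt ω S n q) : mp r z ∈ Tgt ω S' n q := by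
  have : Tgt ω S n q ≤ (Tgt ω S' n q).comap (SpTop.mp r) := by
    refine Tgt.le (fun z hz => ?_) fun s hs h3 h4 => ?_
    · rw [Submodule.mem_comap, mp_bd]
      refine Tgt.bd_mem (mp_mem (fun l hl => ?_) hz)
      refine ⟨by simp [hl.1], fun a ha => ?_⟩
      obtain ⟨b, hb, rfl⟩ := List.mem_map.1 ha
      refine ⟨h1 b (hl.2 b hb).1, fun c hc => ?_⟩
      obtain ⟨d, hd, rfl⟩ := List.mem_map.1 hc
      rw [h2 b (hl.2 b hb).1 d (hl.2 d hd).1, (hl.2 b hb).2 d hd]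
    · rw [Submodule.mem_comap, mp_apt, ← h4]
      refine Tgt.apt_mem ⟨fun p hp => ?_, ?_⟩ (by simpa using h3)
      · obtain ⟨p, hp', rfl⟩ := List.mem_map.1 hp
        obtain ⟨h5, h6, h7⟩ := hs.1 p hp'
        exact ⟨h1 _ h5, h1 _ h6, by simpa [h2 _ h5 _ h6] using h7⟩
      · rw [List.pairwise_map]
        refine hs.2.imp_of_mem fun {p p'} hp hp' h => ?_
        obtain ⟨h5, h6, -⟩ := hs.1 p hp
        obtain ⟨h7, h8, -⟩ := hs.1 p' hp'
        simpa [h2 _ h5 _ h7, h2 _ h5 _ h8, h2 _ h6 _ h7, h2 _ h6 _ h8] using h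
  exact this hz

/-- The nonzero vectors of a submodule. -/
def nz (M : Submodule ℤ L) : Set L := {w | w ∈ M ∧ w ≠ 0}

variable (ω) in
/-- Every nonzero vector is a multiple of a vector belonging to a hyperbolic pair. -/
def Uni (M : Submodule ℤ L) : Prop :=
  ∀ w ∈ nz M, ∃ k : ℤ, ∃ w₀ ∈ M, w = k • w₀ ∧ ∃ w' ∈ M, ω w₀ w' = 1

/-- Fewer than `2 n` linear conditions have a common nonzero solution. -/
def Big (n : ℕ) (M : Submodule ℤ L) : Prop :=
  ∀ φ : List (L →ₗ[ℤ] ℤ), φ.length < 2 * n → ∃ w ∈ nz M, ∀ f ∈ φ, f w = 0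

variable (ω) in
/-- The orthogonal complement of a pair of vectors. -/
def perp (M : Submodule ℤ L) (v v' : L) : Submodule ℤ L :=
  M ⊓ LinearMap.ker (ω v) ⊓ LinearMap.ker (ω v')

lemma mem_perp {M : Submodule ℤ L} {v v' w : L} :
    w ∈ perp ω M v v' ↔ w ∈ M ∧ ω v w = 0 ∧ ω v' w = 0 := by
  simp [perp, and_assoc]

lemma Big.perp {n : ℕ} {M : Submodule ℤ L} (hM : Big (n + 1) M) (v v' : L) :
    Big n (perp ω M v v') := by
  intro φ hφ
  obtain ⟨w, hw, h⟩ := hM (ω v :: ω v' :: φ) (by simp; omega)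
  exact ⟨w, ⟨mem_perp.2 ⟨hw.1, h _ (by simp), h _ (by simp)⟩, hw.2⟩,
    fun f hf => h f (by simp [hf])⟩

lemma Uni.perp (hω : ω.IsAlt) {M : Submodule ℤ L} (hM : Uni ω M) {v v' : L} (hv : v ∈ M)
    (hv' : v' ∈ M) (h : ω v v' = 1) : Uni ω (perp ω M v v') := by
  rintro w ⟨hw, hw0⟩
  obtain ⟨h1, h2, h3⟩ := mem_perp.1 hw
  obtain ⟨k, w₀, hw₀, rfl, w', hw', h4⟩ := hM w ⟨h1, hw0⟩
  have hk : k ≠ 0 := by rintro rfl; simp at hw0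
  have h5 : ω v w₀ = 0 := by simpa [hk] using h2
  have h6 : ω v' w₀ = 0 := by simpa [hk] using h3
  have h7 : ω v' v = -1 := by rw [← hω.neg v v', h]
  have h8 : ω w₀ v = 0 := by rw [← hω.neg v w₀, h5, neg_zero]
  have h9 : ω w₀ v' = 0 := by rw [← hω.neg v' w₀, h6, neg_zero]
  refine ⟨k, w₀, mem_perp.2 ⟨hw₀, h5, h6⟩, rfl, w' + ω v' w' • v - ω v w' • v', mem_perp.2
    ⟨M.sub_mem (M.add_mem hw' (M.smul_mem _ hv)) (M.smul_mem _ hv'), ?_, ?_⟩, ?_⟩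
  · simp [hω v, h]
  · simp [hω v', h7]
  · simp [h8, h9, h4]

lemma exists_orthogonal_partner (hω : ω.IsAlt) {M : Submodule ℤ L} {v v₀ : L} (hv₀ : v₀ ∈ M)
    (h : ω v v₀ = 1) (s : List (L × L)) (hs : Hyp ω {w | w ∈ M ∧ ω v w = 0} s) :
    ∃ v' ∈ M, ω v v' = 1 ∧ ∀ p ∈ s, ω v' p.1 = 0 ∧ ω v' p.2 = 0 := by
  induction s with
  | nil => exact ⟨v₀, hv₀, h, by simp⟩
  | cons p s ih =>
    obtain ⟨h1, h2⟩ := hs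
    rw [List.pairwise_cons] at h2
    rw [List.forall_mem_cons] at h1
    obtain ⟨v', hv', h3, h4⟩ := ih ⟨h1.2, h2.2⟩
    obtain ⟨⟨⟨ha, hva⟩, ⟨hb, hvb⟩, hab⟩, -⟩ := h1
    have hba : ω p.2 p.1 = -1 := by rw [← hω.neg p.1 p.2, hab]
    refine ⟨v' - ω v' p.2 • p.1 + ω v' p.1 • p.2, M.add_mem (M.sub_mem hv' (M.smul_mem _ ha))
      (M.smul_mem _ hb), by simp [hva, hvb, h3], ?_⟩
    rw [List.forall_mem_cons]
    refine ⟨?_, fun p' hp' => ?_⟩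
    · simp [hba, hab, hω p.1, hω p.2]
    · obtain ⟨h5, h6, h7, h8⟩ := h2.1 p' hp'
      simp [h4 p' hp', h5, h6, h7, h8]

/-- A vector which is not parallel to a lower one has a hyperbolic partner. -/
lemma exists_partner (hω : ω.IsAlt) {M : Submodule ℤ L} (hM : Uni ω M) {e v : L} (hv : v ∈ nz M)
    (he : ω e v ≠ 0) {low : Set L} (hlow : ∀ w, |ω e w| < |ω e v| → w ∈ low)
    (hpar : ∀ u ∈ {w | (w ∈ nz M ∧ w ∈ low) ∧ ω v w = 0}, ∃ w, ω v w = 0 ∧ ω u w ≠ 0) :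
    ∃ v' ∈ M, ω v v' = 1 := by
  obtain ⟨k, v₀, hv₀, hvk, v', hv', h1⟩ := hM v hv
  have hk0 : k ≠ 0 := by rintro rfl; exact hv.2 (by simpa using hvk)
  by_cases hk1 : |k| ≤ 1
  · rcases (show k = 1 ∨ k = -1 by rw [abs_le] at hk1; omega) with rfl | rfl
    · exact ⟨v', hv', by rw [hvk]; simpa using h1⟩
    · exact ⟨-v', M.neg_mem hv', by rw [hvk]; simpa using h1⟩
  · exfalso
    have h2 : ω e v = k * ω e v₀ := by
      conv_lhs => rw [hvk]
      simp
    have h3 : ω e v₀ ≠ 0 := by intro h; exact he (by rw [h2, h, mul_zero])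
    obtain ⟨w, hw1, hw2⟩ := hpar v₀ ⟨⟨⟨hv₀, by rintro rfl; simp at h3⟩, hlow _ (by
      rw [h2, abs_mul]
      have := abs_pos.2 h3
      nlinarith)⟩, by rw [hvk]; simp [hω v₀]⟩
    rw [hvk] at hw1
    simp [hk0, hw2] at hw1

/-- Cycles in the lower link of a vector. -/
lemma link_mem_Tgt (hω : ω.IsAlt) {n : ℕ} (ih : ∀ M : Submodule ℤ L, Uni ω M → Big n M →
      ∀ q ≤ n, ∀ z ∈ OC ω (nz M) q, bd z = 0 → z ∈ Tgt ω (nz M) n q)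
    {M : Submodule ℤ L} (hM : Uni ω M) (hB : Big (n + 1) M) {e v : L} (hv : v ∈ nz M)
    (he : ω e v ≠ 0) {low : Set L} (hlow : ∀ w, |ω e w| < |ω e v| → w ∈ low) {q : ℕ} (hq : q ≤ n)
    {c : List L →₀ ℚ} (hc : c ∈ OC ω {w | (w ∈ nz M ∧ w ∈ low) ∧ ω v w = 0} q) (hbd : bd c = 0)
    (hpar : ∀ u ∈ {w | (w ∈ nz M ∧ w ∈ low) ∧ ω v w = 0}, ∃ w, ω v w = 0 ∧ ω u w ≠ 0) :
    c ∈ Tgt ω {w | (w ∈ nz M ∧ w ∈ low) ∧ ω v w = 0} n q := by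
  classical
  set lk : Set L := {w | (w ∈ nz M ∧ w ∈ low) ∧ ω v w = 0} with hlk
  obtain ⟨v', hv', hvv'⟩ := exists_partner hω hM hv he hlow hpar
  have hv'v : ω v' v = -1 := by rw [← hω.neg v v', hvv']
  set π : L → L := fun w => w + ω v' w • v with hπ
  set red : L → L := fun w => w - (ω e w / ω e v) • v with hred
  set ρ : L → L := fun w => if w ∈ low then w else red w with hρ
  have hredlow : ∀ w, red w ∈ low := fun w => hlow _ (by
    have h1 : ω e (red w) = ω e w % ω e v := by
      simp only [hred, map_sub, map_smul, smul_eq_mul, Int.emod_def]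
      ring
    rw [h1, abs_of_nonneg (Int.emod_nonneg _ he)]
    exact Int.emod_lt_abs _ he)
  have hρlow : ∀ w, ρ w ∈ low := fun w => by
    simp only [hρ]
    split_ifs with h
    · exact h
    · exact hredlow w
  have hρM : ∀ w ∈ M, ρ w ∈ M := fun w hw => by
    simp only [hρ]
    split_ifs with h
    · exact hw
    · exact M.sub_mem hw (M.smul_mem _ hv.1)
  have hρv : ∀ w, ∃ k : ℤ, ρ w = w + k • v := fun w => by
    simp only [hρ]
    split_ifs with h
    · exact ⟨0, by simp⟩
    · exact ⟨-(ω e w / ω e v), by simp [hred, sub_eq_add_neg]⟩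
  have hωv : ∀ a b : L, ∀ k l : ℤ, ω v a = 0 → ω v b = 0 → ω (a + k • v) (b + l • v) = ω a b := by
    intro a b k l ha hb
    have : ω a v = 0 := by rw [← hω.neg v a, ha, neg_zero]
    simp [hb, this, hω v]
  have hvk : ∀ a : L, ∀ k : ℤ, ω v (a + k • v) = ω v a := by simp [hω v]
  have hπperp : ∀ w ∈ lk, π w ∈ nz (perp ω M v v') := by
    rintro w ⟨⟨⟨hw, hw0⟩, hwl⟩, hvw⟩
    refine ⟨mem_perp.2 ⟨M.add_mem hw (M.smul_mem _ hv.1), by simp [hπ, hvw, hω v], by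
      simp [hπ, hv'v]⟩, fun h0 => ?_⟩
    obtain ⟨x, hx1, hx2⟩ := hpar w ⟨⟨⟨hw, hw0⟩, hwl⟩, hvw⟩
    have h1 : ω (π w) x = 0 := by rw [h0]; simp
    simp [hπ, hx1] at h1
    exact hx2 h1
  have hρlk : ∀ w ∈ nz (perp ω M v v'), ρ w ∈ lk := by
    rintro w ⟨hw, hw0⟩
    obtain ⟨h1, h2, h3⟩ := mem_perp.1 hw
    obtain ⟨k, hk⟩ := hρv w
    refine ⟨⟨⟨hρM w h1, fun h0 => ?_⟩, hρlow w⟩, by rw [hk, hvk, h2]⟩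
    have h4 : ω v' (ρ w) = 0 := by rw [h0]; simp
    rw [hk] at h4 h0
    simp [h3, hv'v] at h4
    exact hw0 (by simpa [h4] using h0)
  have hπv : ∀ w, ∃ k : ℤ, π w = w + k • v := fun w => ⟨_, rfl⟩
  have hρπv : ∀ w, ∃ k : ℤ, (ρ ∘ π) w = w + k • v := fun w => by
    obtain ⟨k, hk⟩ := hρv (π w)
    exact ⟨ω v' w + k, by rw [Function.comp, hk, add_smul, add_assoc]⟩
  have hρ1 : mp (ρ ∘ π) c ∈ Tgt ω lk n q := by
    have h1 : mp (ρ ∘ π) c = mp ρ (mp π c) := by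
      simp only [mp, Finsupp.lmapDomain_apply, ← Finsupp.mapDomain_comp]
      congr 1
      funext l
      simp
    rw [h1]
    refine Tgt.mp hρlk (fun a ha b hb => ?_) (ih _ (hM.perp hω hv.1 hv' hvv') (hB.perp v v') q hq
      (mp π c) (mp_mem (fun l hl => ?_) hc)
      (by rw [← mp_bd, hbd, map_zero]))
    · obtain ⟨k, hk⟩ := hρv a
      obtain ⟨k', hk'⟩ := hρv b
      rw [hk, hk', hωv _ _ _ _ (mem_perp.1 ha.1).2.1 (mem_perp.1 hb.1).2.1]
    · refine ⟨by simp [hl.1], fun a ha => ?_⟩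
      obtain ⟨b, hb, rfl⟩ := List.mem_map.1 ha
      refine ⟨hπperp b (hl.2 b hb).1, fun d hd => ?_⟩
      obtain ⟨x, hx, rfl⟩ := List.mem_map.1 hd
      rw [hωv _ _ _ _ (hl.2 b hb).1.2 (hl.2 x hx).1.2, (hl.2 b hb).2 x hx]
  have hprism := bd_prism id (ρ ∘ π) c
  have hid : mp id c = c := by simp [mp]
  rw [hbd, map_zero, add_zero, hid] at hprism
  have h2 : c = mp (ρ ∘ π) c - bd (prism id (ρ ∘ π) c) := by rw [hprism]; abel
  rw [h2]
  refine Submodule.sub_mem _ hρ1 (Tgt.bd_mem (prism_mem (fun l hl l' h3 h4 => ?_) hc))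
  refine ⟨by rw [h3, hl.1], fun a ha => ?_⟩
  have h5 : ∀ a ∈ l', ∃ x ∈ l, ∃ k : ℤ, a = x + k • v ∧ a ∈ lk := fun a ha => by
    obtain ⟨x, hx, h | h⟩ := h4 a ha
    · exact ⟨x, hx, 0, by simpa using h, h ▸ (hl.2 x hx).1⟩
    · obtain ⟨k, hk⟩ := hρπv x
      exact ⟨x, hx, k, by rw [h, hk], h ▸ hρlk _ (hπperp x (hl.2 x hx).1)⟩
  obtain ⟨x, hx, k, rfl, hk⟩ := h5 a ha
  refine ⟨hk, fun b hb => ?_⟩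
  obtain ⟨y, hy, l, rfl, hl'⟩ := h5 b hb
  rw [hωv _ _ _ _ (hl.2 x hx).1.2 (hl.2 y hy).1.2, (hl.2 x hx).2 y hy]

lemma cn_bd_link_mem (hω : ω.IsAlt) {n : ℕ} {M : Submodule ℤ L} {v : L} (hv : v ∈ nz M)
    {low : Set L} {q : ℕ} {b : List L →₀ ℚ}
    (hb : b ∈ OC ω {w | (w ∈ nz M ∧ w ∈ low) ∧ ω v w = 0} (q + 1)) :
    cn v (bd b) ∈ OC ω {w | w ∈ nz M ∧ w ∈ low} (q + 1) ⊔ Tgt ω (nz M) (n + 1) (q + 1) := by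
  have hlkS : {w | (w ∈ nz M ∧ w ∈ low) ∧ ω v w = 0} ⊆ {w | w ∈ nz M ∧ w ∈ low} :=
    fun w hw => hw.1
  have hlkv : {w | (w ∈ nz M ∧ w ∈ low) ∧ ω v w = 0} ⊆ {w | w ∈ nz M ∧ ω v w = 0} :=
    fun w hw => ⟨hw.1.1, hw.2⟩
  have h1 : cn v (bd b) = b - bd (cn v b) := by rw [bd_cn]; abel
  rw [h1]
  exact Submodule.sub_mem _ (Submodule.mem_sup_left (OC.mono hlkS _ hb))
    (Submodule.mem_sup_right (Tgt.bd_mem (OC.cn hω hv (OC.mono hlkv _ hb))))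

/-- Joining a vector to the lower link moves chains below this vector. -/
lemma cn_link_mem (hω : ω.IsAlt) {n : ℕ} {M : Submodule ℤ L} {e v v₀ : L} (hv : v ∈ nz M)
    (he : ω e v ≠ 0) {low : Set L} (hlow : ∀ w, |ω e w| < |ω e v| → w ∈ low) (hv₀ : v₀ ∈ M)
    (h : ω v v₀ = 1) {q : ℕ} {c : List L →₀ ℚ}
    (hc : c ∈ Tgt ω {w | (w ∈ nz M ∧ w ∈ low) ∧ ω v w = 0} n q) :
    cn v c ∈ OC ω {w | w ∈ nz M ∧ w ∈ low} (q + 1) ⊔ Tgt ω (nz M) (n + 1) (q + 1) := by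
  set lk : Set L := {w | (w ∈ nz M ∧ w ∈ low) ∧ ω v w = 0} with hlk
  suffices Tgt ω lk n q ≤
      (OC ω {w | w ∈ nz M ∧ w ∈ low} (q + 1) ⊔ Tgt ω (nz M) (n + 1) (q + 1)).comap (cn v) from
    this hc
  refine Tgt.le (fun b hb => ?_) fun s hs hsn hnq => ?_
  · rw [Submodule.mem_comap]
    exact cn_bd_link_mem hω hv hb
  · rw [Submodule.mem_comap]
    subst hnq
    obtain ⟨v₁, hv₁, h1, h2⟩ := exists_orthogonal_partner hω hv₀ h s
      ⟨fun p hp => ⟨⟨(hs.1 p hp).1.1.1.1, (hs.1 p hp).1.2⟩,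
        ⟨(hs.1 p hp).2.1.1.1.1, (hs.1 p hp).2.1.2⟩, (hs.1 p hp).2.2⟩, hs.2⟩
    set v' := v₁ - (ω e v₁ / ω e v) • v with hv'
    have hv'M : v' ∈ M := M.sub_mem hv₁ (M.smul_mem _ hv.1)
    have hvv' : ω v v' = 1 := by simp [hv', hω v, h1]
    have hv'0 : v' ≠ 0 := by intro h0; simp [h0] at hvv'
    have hperp : ∀ p ∈ s, ω v' p.1 = 0 ∧ ω v' p.2 = 0 := fun p hp => by
      simp [hv', h2 p hp, (hs.1 p hp).1.2, (hs.1 p hp).2.1.2]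
    have hv'low : v' ∈ low := hlow _ (by
      have h1 : ω e v' = ω e v₁ % ω e v := by
        simp only [hv', map_sub, map_smul, smul_eq_mul, Int.emod_def]
        ring
      rw [h1, abs_of_nonneg (Int.emod_nonneg _ he)]
      exact Int.emod_lt_abs _ he)
    have h3 : cn v (apt s) = cn v' (apt s) + apt ((v, v') :: s) := by
      simp [apt]
    rw [h3]
    have hs' : Hyp ω {w | (w ∈ nz M ∧ w ∈ low) ∧ ω v' w = 0} s :=
      ⟨fun p hp => ⟨⟨(hs.1 p hp).1.1, (hperp p hp).1⟩, ⟨(hs.1 p hp).2.1.1, (hperp p hp).2⟩,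
        (hs.1 p hp).2.2⟩, hs.2⟩
    have h4 := OC.cn (S := {w | w ∈ nz M ∧ w ∈ low}) hω ⟨⟨hv'M, hv'0⟩, hv'low⟩ (hs'.apt_mem hω)
    rw [hsn] at h4
    refine Submodule.add_mem _ (Submodule.mem_sup_left h4)
      (Submodule.mem_sup_right (Tgt.apt_mem ⟨?_, ?_⟩ (by simp [hsn])))
    · rw [List.forall_mem_cons]
      exact ⟨⟨hv, ⟨hv'M, hv'0⟩, hvv'⟩, fun p hp =>
        ⟨(hs.1 p hp).1.1.1, (hs.1 p hp).2.1.1.1, (hs.1 p hp).2.2⟩⟩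
    · rw [List.pairwise_cons]
      exact ⟨fun p hp => ⟨(hs.1 p hp).1.2, (hs.1 p hp).2.1.2, (hperp p hp).1, (hperp p hp).2⟩, hs.2⟩

open Classical in
/-- **Solomon–Tits for isotropic vectors.** Cycles of pairwise orthogonal vectors are boundaries
up to combinations of apartments. -/
theorem building [Countable L] (hω : ω.IsAlt) (n : ℕ) : ∀ M : Submodule ℤ L, Uni ω M → Big n M →
    ∀ q ≤ n, ∀ z ∈ OC ω (nz M) q, bd z = 0 → z ∈ Tgt ω (nz M) n q := by
  induction n with
  | zero =>
    intro M _ _ q hq z hz _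
    obtain rfl : q = 0 := by omega
    have : z = z [] • apt [] := by
      ext l
      rcases eq_or_ne l [] with rfl | hl
      · simp [apt]
      · have : l ∉ z.support := fun h => hl (by simpa using ((Finsupp.mem_supported ℚ _).1 hz h).1)
        simp [apt, hl, Finsupp.notMem_support_iff.1 this]
    rw [this]
    exact Submodule.smul_mem _ _ (Tgt.apt_mem ⟨by simp, by simp⟩ rfl)
  | succ n ih =>
    intro M hM hB q hq
    obtain ⟨e, he, -⟩ := hB [] (by simp)
    obtain ⟨enc, henc⟩ := Countable.exists_injective_nat L
    set key : L → ℕ ×ₗ ℕ := fun w => toLex ((ω e w).natAbs, enc w) with hkey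
    have hkinj : Function.Injective key := fun a b h => henc (congrArg (fun x => (ofLex x).2) h)
    suffices ∀ κ : ℕ ×ₗ ℕ, ∀ z ∈ OC ω {w | w ∈ nz M ∧ key w < κ} q, bd z = 0 →
        z ∈ Tgt ω (nz M) (n + 1) q by
      intro z hz hbd
      set F : Finset L := z.support.biUnion List.toFinset
      set κ : ℕ ×ₗ ℕ := toLex (F.sup (fun w => (ω e w).natAbs) + 1, 0)
      refine this κ z ((Finsupp.mem_supported ℚ _).2 fun l hl => ?_) hbd
      have h1 := (Finsupp.mem_supported ℚ _).1 hz hl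
      refine ⟨h1.1, fun a ha => ⟨⟨(h1.2 a ha).1, ?_⟩, (h1.2 a ha).2⟩⟩
      have : a ∈ F := Finset.mem_biUnion.2 ⟨l, hl, by simpa using ha⟩
      have := Finset.le_sup (f := fun w => (ω e w).natAbs) this
      exact Prod.Lex.toLex_lt_toLex.2 (Or.inl (by simp only at this ⊢; omega))
    intro κ
    induction κ using WellFoundedLT.induction with
    | ind κ IH =>
    intro z hz hbd
    set F : Finset L := z.support.biUnion List.toFinset with hF
    have hzF : z ∈ OC ω {w | w ∈ nz M ∧ w ∈ F} q := (Finsupp.mem_supported ℚ _).2 fun l hl => by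
      have h1 := (Finsupp.mem_supported ℚ _).1 hz hl
      exact ⟨h1.1, fun a ha => ⟨⟨(h1.2 a ha).1.1, Finset.mem_biUnion.2 ⟨l, hl, by simpa using ha⟩⟩,
        (h1.2 a ha).2⟩⟩
    by_cases h0 : ∀ a ∈ F, ω e a = 0
    · have h1 : bd (cn e z) = z := by rw [bd_cn, hbd, map_zero, sub_zero]
      rw [← h1]
      have h2 : {w | w ∈ nz M ∧ w ∈ F} ⊆ {w | w ∈ nz M ∧ ω e w = 0} :=
        fun w hw => ⟨hw.1, h0 w hw.2⟩
      exact Tgt.bd_mem (OC.cn hω he (OC.mono h2 q hzF))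
    push Not at h0
    obtain ⟨a, ha, hea⟩ := h0
    obtain ⟨v, hvF, hvmax⟩ := F.exists_max_image key ⟨a, ha⟩
    have hev : ω e v ≠ 0 := by
      intro h
      rcases Prod.Lex.toLex_le_toLex.1 (hvmax a ha) with h1 | h1
      · simp [h] at h1
      · simp [h, hea] at h1
    obtain ⟨l₀, hl₀, hvl₀⟩ := Finset.mem_biUnion.1 hvF
    rw [List.mem_toFinset] at hvl₀
    have hl₀' := (Finsupp.mem_supported ℚ _).1 hz hl₀
    obtain ⟨⟨hvM, hvκ⟩, -⟩ := hl₀'.2 v hvl₀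
    obtain ⟨q, rfl⟩ : ∃ p, q = p + 1 := by
      refine ⟨q - 1, ?_⟩
      have := List.length_pos_of_mem hvl₀
      have := hl₀'.1
      omega
    set low : Set L := {w | key w < key v} with hlowdef
    have hlow : ∀ w, |ω e w| < |ω e v| → w ∈ low := fun w hw =>
      Prod.Lex.toLex_lt_toLex.2 (Or.inl (by
        rw [Int.abs_eq_natAbs, Int.abs_eq_natAbs] at hw
        exact_mod_cast hw))
    set lk : Set L := {w | (w ∈ nz M ∧ w ∈ low) ∧ ω v w = 0} with hlk
    set z₁ := z.filter fun l => v ∉ l with hz₁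
    set z₂ := z.filter fun l => v ∈ l with hz₂
    have hz₁₂ : z = z₂ + z₁ := (Finsupp.filter_add_filter_not z fun l => v ∈ l).symm
    have hmax : ∀ l ∈ z.support, ∀ a ∈ l, a ≠ v → a ∈ low := fun l hl a ha hav => by
      have : a ∈ F := Finset.mem_biUnion.2 ⟨l, hl, by simpa using ha⟩
      exact lt_of_le_of_ne (hvmax a this) fun h => hav (hkinj h)
    have hz₁m : z₁ ∈ OC ω {w | w ∈ nz M ∧ w ∈ low} (q + 1) :=
      (Finsupp.mem_supported ℚ _).2 fun l hl => by
        rw [hz₁, Finsupp.support_filter, Finset.mem_coe, Finset.mem_filter] at hl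
        have h1 := (Finsupp.mem_supported ℚ _).1 hz hl.1
        exact ⟨h1.1, fun a ha => ⟨⟨(h1.2 a ha).1.1,
          hmax l hl.1 a ha fun h => hl.2 (h ▸ ha)⟩, (h1.2 a ha).2⟩⟩
    have hz₂m : z₂ ∈ OC ω {w | w ∈ nz M ∧ ω v w = 0} (q + 1) :=
      (Finsupp.mem_supported ℚ _).2 fun l hl => by
        rw [hz₂, Finsupp.support_filter, Finset.mem_coe, Finset.mem_filter] at hl
        have h1 := (Finsupp.mem_supported ℚ _).1 hz hl.1
        exact ⟨h1.1, fun a ha => ⟨⟨(h1.2 a ha).1.1, (h1.2 v hl.2).2 a ha⟩, (h1.2 a ha).2⟩⟩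
    have hface : ∀ S : Set L, ∀ p, ∀ l ∈ Orth ω S (p + 1), ∀ l', l'.Sublist l →
        l'.length + 1 = l.length → l' ∈ Orth ω S p := fun S p l hl l' h1 h2 =>
      ⟨by have := hl.1; omega, fun a ha => ⟨(hl.2 a (h1.subset ha)).1,
        fun b hb => (hl.2 a (h1.subset ha)).2 b (h1.subset hb)⟩⟩
    have hc : bd z₂ ∈ OC ω lk q := by
      have h1 : bd z₂ = -bd z₁ := by
        rw [hz₁₂, map_add] at hbd
        exact eq_neg_of_add_eq_zero_left hbd
      have h2 := bd_mem (hface _ q) hz₂m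
      have h3 : bd z₂ ∈ OC ω {w | w ∈ nz M ∧ w ∈ low} q := by
        rw [h1]
        exact Submodule.neg_mem _ (bd_mem (hface _ q) hz₁m)
      refine (Finsupp.mem_supported ℚ _).2 fun l hl => ?_
      have h4 := (Finsupp.mem_supported ℚ _).1 h2 hl
      have h5 := (Finsupp.mem_supported ℚ _).1 h3 hl
      exact ⟨h4.1, fun a ha => ⟨⟨(h5.2 a ha).1, (h4.2 a ha).1.2⟩, (h4.2 a ha).2⟩⟩
    have hcn : cn v (bd z₂) ∈
        OC ω {w | w ∈ nz M ∧ w ∈ low} (q + 1) ⊔ Tgt ω (nz M) (n + 1) (q + 1) := by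
      by_cases hpar : ∃ u ∈ lk, ∀ w, ω v w = 0 → ω u w = 0
      · obtain ⟨u, hu, h⟩ := hpar
        have h1 : bd (cn u (bd z₂)) = bd z₂ := by rw [bd_cn, bd_bd, map_zero, sub_zero]
        rw [← h1]
        have h2 : lk ⊆ {w | w ∈ lk ∧ ω u w = 0} := fun w hw => ⟨hw, h w hw.2⟩
        exact cn_bd_link_mem hω hvM (OC.cn hω hu (OC.mono h2 q hc))
      · push Not at hpar
        obtain ⟨v₀, hv₀, hvv₀⟩ := exists_partner hω hM hvM hev hlow hpar
        exact cn_link_mem hω hvM hev hlow hv₀ hvv₀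
          (link_mem_Tgt hω ih hM hB hvM hev hlow (by omega) hc (bd_bd _) hpar)
    have hz₂v : bd (cn v (z₂ - cn v (bd z₂))) = z₂ - cn v (bd z₂) := by
      rw [bd_cn, map_sub, bd_cn, bd_bd]
      simp
    have hz₂T : z₂ - cn v (bd z₂) ∈ Tgt ω (nz M) (n + 1) (q + 1) := by
      rw [← hz₂v]
      refine Tgt.bd_mem (OC.cn hω hvM (Submodule.sub_mem _ hz₂m ?_))
      refine OC.cn hω (show v ∈ {w | w ∈ nz M ∧ ω v w = 0} from ⟨hvM, hω v⟩) (OC.mono ?_ q hc)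
      exact fun w hw => ⟨⟨hw.1.1, hw.2⟩, hw.2⟩
    obtain ⟨y, hy, t, ht, hyt⟩ := Submodule.mem_sup.1 hcn
    have hz' : z = (z₁ + y) + (t + (z₂ - cn v (bd z₂))) := by
      rw [← hyt]
      nth_rw 1 [hz₁₂]
      abel
    have hT := Submodule.add_mem _ ht hz₂T
    rw [hz']
    refine Submodule.add_mem _ (IH (key v) hvκ _ (Submodule.add_mem _ hz₁m hy) ?_) hT
    have h1 := Tgt.bd_eq_zero hT
    rw [hz', map_add, h1, add_zero] at hbd
    exact hbd

end Building

end SpTop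

namespace SpTop

open Matrix

section Symplectic

variable {n : ℕ} {R : Type*} [CommRing R]

variable (n R) in
/-- The standard symplectic form. -/
noncomputable def om : (Fin n ⊕ Fin n → R) →ₗ[R] (Fin n ⊕ Fin n → R) →ₗ[R] R :=
  Matrix.toLinearMap₂' R (J (Fin n) R)

lemma om_apply (v w : Fin n ⊕ Fin n → R) : om n R v w = v ⬝ᵥ (J (Fin n) R *ᵥ w) :=
  Matrix.toLinearMap₂'_apply' _ _ _

lemma om_eq_sum (v w : Fin n ⊕ Fin n → R) :
    om n R v w = ∑ i, (v (.inr i) * w (.inl i) - v (.inl i) * w (.inr i)) := by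
  rw [om_apply, Matrix.J]
  conv_lhs => rw [← Sum.elim_comp_inl_inr w]
  rw [Matrix.fromBlocks_mulVec]
  simp only [Matrix.zero_mulVec, Matrix.neg_mulVec, Matrix.one_mulVec, zero_add, add_zero,
    dotProduct, Fintype.sum_sum_type, Sum.elim_inl, Sum.elim_inr, Pi.neg_apply,
    Function.comp_apply, Sum.elim_comp_inl, Sum.elim_comp_inr]
  rw [Finset.sum_sub_distrib]
  simp only [mul_neg, Finset.sum_neg_distrib]
  ring

lemma om_isAlt : (om n R).IsAlt := fun v => by
  rw [om_eq_sum]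
  exact Finset.sum_eq_zero fun i _ => by ring

lemma om_swap (v w : Fin n ⊕ Fin n → R) : om n R w v = -om n R v w := by
  rw [← (om_isAlt (n := n) (R := R)).neg v w]

@[simp] lemma om_self (v : Fin n ⊕ Fin n → R) : om n R v v = 0 := om_isAlt v

/-- The dual vector recovering coordinates. -/
lemma om_neg_J (v w : Fin n ⊕ Fin n → R) : om n R v (-(J (Fin n) R *ᵥ w)) = v ⬝ᵥ w := by
  rw [om_apply, Matrix.mulVec_neg, Matrix.mulVec_mulVec, J_squared, Matrix.neg_mulVec,
    Matrix.one_mulVec, dotProduct_neg, dotProduct_neg, neg_neg]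

lemma mem_of_om {A : Matrix (Fin n ⊕ Fin n) (Fin n ⊕ Fin n) R}
    (h : ∀ v w, om n R (A *ᵥ v) (A *ᵥ w) = om n R v w) : A ∈ symplecticGroup (Fin n) R := by
  rw [SymplecticGroup.mem_iff']
  refine Matrix.ext_of_mulVec_single fun j => dotProduct_eq _ _ fun v => ?_
  generalize (Pi.single j 1 : Fin n ⊕ Fin n → R) = w
  rw [dotProduct_comm _ v, dotProduct_comm _ v, ← om_apply, ← h, om_apply,
    ← Matrix.vecMul_transpose A v, ← Matrix.dotProduct_mulVec, Matrix.mulVec_mulVec,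
    Matrix.mulVec_mulVec]

/-- The rotation in the plane of a hyperbolic pair. -/
noncomputable def rot (v v' : Fin n ⊕ Fin n → R) (c s : R) :
    Matrix (Fin n ⊕ Fin n) (Fin n ⊕ Fin n) R :=
  1 + vecMulVec ((c - 1) • v + s • v') (J (Fin n) R *ᵥ v') -
    vecMulVec (-s • v + (c - 1) • v') (J (Fin n) R *ᵥ v)

lemma rot_mulVec (v v' : Fin n ⊕ Fin n → R) (c s : R) (x : Fin n ⊕ Fin n → R) :
    rot v v' c s *ᵥ x = x + om n R x v' • ((c - 1) • v + s • v') +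
      om n R v x • (-s • v + (c - 1) • v') := by
  rw [rot, Matrix.sub_mulVec, Matrix.add_mulVec, Matrix.one_mulVec, vecMulVec_mulVec,
    vecMulVec_mulVec, dotProduct_comm _ x, dotProduct_comm _ x, ← om_apply, ← om_apply,
    om_swap v x, op_smul_eq_smul, op_smul_eq_smul]
  rw [neg_smul, sub_eq_add_neg]
  simp only [← neg_smul, neg_neg]

lemma rot_mem {v v' : Fin n ⊕ Fin n → R} (h : om n R v v' = 1) {c s : R} (hcs : c ^ 2 + s ^ 2 = 1) :
    rot v v' c s ∈ symplecticGroup (Fin n) R := by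
  refine mem_of_om fun x y => ?_
  have h' : om n R v' v = -1 := by rw [om_swap, h]
  simp only [rot_mulVec, map_add, map_smul, LinearMap.add_apply, LinearMap.smul_apply, om_self,
    h, h', smul_eq_mul, om_swap v x, om_swap y v']
  linear_combination (om n R v y * om n R x v' - om n R v x * om n R y v') * hcs

lemma rot_mul {v v' : Fin n ⊕ Fin n → R} (h : om n R v v' = 1) (c s c' s' : R) :
    rot v v' c s * rot v v' c' s' = rot v v' (c * c' - s * s') (c * s' + s * c') := by
  refine Matrix.ext_of_mulVec_single fun j => ?_
  generalize (Pi.single j 1 : Fin n ⊕ Fin n → R) = x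
  rw [← Matrix.mulVec_mulVec]
  simp only [rot_mulVec, map_add, map_smul, LinearMap.add_apply, LinearMap.smul_apply, om_self,
    h, smul_eq_mul]
  module

end Symplectic

section Apartments

variable {n : ℕ}

lemma uni_top : Uni (om n ℤ) ⊤ := by
  rintro w ⟨-, hw⟩
  obtain ⟨k, hk⟩ : ∃ k, LinearMap.range (om n ℤ w) = Ideal.span {k} :=
    (IsPrincipalIdealRing.principal (LinearMap.range (om n ℤ w) : Ideal ℤ)).principal
  have hdvd : ∀ i, k ∣ w i := fun i => by
    rw [← Ideal.mem_span_singleton, ← hk]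
    exact ⟨-(J (Fin n) ℤ *ᵥ Pi.single i 1), by rw [om_neg_J]; simp⟩
  choose w₀ hw₀ using hdvd
  have hw' : w = k • w₀ := funext fun i => by simp [hw₀]
  have hk0 : k ≠ 0 := by rintro rfl; exact hw (by simpa using hw')
  obtain ⟨x, hx⟩ : k ∈ LinearMap.range (om n ℤ w) := by
    rw [hk]; exact Ideal.mem_span_singleton_self k
  refine ⟨k, w₀, trivial, hw', x, trivial, ?_⟩
  rw [hw'] at hx
  rw [map_smul, LinearMap.smul_apply, smul_eq_mul] at hx
  exact mul_left_cancel₀ hk0 (by rw [hx, mul_one])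

lemma big_top : Big n (⊤ : Submodule ℤ (Fin n ⊕ Fin n → ℤ)) := by
  intro φ hφ
  by_contra hc
  push Not at hc
  set F : (Fin n ⊕ Fin n → ℤ) →ₗ[ℤ] (Fin φ.length → ℤ) := LinearMap.pi fun i => φ.get i
  have hF : Function.Injective F := by
    rw [← LinearMap.ker_eq_bot, LinearMap.ker_eq_bot']
    intro w hw
    by_contra h0
    obtain ⟨f, hf, hfw⟩ := hc w ⟨trivial, h0⟩
    obtain ⟨i, rfl⟩ := List.get_of_mem hf
    exact hfw (congrFun hw i)
  have := LinearMap.finrank_le_finrank_of_injective hF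
  simp at this
  omega

/-- The symplectic rotation exchanging the two vectors of a hyperbolic pair maps the corresponding
apartments to their negatives modulo boundaries. -/
lemma exists_rotation {p : (Fin n ⊕ Fin n → ℤ) × (Fin n ⊕ Fin n → ℤ)}
    {s : List ((Fin n ⊕ Fin n → ℤ) × (Fin n ⊕ Fin n → ℤ))} (hs : Hyp (om n ℤ) (nz ⊤) (p :: s)) :
    apt (p :: s) + mp (fun x => rot p.1 p.2 0 1 *ᵥ x) (apt (p :: s)) ∈
      (OC (om n ℤ) (nz ⊤) (s.length + 2)).map bd := by
  obtain ⟨h1, h2⟩ := hs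
  rw [List.pairwise_cons] at h2
  rw [List.forall_mem_cons] at h1
  obtain ⟨⟨hv, hv', h⟩, h1⟩ := h1
  obtain ⟨v, v'⟩ := p
  simp only at h hv hv' h2 ⊢
  have hrv : rot v v' 0 1 *ᵥ v = v' := by
    rw [rot_mulVec, h, om_self]
    module
  have hrv' : rot v v' 0 1 *ᵥ v' = -v := by
    rw [rot_mulVec, h, om_self]
    module
  have hrs : s.map (Prod.map (fun x => rot v v' 0 1 *ᵥ x) fun x => rot v v' 0 1 *ᵥ x) = s := by
    refine (List.map_congr_left fun p hp => ?_).trans (List.map_id _)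
    obtain ⟨h3, h4, h5, h6⟩ := h2.1 p hp
    refine Prod.ext ?_ ?_
    · simp [rot_mulVec, h3, om_swap v' p.1, h5]
    · simp [rot_mulVec, h4, om_swap v' p.2, h6]
  refine ⟨cn (-v) (cn v (apt s)), ?_, ?_⟩
  · have h3 : Hyp (om n ℤ) {x | (x ∈ nz ⊤ ∧ om n ℤ (-v) x = 0) ∧ om n ℤ v x = 0} s :=
      ⟨fun p hp => ⟨⟨⟨(h1 p hp).1, by simp [(h2.1 p hp).1]⟩, (h2.1 p hp).1⟩,
        ⟨⟨(h1 p hp).2.1, by simp [(h2.1 p hp).2.1]⟩, (h2.1 p hp).2.1⟩, (h1 p hp).2.2⟩, h2.2⟩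
    exact OC.cn om_isAlt (show -v ∈ nz ⊤ from ⟨trivial, neg_ne_zero.2 hv.2⟩)
      (OC.cn om_isAlt (show v ∈ {x | x ∈ nz ⊤ ∧ om n ℤ (-v) x = 0} from ⟨hv, by simp⟩)
        (h3.apt_mem om_isAlt))
  · rw [mp_apt, List.map_cons, hrs]
    simp only [apt, Prod.map_apply, hrv, hrv', bd_cn, bd_apt, map_zero, sub_zero]
    abel

end Apartments

end SpTop

namespace SpTop

open Matrix

section PositiveDefinite

variable {ι κ : Type*} [Fintype ι] [Fintype κ]

/-- Real symmetric positive definite matrices. -/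
structure PD (Q : Matrix ι ι ℝ) : Prop where
  symm : Qᵀ = Q
  pos : ∀ x : ι → ℝ, x ≠ 0 → 0 < x ⬝ᵥ (Q *ᵥ x)

lemma dot_mulVec_comm {Q : Matrix ι ι ℝ} (hQ : Qᵀ = Q) (x y : ι → ℝ) :
    x ⬝ᵥ (Q *ᵥ y) = y ⬝ᵥ (Q *ᵥ x) := by
  rw [Matrix.dotProduct_mulVec, ← Matrix.mulVec_transpose, hQ, dotProduct_comm]

lemma PD.posDef {Q : Matrix ι ι ℝ} (h : PD Q) : Q.PosDef :=
  .of_dotProduct_mulVec_pos (by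
    rw [Matrix.IsHermitian, Matrix.conjTranspose_eq_transpose_of_trivial, h.symm])
    fun x hx => by simpa using h.pos x hx

lemma PD.of_posDef {Q : Matrix ι ι ℝ} (h : Q.PosDef) : PD Q :=
  ⟨by rw [← Matrix.conjTranspose_eq_transpose_of_trivial, h.1], fun x hx => by
    simpa using h.dotProduct_mulVec_pos hx⟩

lemma PD.nonneg {Q : Matrix ι ι ℝ} (h : PD Q) (x : ι → ℝ) : 0 ≤ x ⬝ᵥ (Q *ᵥ x) := by
  rcases eq_or_ne x 0 with rfl | hx
  · simp
  · exact (h.pos x hx).le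

lemma PD.cs {Q : Matrix ι ι ℝ} (h : PD Q) (x y : ι → ℝ) :
    (x ⬝ᵥ (Q *ᵥ y)) ^ 2 ≤ x ⬝ᵥ (Q *ᵥ x) * y ⬝ᵥ (Q *ᵥ y) := by
  rcases eq_or_ne y 0 with rfl | hy
  · simp
  set a := x ⬝ᵥ (Q *ᵥ x)
  set b := x ⬝ᵥ (Q *ᵥ y) with hb
  set c := y ⬝ᵥ (Q *ᵥ y) with hc
  have hc0 : 0 < c := h.pos y hy
  have h1 := h.nonneg (c • x - b • y)
  rw [Matrix.mulVec_sub, Matrix.mulVec_smul, Matrix.mulVec_smul, sub_dotProduct, dotProduct_sub,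
    dotProduct_sub, smul_dotProduct, smul_dotProduct, smul_dotProduct, smul_dotProduct,
    dotProduct_smul, dotProduct_smul, dotProduct_smul, dotProduct_smul,
    dot_mulVec_comm h.symm y x, ← hb, ← hc] at h1
  simp only [smul_eq_mul] at h1
  have h2 : 0 ≤ c * (a * c - b ^ 2) := by linarith
  nlinarith [nonneg_of_mul_nonneg_right h2 hc0]

variable [DecidableEq ι] [DecidableEq κ]

lemma PD.det_pos {Q : Matrix ι ι ℝ} (h : PD Q) : 0 < Q.det := h.posDef.det_pos

lemma PD.isUnit_det {Q : Matrix ι ι ℝ} (h : PD Q) : IsUnit Q.det := h.det_pos.ne'.isUnit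

lemma PD.inv {Q : Matrix ι ι ℝ} (h : PD Q) : PD Q⁻¹ := .of_posDef h.posDef.inv

lemma PD.congr {Q : Matrix ι ι ℝ} (h : PD Q) {g : Matrix ι κ ℝ}
    (hg : ∀ x, g *ᵥ x = 0 → x = 0) : PD (gᵀ * Q * g) where
  symm := by simp [Matrix.transpose_mul, h.symm, Matrix.mul_assoc]
  pos x hx := by
    rw [← Matrix.mulVec_mulVec, ← Matrix.mulVec_mulVec, Matrix.dotProduct_mulVec,
      Matrix.vecMul_transpose]
    exact h.pos _ fun h => hx (hg x h)

lemma mulVec_eq_zero_of_isUnit {R : Type*} [CommRing R] {g : Matrix ι ι R} (hg : IsUnit g.det)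
    (x : ι → R) (h : g *ᵥ x = 0) : x = 0 := by
  rw [← Matrix.one_mulVec x, ← Matrix.nonsing_inv_mul g hg, ← Matrix.mulVec_mulVec, h,
    Matrix.mulVec_zero]

lemma sq_le_dot (x : ι → ℝ) (i : ι) : x i ^ 2 ≤ x ⬝ᵥ x := by
  rw [pow_two]
  exact Finset.single_le_sum (f := fun i => x i * x i) (fun i _ => mul_self_nonneg _)
    (Finset.mem_univ i)

lemma exists_dot_bound (W : Matrix ι ι ℝ) : ∃ M, 0 < M ∧ ∀ x, |x ⬝ᵥ (W *ᵥ x)| ≤ M * (x ⬝ᵥ x) := by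
  refine ⟨∑ i, ∑ j, |W i j| + 1, by positivity, fun x => ?_⟩
  have h0 : 0 ≤ x ⬝ᵥ x := Finset.sum_nonneg fun i _ => mul_self_nonneg _
  have h1 : ∀ i j, |x i * (W i j * x j)| ≤ |W i j| * (x ⬝ᵥ x) := fun i j => by
    have : |x i * x j| ≤ x ⬝ᵥ x := by
      have h1 := sq_le_dot x i
      have h2 := sq_le_dot x j
      rw [abs_le]
      constructor <;> nlinarith [sq_nonneg (x i + x j), sq_nonneg (x i - x j)]
    calc _ = |W i j| * |x i * x j| := by rw [← abs_mul]; congr 1; ring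
      _ ≤ _ := by gcongr
  calc |x ⬝ᵥ (W *ᵥ x)| = |∑ i, ∑ j, x i * (W i j * x j)| := by
        simp [dotProduct, Matrix.mulVec, Finset.mul_sum]
    _ ≤ ∑ i, ∑ j, |W i j| * (x ⬝ᵥ x) :=
        (Finset.abs_sum_le_sum_abs _ _).trans (Finset.sum_le_sum fun i _ =>
          (Finset.abs_sum_le_sum_abs _ _).trans (Finset.sum_le_sum fun j _ => h1 i j))
    _ = (∑ i, ∑ j, |W i j|) * (x ⬝ᵥ x) := by simp [Finset.sum_mul]
    _ ≤ _ := by rw [add_mul]; linarith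

lemma PD.exists_lower {Q : Matrix ι ι ℝ} (h : PD Q) :
    ∃ c, 0 < c ∧ ∀ x, c * (x ⬝ᵥ x) ≤ x ⬝ᵥ (Q *ᵥ x) := by
  obtain ⟨M, hM, hMx⟩ := exists_dot_bound Q⁻¹
  refine ⟨M⁻¹, inv_pos.2 hM, fun x => ?_⟩
  rw [inv_mul_le_iff₀ hM]
  have h1 := h.cs x (Q⁻¹ *ᵥ x)
  rw [Matrix.mulVec_mulVec, Matrix.mul_nonsing_inv Q h.isUnit_det, Matrix.one_mulVec,
    dotProduct_comm (Q⁻¹ *ᵥ x)] at h1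
  have h2 := (le_abs_self _).trans (hMx x)
  have h3 := h.nonneg x
  have h0 : 0 ≤ x ⬝ᵥ x := Finset.sum_nonneg fun i _ => mul_self_nonneg _
  rcases h0.eq_or_lt with h4 | h4
  · rw [← h4]; positivity
  · nlinarith

lemma PD.finite_le {Q : Matrix ι ι ℝ} (h : PD Q) (R : ℝ) :
    {v : ι → ℤ | (fun i => (v i : ℝ)) ⬝ᵥ (Q *ᵥ fun i => (v i : ℝ)) ≤ R}.Finite := by
  obtain ⟨c, hc, hcx⟩ := h.exists_lower
  obtain ⟨B, hB⟩ := exists_nat_gt (R / c)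
  refine (Set.Finite.pi fun _ : ι => Set.finite_Icc (-B : ℤ) B).subset fun v hv i _ => ?_
  have h1 := (mul_le_mul_of_nonneg_left (sq_le_dot (fun i => (v i : ℝ)) i) hc.le).trans
    ((hcx _).trans hv)
  rw [div_lt_iff₀ hc] at hB
  have h2 : (v i : ℝ) ^ 2 < B := by
    by_contra h3
    push Not at h3
    nlinarith
  have h3 : (v i) ^ 2 < B := by exact_mod_cast h2
  constructor <;> nlinarith

end PositiveDefinite

end SpTop

namespace SpTop

open Matrix

section Reduction

variable {ι κ : Type*} [Fintype ι] [Fintype κ]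

/-- An integral matrix as a real matrix. -/
def toR (g : Matrix ι κ ℤ) : Matrix ι κ ℝ := g.map Int.cast

/-- The value of a quadratic form at an integral vector. -/
noncomputable def qi (Q : Matrix ι ι ℝ) (v : ι → ℤ) : ℝ :=
  (fun i => (v i : ℝ)) ⬝ᵥ (Q *ᵥ fun i => (v i : ℝ))

lemma toR_mulVec (g : Matrix ι κ ℤ) (v : κ → ℤ) :
    (fun i => ((g *ᵥ v) i : ℝ)) = toR g *ᵥ fun i => (v i : ℝ) := by
  ext i
  simp [toR, Matrix.mulVec, dotProduct]

lemma toR_mul {ν : Type*} (g : Matrix ν ι ℤ) (h : Matrix ι κ ℤ) :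
    toR (g * h) = toR g * toR h := by
  ext i j
  simp [toR, Matrix.mul_apply]

lemma qi_mulVec (Q : Matrix ι ι ℝ) (g : Matrix ι κ ℤ) (v : κ → ℤ) :
    qi Q (g *ᵥ v) = qi ((toR g)ᵀ * Q * toR g) v := by
  have h : (fun i => ((g *ᵥ v) i : ℝ)) = toR g *ᵥ fun i => (v i : ℝ) := toR_mulVec g v
  rw [qi, qi, h, ← Matrix.mulVec_mulVec, ← Matrix.mulVec_mulVec,
    Matrix.dotProduct_mulVec _ (toR g)ᵀ, Matrix.vecMul_transpose]

variable [DecidableEq ι] [DecidableEq κ]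

lemma det_map_cast (g : Matrix ι ι ℤ) : (toR g).det = g.det :=
  (RingHom.map_det (Int.castRingHom ℝ) g).symm

lemma isUnit_det_cast {g : Matrix ι ι ℤ} (hg : IsUnit g.det) :
    IsUnit (toR g).det := by
  rw [det_map_cast]
  exact hg.map (Int.castRingHom ℝ)

lemma sq_det_cast {g : Matrix ι ι ℤ} (hg : IsUnit g.det) :
    (toR g).det ^ 2 = 1 := by
  rw [det_map_cast]
  rcases Int.isUnit_iff.1 hg with h | h <;> simp [h]

lemma mulVec_col (g h : Matrix ι ι ℤ) (i : ι) :
    (fun j => (g * h) j i) = g *ᵥ fun j => h j i := by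
  ext j; simp [Matrix.mul_apply, Matrix.mulVec, dotProduct]

variable (ι) in
/-- Positive definite forms have bases with bounded product of lengths. -/
def Red : Prop :=
  ∃ C, 0 < C ∧ ∀ Q : Matrix ι ι ℝ, PD Q →
    ∃ g : Matrix ι ι ℤ, IsUnit g.det ∧ ∏ i, qi Q (fun j => g j i) ≤ C * Q.det

lemma Red.equiv (h : Red ι) (e : κ ≃ ι) : Red κ := by
  obtain ⟨C, hC, h⟩ := h
  refine ⟨C, hC, fun Q hQ => ?_⟩
  obtain ⟨g, hg, hgQ⟩ := h (Q.submatrix e.symm e.symm)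
    (.of_posDef (hQ.posDef.submatrix e.symm.injective))
  refine ⟨g.submatrix e e, by simpa using hg, ?_⟩
  rw [Matrix.det_submatrix_equiv_self] at hgQ
  refine le_of_eq_of_le ?_ hgQ
  refine Fintype.prod_equiv e _ _ fun i => ?_
  simp only [qi, dotProduct, Matrix.mulVec, Matrix.submatrix_apply]
  refine Fintype.sum_equiv e _ _ fun j => ?_
  simp only [Equiv.symm_apply_apply]
  congr 1
  exact Fintype.sum_equiv e _ _ fun k => by simp

lemma Red.of_isEmpty [IsEmpty ι] : Red ι :=
  ⟨1, one_pos, fun Q _ => ⟨1, by simp, by simp⟩⟩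

lemma qi_sum (Q : Matrix (Unit ⊕ κ) (Unit ⊕ κ) ℝ) (hQ : Qᵀ = Q) (x : Unit ⊕ κ → ℝ)
    (hα : Q (.inl ()) (.inl ()) ≠ 0) :
    x ⬝ᵥ (Q *ᵥ x) = Q (.inl ()) (.inl ()) *
      (x (.inl ()) + (∑ j, Q (.inl ()) (.inr j) * x (.inr j)) / Q (.inl ()) (.inl ())) ^ 2 +
      (fun j => x (.inr j)) ⬝ᵥ ((of fun i j => Q (.inr i) (.inr j) -
        Q (.inl ()) (.inr i) * Q (.inl ()) (.inr j) / Q (.inl ()) (.inl ())) *ᵥ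
          fun j => x (.inr j)) := by
  have hs : ∀ i, Q (.inr i) (.inl ()) = Q (.inl ()) (.inr i) := fun i => by
    conv_lhs => rw [← hQ, Matrix.transpose_apply]
  have h1 : ∑ i, ∑ j, x (.inr i) * (Q (.inl ()) (.inr i) * Q (.inl ()) (.inr j) /
      Q (.inl ()) (.inl ()) * x (.inr j)) =
      (∑ j, Q (.inl ()) (.inr j) * x (.inr j)) ^ 2 / Q (.inl ()) (.inl ()) := by
    rw [pow_two, Finset.sum_mul_sum, Finset.sum_div]
    refine Finset.sum_congr rfl fun i _ => ?_
    rw [Finset.sum_div]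
    exact Finset.sum_congr rfl fun j _ => by ring
  have h2 : ∑ i, x (.inr i) * (Q (.inl ()) (.inr i) * x (.inl ())) =
      x (.inl ()) * ∑ j, Q (.inl ()) (.inr j) * x (.inr j) := by
    rw [Finset.mul_sum]
    exact Finset.sum_congr rfl fun j _ => by ring
  simp only [dotProduct, Matrix.mulVec, Fintype.sum_sum_type, Finset.univ_unique,
    Finset.sum_singleton, PUnit.default_eq_unit, hs, of_apply, sub_mul, Finset.sum_sub_distrib,
    mul_add, mul_sub, Finset.sum_add_distrib, Finset.mul_sum] at h1 h2 ⊢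
  rw [h1, h2]
  simp only [← Finset.mul_sum]
  field_simp
  ring

lemma det_sum (Q : Matrix (Unit ⊕ κ) (Unit ⊕ κ) ℝ) (hQ : Qᵀ = Q)
    (hα : Q (.inl ()) (.inl ()) ≠ 0) :
    Q.det = Q (.inl ()) (.inl ()) * (of fun i j => Q (.inr i) (.inr j) -
        Q (.inl ()) (.inr i) * Q (.inl ()) (.inr j) / Q (.inl ()) (.inl ())).det := by
  have hs : ∀ i, Q (.inr i) (.inl ()) = Q (.inl ()) (.inr i) := fun i => by
    conv_lhs => rw [← hQ, Matrix.transpose_apply]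
  have hu : IsUnit Q.toBlocks₁₁.det := by
    rw [Matrix.det_unique]
    exact hα.isUnit
  let := Matrix.invertibleOfIsUnitDet _ hu
  conv_lhs => rw [← Matrix.fromBlocks_toBlocks Q, Matrix.det_fromBlocks₁₁, Matrix.det_unique]
  congr 2
  ext i j
  rw [Matrix.invOf_eq_nonsing_inv, Matrix.inv_subsingleton]
  simp [Matrix.mul_apply, 
    Matrix.toBlocks₁₁, Matrix.toBlocks₁₂, Matrix.toBlocks₂₁, Matrix.toBlocks₂₂, hs]
  ring

lemma Red.succ (h : Red κ) : Red (Unit ⊕ κ) := by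
  obtain ⟨C, hC, h⟩ := h
  refine ⟨(4 / 3) ^ Fintype.card κ * C, by positivity, fun Q₀ hQ₀ => ?_⟩
  set T : Set (Unit ⊕ κ → ℤ) := {v | qi Q₀ v ≤ qi Q₀ (Pi.single (.inl ()) 1) ∧
    ∃ g : Matrix (Unit ⊕ κ) (Unit ⊕ κ) ℤ, IsUnit g.det ∧ v = fun j => g j (.inl ())} with hT
  have hTne : T.Nonempty := by
    refine ⟨Pi.single (.inl ()) 1, le_rfl, 1, by simp, ?_⟩
    ext j
    simp [Matrix.one_apply, Pi.single_apply]
  obtain ⟨v₀, ⟨hv₀, g₀, hg₀, rfl⟩, hmin⟩ := Set.exists_min_image T (qi Q₀)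
    ((hQ₀.finite_le _).subset fun v hv => hv.1) hTne
  have hmin' : ∀ g : Matrix (Unit ⊕ κ) (Unit ⊕ κ) ℤ, IsUnit g.det →
      qi Q₀ (fun j => g₀ j (.inl ())) ≤ qi Q₀ (fun j => g j (.inl ())) := fun g hg => by
    by_cases h : qi Q₀ (fun j => g j (.inl ())) ≤ qi Q₀ (Pi.single (.inl ()) 1)
    · exact hmin _ ⟨h, g, hg, rfl⟩
    · exact hv₀.trans (not_le.1 h).le
  set Q := (toR g₀)ᵀ * Q₀ * toR g₀ with hQdef
  have hQ : PD Q := hQ₀.congr (mulVec_eq_zero_of_isUnit (isUnit_det_cast hg₀))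
  have hdet : Q.det = Q₀.det := by
    rw [hQdef, Matrix.det_mul, Matrix.det_mul, Matrix.det_transpose, mul_right_comm, ← pow_two,
      sq_det_cast hg₀, one_mul]
  have hqQ : ∀ v, qi Q₀ (g₀ *ᵥ v) = qi Q v := fun v => qi_mulVec _ _ _
  set α := Q (.inl ()) (.inl ()) with hα
  have hα0 : 0 < α := by
    have := hQ.pos (Pi.single (.inl ()) 1) (by simp)
    simpa using this
  have hαq : qi Q₀ (fun j => g₀ j (.inl ())) = α := by
    have : (fun j => g₀ j (.inl ())) = g₀ *ᵥ Pi.single (.inl ()) 1 := by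
      ext j; simp
    rw [this, hqQ, qi]
    have : (fun i => ((Pi.single (.inl ()) 1 : Unit ⊕ κ → ℤ) i : ℝ)) = Pi.single (.inl ()) 1 := by
      ext i
      simp only [Pi.single_apply]
      split_ifs <;> simp
    rw [this]
    simp [hα]
  have hmin2 : ∀ g : Matrix (Unit ⊕ κ) (Unit ⊕ κ) ℤ, IsUnit g.det → ∀ i,
      α ≤ qi Q (fun j => g j i) := fun g hg i => by
    rw [← hqQ, ← mulVec_col, ← hαq]
    have := hmin' ((g₀ * g).submatrix id (Equiv.swap (.inl ()) i)) (by
      rw [Matrix.det_permute', Matrix.det_mul]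
      exact (IsUnit.map (Int.castRingHom ℤ) (Equiv.Perm.sign _).isUnit).mul (hg₀.mul hg))
    simpa using this
  set Q' : Matrix κ κ ℝ := of fun i j => Q (.inr i) (.inr j) -
        Q (.inl ()) (.inr i) * Q (.inl ()) (.inr j) / α with hQ'def
  have hQ' : PD Q' := by
    refine ⟨?_, fun x hx => ?_⟩
    · ext i j
      have : Q (.inr j) (.inr i) = Q (.inr i) (.inr j) := by
        conv_lhs => rw [← hQ.symm, Matrix.transpose_apply]
      simp only [hQ'def, Matrix.transpose_apply, of_apply, this]
      ring
    · have h1 := qi_sum Q hQ.symm (Sum.elim (fun _ => -(∑ j, Q (.inl ()) (.inr j) * x j) / α) x)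
        hα0.ne'
      have h2 := hQ.pos (Sum.elim (fun _ => -(∑ j, Q (.inl ()) (.inr j) * x j) / α) x)
        fun h => hx (funext fun j => congrFun h (.inr j))
      rw [h1] at h2
      simpa [neg_div, ← hα] using h2
  obtain ⟨g', hg', hgQ'⟩ := h Q' hQ'
  set r : κ → ℤ := fun i => -round ((∑ j, Q (.inl ()) (.inr j) * (g' j i : ℝ)) / α)
  set k : Matrix (Unit ⊕ κ) (Unit ⊕ κ) ℤ := fromBlocks 1 (of fun _ i => r i) 0 g' with hk
  have hku : IsUnit k.det := by
    rw [hk, Matrix.det_fromBlocks_zero₂₁]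
    simpa using hg'
  have hb : ∀ i, qi Q (fun j => k j (.inr i)) ≤ 4 / 3 * qi Q' (fun j => g' j i) := fun i => by
    have h1 := hmin2 k hku (.inr i)
    have h2 : qi Q (fun j => k j (.inr i)) =
        α * (r i + (∑ j, Q (.inl ()) (.inr j) * (g' j i : ℝ)) / α) ^ 2 +
          qi Q' (fun j => g' j i) := by
      rw [qi, qi_sum Q hQ.symm _ hα0.ne']
      rfl
    have h3 : (r i + (∑ j, Q (.inl ()) (.inr j) * (g' j i : ℝ)) / α) ^ 2 ≤ 1 / 4 := by
      have := abs_le.1 (abs_sub_round ((∑ j, Q (.inl ()) (.inr j) * (g' j i : ℝ)) / α))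
      simp only [r, Int.cast_neg]
      nlinarith
    have h4 := mul_le_mul_of_nonneg_left h3 hα0.le
    linarith
  refine ⟨g₀ * k, by rw [Matrix.det_mul]; exact hg₀.mul hku, ?_⟩
  simp only [mulVec_col, hqQ, Fintype.prod_sum_type, Finset.univ_unique, Finset.prod_singleton]
  have hk0 : (fun j => k j (.inl default)) = fun j => (1 : Matrix (Unit ⊕ κ) (Unit ⊕ κ) ℤ) j
      (.inl ()) := by
    ext j
    rcases j with j | j <;> simp [hk]
  have hk1 : qi Q (fun j => k j (.inl default)) = α := by
    rw [hk0, ← hαq, ← hqQ, ← mulVec_col, mul_one]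
  rw [hk1, ← hdet, det_sum Q hQ.symm hα0.ne', ← hα, ← hQ'def]
  have hnn : ∀ v, 0 ≤ qi Q v := fun v => hQ.nonneg _
  calc α * ∏ i, qi Q (fun j => k j (.inr i))
      ≤ α * ∏ i, (4 / 3 * qi Q' (fun j => g' j i)) := by
        gcongr with i
        · exact fun i _ => hnn _
        · exact hb i
    _ = α * ((4 / 3) ^ Fintype.card κ * ∏ i, qi Q' (fun j => g' j i)) := by
        rw [Finset.prod_mul_distrib, Finset.prod_const, Finset.card_univ]
    _ ≤ α * ((4 / 3) ^ Fintype.card κ * (C * Q'.det)) := by gcongr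
    _ = _ := by ring

theorem exists_red : Red ι := by
  suffices ∀ m : ℕ, Red (Fin m) from (this _).equiv (Fintype.equivFin ι)
  intro m
  induction m with
  | zero => exact Red.of_isEmpty
  | succ m ih =>
    exact ih.succ.equiv ((finSumFinEquiv.symm.trans (Equiv.sumComm _ _)).trans
      (Equiv.sumCongr (Equiv.ofUnique (Fin 1) Unit) (Equiv.refl _)))

end Reduction

end SpTop

namespace SpTop

open Matrix

section Siegel

variable {n : ℕ}

/-- The symmetric matrix with given entries. -/
def sm (x : Sym2 (Fin n) → ℝ) : Matrix (Fin n) (Fin n) ℝ := of fun i j => x s(i, j)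

lemma sm_transpose (x : Sym2 (Fin n) → ℝ) : (sm x)ᵀ = sm x := by
  ext i j; simp [sm, Sym2.eq_swap]

lemma sm_add (x y : Sym2 (Fin n) → ℝ) : sm (x + y) = sm x + sm y := rfl

lemma sm_smul (c : ℝ) (x : Sym2 (Fin n) → ℝ) : sm (c • x) = c • sm x := rfl

lemma exists_sm {W : Matrix (Fin n) (Fin n) ℝ} (hW : Wᵀ = W) : ∃ x, sm x = W :=
  ⟨Sym2.lift ⟨fun i j => W i j, fun i j => congrFun₂ hW j i⟩, by
    ext i j; simp [sm]⟩

variable (n) in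
/-- The ambient space of the Siegel upper half space. -/
abbrev SE : Type := (Sym2 (Fin n) → ℝ) × (Sym2 (Fin n) → ℝ)

lemma finrank_SE : Module.finrank ℝ (SE n) = n ^ 2 + n := by
  rw [Module.finrank_prod, Module.finrank_fintype_fun_eq_card, Sym2.card, Fintype.card_fin,
    Nat.choose_two_right]
  have := Nat.even_mul_succ_self n
  have h2 : (n + 1) * (n + 1 - 1) = n * (n + 1) := by rw [Nat.add_sub_cancel, mul_comm]
  rw [h2]
  have h3 := Nat.div_mul_cancel this.two_dvd
  have h4 : n * (n + 1) = n ^ 2 + n := by ring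
  rw [h4] at h3 ⊢
  omega

variable (n) in
/-- The Siegel upper half space. -/
def siegel : Set (SE n) := {p | PD (sm p.2)}

/-- Affine functions whose supremum is the quadratic form attached to a point. -/
def aff (v : Fin n ⊕ Fin n → ℝ) (w : Fin n → ℝ) (p : SE n) : ℝ :=
  2 * (w ⬝ᵥ (sm p.1 *ᵥ (v ∘ Sum.inl) + v ∘ Sum.inr)) - w ⬝ᵥ (sm p.2 *ᵥ w) +
    (v ∘ Sum.inl) ⬝ᵥ (sm p.2 *ᵥ (v ∘ Sum.inl))

/-- The positive definite symplectic matrix attached to a point. -/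
noncomputable def qm (p : SE n) : Matrix (Fin n ⊕ Fin n) (Fin n ⊕ Fin n) ℝ :=
  fromBlocks (sm p.2 + sm p.1 * (sm p.2)⁻¹ * sm p.1) (sm p.1 * (sm p.2)⁻¹)
    ((sm p.2)⁻¹ * sm p.1) (sm p.2)⁻¹

/-- The quadratic form attached to a point. -/
noncomputable def qf (p : SE n) (v : Fin n ⊕ Fin n → ℝ) : ℝ := v ⬝ᵥ (qm p *ᵥ v)

lemma qf_eq (p : SE n) (v : Fin n ⊕ Fin n → ℝ) :
    qf p v = (v ∘ Sum.inl) ⬝ᵥ (sm p.2 *ᵥ (v ∘ Sum.inl)) +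
      (sm p.1 *ᵥ (v ∘ Sum.inl) + v ∘ Sum.inr) ⬝ᵥ
        ((sm p.2)⁻¹ *ᵥ (sm p.1 *ᵥ (v ∘ Sum.inl) + v ∘ Sum.inr)) := by
  have h : ∀ u, (sm p.1 *ᵥ (v ∘ Sum.inl)) ⬝ᵥ u = (v ∘ Sum.inl) ⬝ᵥ (sm p.1 *ᵥ u) := fun u => by
    rw [dotProduct_comm, dot_mulVec_comm (sm_transpose _)]
  conv_lhs => rw [qf, qm, ← Sum.elim_comp_inl_inr v, Matrix.fromBlocks_mulVec]
  rw [sumElim_dotProduct_sumElim]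
  simp only [Sum.elim_comp_inl_inr, Matrix.add_mulVec,
    Matrix.mulVec_add, dotProduct_add, add_dotProduct, ← Matrix.mulVec_mulVec, h]
  ring

lemma qf_le_iff {p : SE n} (hp : p ∈ siegel n) (v : Fin n ⊕ Fin n → ℝ) (t : ℝ) :
    qf p v ≤ t ↔ ∀ w, aff v w p ≤ t := by
  have hp : PD (sm p.2) := hp
  rw [qf_eq]
  set u := sm p.1 *ᵥ (v ∘ Sum.inl) + v ∘ Sum.inr with hu
  have hyu : sm p.2 *ᵥ ((sm p.2)⁻¹ *ᵥ u) = u := by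
    rw [Matrix.mulVec_mulVec, Matrix.mul_nonsing_inv _ hp.isUnit_det, Matrix.one_mulVec]
  constructor
  · intro h w
    refine le_trans ?_ h
    have h1 := hp.nonneg (w - (sm p.2)⁻¹ *ᵥ u)
    rw [Matrix.mulVec_sub, hyu, sub_dotProduct, dotProduct_sub, dotProduct_sub,
      dot_mulVec_comm (sm_transpose p.2) ((sm p.2)⁻¹ *ᵥ u) w, hyu, dotProduct_comm (_ *ᵥ u) u] at h1
    rw [aff, ← hu]
    linarith
  · intro h
    refine le_trans ?_ (h ((sm p.2)⁻¹ *ᵥ u))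
    rw [aff, ← hu, hyu, dotProduct_comm _ u]
    linarith

lemma aff_combo (v : Fin n ⊕ Fin n → ℝ) (w : Fin n → ℝ) (p q : SE n) {a b : ℝ} (hab : a + b = 1) :
    aff v w (a • p + b • q) = a * aff v w p + b * aff v w q := by
  simp only [aff, Prod.fst_add, Prod.snd_add, Prod.smul_fst, Prod.smul_snd, sm_add, sm_smul,
    Matrix.add_mulVec, Matrix.smul_mulVec, dotProduct_add, dotProduct_smul, smul_eq_mul]
  linear_combination (-2 * (w ⬝ᵥ v ∘ Sum.inr)) * hab

lemma continuous_sm : Continuous (sm (n := n)) :=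
  continuous_pi fun _ => continuous_pi fun _ => continuous_apply _

lemma continuous_aff (v : Fin n ⊕ Fin n → ℝ) (w : Fin n → ℝ) : Continuous (aff v w) := by
  have h1 : Continuous fun p : SE n => sm p.1 := continuous_sm.comp continuous_fst
  have h2 : Continuous fun p : SE n => sm p.2 := continuous_sm.comp continuous_snd
  unfold aff
  fun_prop

lemma convex_siegel : Convex ℝ (siegel n) := by
  intro p hp q hq a b ha hb hab
  refine ⟨sm_transpose _, fun x hx => ?_⟩
  have h1 := PD.pos hp x hx
  have h2 := PD.pos hq x hx
  simp only [Prod.snd_add, Prod.smul_snd, sm_add, sm_smul, Matrix.add_mulVec, Matrix.smul_mulVec,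
    dotProduct_add, dotProduct_smul, smul_eq_mul]
  rcases ha.eq_or_lt with rfl | ha
  · have : b = 1 := by linarith
    simpa [this] using h2
  · have := mul_nonneg hb h2.le
    positivity

lemma flat_siegel : Flat (siegel n) ⊤ (siegel n) where
  sub := subset_rfl
  conv := convex_siegel
  diff _ _ _ _ := trivial
  cpt K hK h := by rwa [Set.inter_eq_left.2 hK]
  opn p hp w _ := by
    obtain ⟨c, hc, hcx⟩ := PD.exists_lower hp
    obtain ⟨M, hM, hMx⟩ := exists_dot_bound (sm w.2)
    refine ⟨c / (2 * M), by positivity, sm_transpose _, fun x hx => ?_⟩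
    have h0 : 0 < x ⬝ᵥ x := by
      refine lt_of_le_of_ne (Finset.sum_nonneg fun i _ => mul_self_nonneg _) fun h => hx ?_
      exact dotProduct_self_eq_zero.1 h.symm
    have h1 := hcx x
    have h2 := (abs_le.1 (hMx x)).1
    simp only [Prod.snd_add, Prod.smul_snd, sm_add, sm_smul, Matrix.add_mulVec, Matrix.smul_mulVec,
      dotProduct_add, dotProduct_smul, smul_eq_mul]
    have h3 : c / (2 * M) * -(M * (x ⬝ᵥ x)) ≤ c / (2 * M) * (x ⬝ᵥ (sm w.2 *ᵥ x)) := by gcongr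
    have h4 : c / (2 * M) * -(M * (x ⬝ᵥ x)) = -(c / 2 * (x ⬝ᵥ x)) := by field_simp
    have h5 : 0 < c / 2 * (x ⬝ᵥ x) := by positivity
    linarith

lemma siegel_nonempty : (siegel n).Nonempty := by
  obtain ⟨y, hy⟩ := exists_sm (n := n) (W := 1) (by simp)
  refine ⟨(0, y), ?_⟩
  change PD (sm y)
  rw [hy]
  exact .of_posDef Matrix.PosDef.one

lemma pd_qm {p : SE n} (hp : p ∈ siegel n) : PD (qm p) := by
  have hp : PD (sm p.2) := hp
  refine ⟨?_, fun v hv => ?_⟩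
  · rw [qm, Matrix.fromBlocks_transpose]
    simp only [Matrix.transpose_add, Matrix.transpose_mul, sm_transpose, hp.inv.symm,
      Matrix.mul_assoc]
  · have h := qf_eq p v
    rw [qf] at h
    rw [h]
    by_cases hc : v ∘ Sum.inl = 0
    · rw [hc]
      simp only [Matrix.mulVec_zero, dotProduct_zero, zero_add]
      refine hp.inv.pos _ fun hd => hv ?_
      rw [← Sum.elim_comp_inl_inr v, hc, hd]
      ext (i | i) <;> rfl
    · exact add_pos_of_pos_of_nonneg (hp.pos _ hc) (hp.inv.nonneg _)

lemma qm_symp {p : SE n} (hp : p ∈ siegel n) : qm p * J (Fin n) ℝ * qm p = J (Fin n) ℝ := by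
  have hp : PD (sm p.2) := hp
  have h1 := Matrix.mul_nonsing_inv _ hp.isUnit_det
  have h2 := Matrix.nonsing_inv_mul _ hp.isUnit_det
  rw [qm, J, Matrix.fromBlocks_multiply, Matrix.fromBlocks_multiply]
  set x := sm p.1
  set y := sm p.2
  simp only [mul_zero, zero_add, add_zero, mul_one, Matrix.mul_neg, Matrix.neg_mul]
  congr 1
  · simp only [mul_add, add_mul, Matrix.mul_assoc, h2, mul_one]
    simp only [← Matrix.mul_assoc, h1, one_mul]
    abel
  · simp only [add_mul, h1, ← Matrix.mul_assoc]
    abel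
  · simp only [mul_add, ← Matrix.mul_assoc, h2]
    abel
  · simp only [← Matrix.mul_assoc]
    abel

lemma exists_qm {Q : Matrix (Fin n ⊕ Fin n) (Fin n ⊕ Fin n) ℝ} (hQ : PD Q)
    (hJ : Q * J (Fin n) ℝ * Q = J (Fin n) ℝ) : ∃ p ∈ siegel n, qm p = Q := by
  have hs := hQ.symm
  have he : PD Q.toBlocks₂₂ := .of_posDef (hQ.posDef.submatrix Sum.inr_injective)
  obtain ⟨a, b, c, e, rfl⟩ : ∃ a b c e, Q = fromBlocks a b c e :=
    ⟨_, _, _, _, (Matrix.fromBlocks_toBlocks Q).symm⟩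
  rw [Matrix.toBlocks_fromBlocks₂₂] at he
  rw [Matrix.fromBlocks_transpose, Matrix.fromBlocks_inj] at hs
  obtain ⟨ha, hc, hb, -⟩ := hs
  rw [J, Matrix.fromBlocks_multiply, Matrix.fromBlocks_multiply, Matrix.fromBlocks_inj] at hJ
  simp only [mul_zero, zero_add, add_zero, mul_one, Matrix.mul_neg, Matrix.neg_mul] at hJ
  obtain ⟨-, h12, -, h22⟩ := hJ
  have h1 := Matrix.mul_nonsing_inv _ he.isUnit_det
  have h2 := Matrix.nonsing_inv_mul _ he.isUnit_det
  have hce : c * e = e * b := by rw [← sub_eq_zero, ← neg_eq_zero, ← h22]; abel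
  have hbe : b * e⁻¹ = e⁻¹ * c := by
    calc b * e⁻¹ = e⁻¹ * (e * b) * e⁻¹ := by rw [← Matrix.mul_assoc, h2, one_mul]
      _ = e⁻¹ * c * (e * e⁻¹) := by rw [← hce]; simp only [Matrix.mul_assoc]
      _ = _ := by rw [h1, mul_one]
  have hae : a = e⁻¹ + b * e⁻¹ * c := by
    have h3 : a * e = 1 + b * b := by
      rw [← sub_eq_zero, ← neg_eq_zero]
      have := h12
      rw [← sub_eq_zero] at this
      rw [← this]
      abel
    calc a = a * e * e⁻¹ := by rw [Matrix.mul_assoc, h1, mul_one]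
      _ = e⁻¹ + b * (b * e⁻¹) := by rw [h3, add_mul, one_mul, Matrix.mul_assoc]
      _ = e⁻¹ + b * (e⁻¹ * c) := by rw [hbe]
      _ = _ := by rw [Matrix.mul_assoc]
  obtain ⟨x, hx⟩ := exists_sm (W := b * e⁻¹) (by
    rw [Matrix.transpose_mul, he.inv.symm, hb, hbe])
  obtain ⟨y, hy⟩ := exists_sm (W := e⁻¹) he.inv.symm
  refine ⟨(x, y), ?_, ?_⟩
  · change PD (sm y)
    rw [hy]; exact he.inv
  · rw [qm]
    simp only [hx, hy, Matrix.nonsing_inv_nonsing_inv _ he.isUnit_det]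
    congr 1
    · rw [hae, Matrix.mul_assoc b, h2, mul_one, Matrix.mul_assoc b, ← hbe]
    · rw [Matrix.mul_assoc, h2, mul_one]
    · rw [hbe, ← Matrix.mul_assoc, h1, one_mul]

end Siegel

end SpTop

namespace SpTop

open Matrix

section Pieces

variable {n : ℕ}

lemma PD.le_of_diag {ι : Type*} [Fintype ι] [DecidableEq ι] {Q : Matrix ι ι ℝ} (h : PD Q) {D : ℝ}
    (hD : ∀ i, Q i i ≤ D) (x : ι → ℝ) : x ⬝ᵥ (Q *ᵥ x) ≤ D * Fintype.card ι * (x ⬝ᵥ x) := by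
  have h0 : ∀ i j, Pi.single i (1 : ℝ) ⬝ᵥ (Q *ᵥ Pi.single j 1) = Q i j := fun i j => by simp
  have h1 : ∀ i j, Q i j * (x i * x j) ≤ D * ((x i ^ 2 + x j ^ 2) / 2) := fun i j => by
    have hi := h.nonneg (Pi.single i 1)
    have hj := h.nonneg (Pi.single j 1)
    have hc := h.cs (Pi.single i 1) (Pi.single j 1)
    rw [h0] at hi hj hc
    rw [h0, h0] at hc
    have hD0 : 0 ≤ D := hi.trans (hD i)
    have h2 : |Q i j| ≤ D := by
      refine abs_le_of_sq_le_sq ?_ hD0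
      nlinarith [hD i, hD j]
    calc Q i j * (x i * x j) ≤ |Q i j * (x i * x j)| := le_abs_self _
      _ = |Q i j| * |x i * x j| := abs_mul _ _
      _ ≤ D * ((x i ^ 2 + x j ^ 2) / 2) := by
        gcongr
        rw [abs_le]
        constructor <;> nlinarith [sq_nonneg (x i + x j), sq_nonneg (x i - x j)]
  calc x ⬝ᵥ (Q *ᵥ x) = ∑ i, ∑ j, Q i j * (x i * x j) := by
        simp only [dotProduct, Matrix.mulVec, Finset.mul_sum]
        exact Finset.sum_congr rfl fun i _ => Finset.sum_congr rfl fun j _ => by ring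
    _ ≤ ∑ i, ∑ j, D * ((x i ^ 2 + x j ^ 2) / 2) :=
        Finset.sum_le_sum fun i _ => Finset.sum_le_sum fun j _ => h1 i j
    _ = _ := by
        simp only [← Finset.mul_sum, ← Finset.sum_div, Finset.sum_add_distrib, Finset.sum_const,
          Finset.card_univ, nsmul_eq_mul, dotProduct, ← sq]
        ring

/-- The set of points whose quadratic form is bounded on the columns of a matrix. -/
def Vr (g : Matrix (Fin n ⊕ Fin n) (Fin n ⊕ Fin n) ℝ) (k : Fin n ⊕ Fin n → ℤ) : Set (SE n) :=
  {p | p ∈ siegel n ∧ ∀ i, qf p (g.col i) ≤ 2 ^ k i}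

lemma qf_le_of_mem_Vr {g : Matrix (Fin n ⊕ Fin n) (Fin n ⊕ Fin n) ℝ} (hg : IsUnit g.det)
    (k : Fin n ⊕ Fin n → ℤ) : ∃ R, 0 < R ∧ ∀ p ∈ Vr g k, ∀ v, qf p v ≤ R * (v ⬝ᵥ v) := by
  obtain ⟨M, hM, hMx⟩ := exists_dot_bound (g⁻¹ᵀ * g⁻¹)
  obtain ⟨D, hD⟩ := (Set.finite_range fun i => (2 : ℝ) ^ k i).bddAbove
  have hD : ∀ i, (2 : ℝ) ^ k i ≤ D := fun i => hD ⟨i, rfl⟩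
  refine ⟨(|D| * Fintype.card (Fin n ⊕ Fin n) * M) + 1, by positivity, fun p hp v => ?_⟩
  have hinj : ∀ x, g *ᵥ x = 0 → x = 0 := fun x hx => mulVec_eq_zero_of_isUnit hg x hx
  have hQ := (pd_qm hp.1).congr hinj
  have key : ∀ x y, x ⬝ᵥ ((gᵀ * qm p * g) *ᵥ y) = (g *ᵥ x) ⬝ᵥ (qm p *ᵥ (g *ᵥ y)) := fun x y => by
    rw [← Matrix.mulVec_mulVec, ← Matrix.mulVec_mulVec, Matrix.dotProduct_mulVec,
      Matrix.vecMul_transpose]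
  have hdiag : ∀ i, (gᵀ * qm p * g) i i ≤ |D| := fun i => by
    have h1 := key (Pi.single i 1) (Pi.single i 1)
    simp only [Matrix.mulVec_single_one, single_one_dotProduct, Matrix.col_apply] at h1
    rw [h1]
    exact (hp.2 i).trans ((hD i).trans (le_abs_self _))
  have h2 := hQ.le_of_diag hdiag (g⁻¹ *ᵥ v)
  rw [key, Matrix.mulVec_mulVec, Matrix.mul_nonsing_inv _ hg, Matrix.one_mulVec] at h2
  have h3 : (g⁻¹ *ᵥ v) ⬝ᵥ (g⁻¹ *ᵥ v) ≤ M * (v ⬝ᵥ v) := by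
    refine le_trans (le_of_eq ?_) ((le_abs_self _).trans (hMx v))
    rw [← Matrix.mulVec_mulVec, Matrix.dotProduct_mulVec v, Matrix.vecMul_transpose]
  have h4 : 0 ≤ v ⬝ᵥ v := Finset.sum_nonneg fun i _ => mul_self_nonneg _
  calc qf p v ≤ _ := h2
    _ ≤ |D| * Fintype.card (Fin n ⊕ Fin n) * (M * (v ⬝ᵥ v)) := by gcongr
    _ ≤ _ := by rw [add_mul, mul_assoc _ M]; linarith

lemma aff_smul (v : Fin n ⊕ Fin n → ℝ) (w : Fin n → ℝ) (t : ℝ) (p : SE n) :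
    aff v (t • w) p = 2 * t * (w ⬝ᵥ (sm p.1 *ᵥ (v ∘ Sum.inl) + v ∘ Sum.inr)) -
      t ^ 2 * (w ⬝ᵥ (sm p.2 *ᵥ w)) + (v ∘ Sum.inl) ⬝ᵥ (sm p.2 *ᵥ (v ∘ Sum.inl)) := by
  simp only [aff, smul_dotProduct, Matrix.mulVec_smul, dotProduct_smul, smul_eq_mul]
  ring

lemma quad_bound {a b c : ℝ} (h : ∀ t : ℝ, 2 * t * a - t ^ 2 * b ≤ c) :
    0 ≤ b ∧ (b = 0 → a = 0) := by
  constructor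
  · by_contra! hb
    have h1 := h ((1 + |c|) / -b * (1 + -b))
    have h2 := h (-((1 + |c|) / -b * (1 + -b)))
    have h3 : ((1 + |c|) / -b * (1 + -b)) ^ 2 * b = -(1 + |c|) ^ 2 * (1 + -b) ^ 2 / -b := by
      field_simp
    have h5 : (1 + |c|) ^ 2 * 1 ≤ (1 + |c|) ^ 2 * (1 + -b) ^ 2 / -b := by
      rw [mul_div_assoc]
      gcongr
      rw [le_div_iff₀ (by linarith)]
      nlinarith
    have h6 : -(1 + |c|) ^ 2 * (1 + -b) ^ 2 / -b = -((1 + |c|) ^ 2 * (1 + -b) ^ 2 / -b) := by ring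
    have h7 := le_abs_self c
    have h8 := abs_nonneg c
    nlinarith
  · rintro rfl
    by_contra ha
    have h1 := h ((|c| + 1) / (2 * a))
    have h2 : 2 * ((|c| + 1) / (2 * a)) * a = |c| + 1 := by field_simp
    have := le_abs_self c
    linarith

lemma Vr_eq {g : Matrix (Fin n ⊕ Fin n) (Fin n ⊕ Fin n) ℝ} (hg : IsUnit g.det)
    (k : Fin n ⊕ Fin n → ℤ) : Vr g k = {p | ∀ i w, aff (g.col i) w p ≤ 2 ^ k i} := by
  ext p
  constructor
  · intro hp i
    exact (qf_le_iff hp.1 _ _).1 (hp.2 i)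
  · intro hp
    have hp : ∀ i w, aff (g.col i) w p ≤ 2 ^ k i := hp
    have h1 : ∀ i w, 0 ≤ w ⬝ᵥ (sm p.2 *ᵥ w) ∧ (w ⬝ᵥ (sm p.2 *ᵥ w) = 0 →
        w ⬝ᵥ (sm p.1 *ᵥ (g.col i ∘ Sum.inl) + g.col i ∘ Sum.inr) = 0) := fun i w => by
      refine quad_bound
        (c := 2 ^ k i - (g.col i ∘ Sum.inl) ⬝ᵥ (sm p.2 *ᵥ (g.col i ∘ Sum.inl))) fun t => ?_
      have := hp i (t • w)
      rw [aff_smul] at this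
      linarith
    have hs : p ∈ siegel n := by
      refine ⟨sm_transpose _, fun w hw => ?_⟩
      obtain ⟨j, hj⟩ := Function.ne_iff.1 hw
      refine lt_of_le_of_ne (h1 (Sum.inl j) w).1 fun h0 => hw ?_
      have h2 : ∀ i, w ⬝ᵥ (sm p.1 *ᵥ (g.col i ∘ Sum.inl) + g.col i ∘ Sum.inr) = 0 :=
        fun i => (h1 i w).2 h0.symm
      have h3 : ∀ v : Fin n ⊕ Fin n → ℝ, w ⬝ᵥ (sm p.1 *ᵥ (v ∘ Sum.inl) + v ∘ Sum.inr) =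
          Sum.elim (sm p.1 *ᵥ w) w ⬝ᵥ v := fun v => by
        conv_rhs => rw [← Sum.elim_comp_inl_inr v]
        rw [sumElim_dotProduct_sumElim, dotProduct_add, dot_mulVec_comm (sm_transpose _),
          dotProduct_comm]
      have h4 : gᵀ *ᵥ Sum.elim (sm p.1 *ᵥ w) w = 0 := by
        ext i
        have := h2 i
        rw [h3] at this
        rw [Matrix.mulVec_transpose]
        exact this
      have h5 := mulVec_eq_zero_of_isUnit (g := gᵀ) (by rwa [Matrix.det_transpose]) _ h4
      ext i
      exact congrFun h5 (Sum.inr i)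
    exact ⟨hs, fun i => (qf_le_iff hs _ _).2 (hp i)⟩

lemma convex_qf (v : Fin n ⊕ Fin n → ℝ) (t : ℝ) : Convex ℝ {p | p ∈ siegel n ∧ qf p v ≤ t} := by
  intro p hp q hq a b ha hb hab
  have h := convex_siegel hp.1 hq.1 ha hb hab
  refine ⟨h, (qf_le_iff h _ _).2 fun w => ?_⟩
  rw [aff_combo _ _ _ _ hab]
  have h1 := (qf_le_iff hp.1 _ _).1 hp.2 w
  have h2 := (qf_le_iff hq.1 _ _).1 hq.2 w
  calc _ ≤ a * t + b * t := by gcongr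
    _ = t := by rw [← add_mul, hab, one_mul]

lemma convex_Vr (g : Matrix (Fin n ⊕ Fin n) (Fin n ⊕ Fin n) ℝ) (k : Fin n ⊕ Fin n → ℤ) :
    Convex ℝ (Vr g k) := by
  intro p hp q hq a b ha hb hab
  exact ⟨convex_siegel hp.1 hq.1 ha hb hab, fun i =>
    (convex_qf _ _ (show p ∈ {p | p ∈ siegel n ∧ qf p (g.col i) ≤ 2 ^ k i} from ⟨hp.1, hp.2 i⟩)
      ⟨hq.1, hq.2 i⟩ ha hb hab).2⟩

lemma isClosed_Vr {g : Matrix (Fin n ⊕ Fin n) (Fin n ⊕ Fin n) ℝ} (hg : IsUnit g.det)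
    (k : Fin n ⊕ Fin n → ℤ) : IsClosed (Vr g k) := by
  rw [Vr_eq hg]
  simp only [Set.ofPred_forall]
  exact isClosed_iInter fun i => isClosed_iInter fun w =>
    isClosed_le (continuous_aff _ _) continuous_const

lemma coord_bound {p : SE n} (hp : p ∈ siegel n) {R : ℝ} (hR : ∀ v, qf p v ≤ R * (v ⬝ᵥ v))
    (i j : Fin n) : |sm p.1 i j| ≤ R ∧ |sm p.2 i j| ≤ R := by
  have hy : PD (sm p.2) := hp
  have h : ∀ c w : Fin n → ℝ, 2 * (w ⬝ᵥ (sm p.1 *ᵥ c)) - w ⬝ᵥ (sm p.2 *ᵥ w) + c ⬝ᵥ (sm p.2 *ᵥ c) ≤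
      R * (c ⬝ᵥ c) := fun c w => by
    have := (qf_le_iff hp (Sum.elim c 0) _).1 (hR _) w
    simpa [aff, sumElim_dotProduct_sumElim] using this
  have h1 : ∀ i j, Pi.single i (1 : ℝ) ⬝ᵥ (sm p.2 *ᵥ Pi.single j 1) = sm p.2 i j :=
    fun i j => by simp
  have h2 : ∀ i j, Pi.single i (1 : ℝ) ⬝ᵥ (sm p.1 *ᵥ Pi.single j 1) = sm p.1 i j :=
    fun i j => by simp
  have hpos : ∀ i, 0 ≤ sm p.2 i i := fun i => by rw [← h1]; exact hy.nonneg _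
  have hle : ∀ i, sm p.2 i i ≤ R := fun i => by
    have := h (Pi.single i 1) 0
    simpa using this
  have hcs := hy.cs (Pi.single i 1) (Pi.single j 1)
  rw [h1, h1, h1] at hcs
  have hR0 := (hpos i).trans (hle i)
  constructor
  · have ha := h (Pi.single j 1) (Pi.single i 1)
    have hb := h (Pi.single j 1) (-Pi.single i 1)
    simp only [neg_dotProduct, Matrix.mulVec_neg, dotProduct_neg, h1, h2] at ha hb
    simp at ha hb
    have := hpos i
    have := hpos j
    have := hle i
    rw [abs_le]
    constructor <;> linarith
  · refine abs_le_of_sq_le_sq ?_ hR0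
    nlinarith [hle i, hle j, hpos i, hpos j]

lemma isCompact_Vr {g : Matrix (Fin n ⊕ Fin n) (Fin n ⊕ Fin n) ℝ} (hg : IsUnit g.det)
    (k : Fin n ⊕ Fin n → ℤ) : IsCompact (Vr g k) := by
  refine Metric.isCompact_of_isClosed_isBounded (isClosed_Vr hg k) ?_
  obtain ⟨R, hR, h⟩ := qf_le_of_mem_Vr hg k
  refine (Metric.isBounded_closedBall (x := (0 : SE n)) (r := R)).subset fun p hp => ?_
  rw [mem_closedBall_zero_iff, Prod.norm_def, max_le_iff, pi_norm_le_iff_of_nonneg hR.le,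
    pi_norm_le_iff_of_nonneg hR.le]
  exact ⟨fun s => Sym2.ind (fun i j => (coord_bound hp.1 (h p hp) i j).1) s,
    fun s => Sym2.ind (fun i j => (coord_bound hp.1 (h p hp) i j).2) s⟩

lemma J_dot (v w : Fin n ⊕ Fin n → ℝ) : (J (Fin n) ℝ *ᵥ v) ⬝ᵥ (J (Fin n) ℝ *ᵥ w) = v ⬝ᵥ w := by
  rw [Matrix.dotProduct_mulVec, ← Matrix.mulVec_transpose, J_transpose, Matrix.mulVec_mulVec,
    Matrix.neg_mul, J_squared, neg_neg, Matrix.one_mulVec]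

lemma om_sq_le {p : SE n} (hp : p ∈ siegel n) (v w : Fin n ⊕ Fin n → ℝ) :
    om n ℝ v w ^ 2 ≤ qf p v * qf p w := by
  have hs := qm_symp hp
  have hQ := pd_qm hp
  have h1 : qf p (J (Fin n) ℝ *ᵥ (qm p *ᵥ w)) = qf p w := by
    have h3 : qm p *ᵥ (J (Fin n) ℝ *ᵥ (qm p *ᵥ w)) = J (Fin n) ℝ *ᵥ w := by
      rw [Matrix.mulVec_mulVec, Matrix.mulVec_mulVec, hs]
    rw [qf, qf, h3, J_dot, dotProduct_comm]
  have h2 : v ⬝ᵥ (qm p *ᵥ (J (Fin n) ℝ *ᵥ (qm p *ᵥ w))) = om n ℝ v w := by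
    rw [Matrix.mulVec_mulVec, Matrix.mulVec_mulVec, hs, om_apply]
  rw [← h1, ← h2]
  exact hQ.cs _ _

lemma dot_le_qf {p : SE n} (hp : p ∈ siegel n) {R : ℝ} (hR : ∀ v, qf p v ≤ R * (v ⬝ᵥ v))
    (v : Fin n ⊕ Fin n → ℝ) : v ⬝ᵥ v ≤ R * qf p v := by
  have h1 := om_sq_le hp v (-(J (Fin n) ℝ *ᵥ v))
  rw [om_neg_J] at h1
  have h2 := hR (-(J (Fin n) ℝ *ᵥ v))
  have h3 : -(J (Fin n) ℝ *ᵥ v) ⬝ᵥ -(J (Fin n) ℝ *ᵥ v) = v ⬝ᵥ v := by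
    rw [neg_dotProduct_neg, J_dot]
  rw [h3] at h2
  have h4 : 0 ≤ v ⬝ᵥ v := Finset.sum_nonneg fun i _ => mul_self_nonneg _
  have h5 : 0 ≤ qf p v := (pd_qm hp).nonneg v
  rcases h4.eq_or_lt with h0 | h0
  · have := hR v
    rw [← h0] at this ⊢
    have h6 : qf p v = 0 := le_antisymm (by linarith) h5
    rw [h6, mul_zero]
  · have : (v ⬝ᵥ v) * (v ⬝ᵥ v) ≤ (R * qf p v) * (v ⬝ᵥ v) := by nlinarith
    exact le_of_mul_le_mul_right this h0

variable (n) in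
/-- Integral frames with levels. -/
@[ext] structure Vx where
  /-- The matrix whose columns are the frame. -/
  mat : Matrix (Fin n ⊕ Fin n) (Fin n ⊕ Fin n) ℤ
  /-- The levels. -/
  lev : Fin n ⊕ Fin n → ℤ

/-- Unimodular frames with bounded total level. -/
def Vx.Ok (c : ℤ) (a : Vx n) : Prop := IsUnit a.mat.det ∧ ∑ i, a.lev i ≤ c

lemma finite_meet {M : Matrix (Fin n ⊕ Fin n) (Fin n ⊕ Fin n) ℝ} (hM : IsUnit M.det) (c : ℤ)
    {K : Set (SE n)} {R : ℝ} (hR : ∀ p ∈ K, ∀ v, qf p v ≤ R * (v ⬝ᵥ v)) :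
    {a : Vx n | a.Ok c ∧ (K ∩ Vr (M * toR a.mat) a.lev).Nonempty}.Finite := by
  have hinj : ∀ x, M *ᵥ x = 0 → x = 0 := fun x hx => mulVec_eq_zero_of_isUnit hM x hx
  have hP : PD (Mᵀ * M) := by
    have := (PD.of_posDef (Matrix.PosDef.one (n := Fin n ⊕ Fin n) (R := ℝ))).congr hinj
    rwa [Matrix.mul_one] at this
  have hPx : ∀ x, x ⬝ᵥ ((Mᵀ * M) *ᵥ x) = (M *ᵥ x) ⬝ᵥ (M *ᵥ x) := fun x => by
    rw [← Matrix.mulVec_mulVec, Matrix.dotProduct_mulVec, Matrix.vecMul_transpose]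
  obtain ⟨δ, hδ, hδx⟩ := hP.exists_lower
  obtain ⟨N, hN⟩ := pow_unbounded_of_one_lt (|R| / δ) one_lt_two
  have key : ∀ a : Vx n, a.Ok c ∧ (K ∩ Vr (M * toR a.mat) a.lev).Nonempty →
      ∀ i, qi (Mᵀ * M) (a.mat.col i) ≤ |R| * 2 ^ a.lev i ∧ -(N : ℤ) ≤ a.lev i := by
    rintro a ⟨⟨ha, -⟩, p, hpK, hp⟩ i
    have h0 : (M * toR a.mat).col i = M *ᵥ fun j => (a.mat.col i j : ℝ) := rfl
    have h1 := hp.2 i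
    have h2 := dot_le_qf hp.1 (hR p hpK) ((M * toR a.mat).col i)
    have h5 : 0 ≤ qf p ((M * toR a.mat).col i) := (pd_qm hp.1).nonneg _
    have h3 : qi (Mᵀ * M) (a.mat.col i) ≤ |R| * 2 ^ a.lev i := by
      rw [qi, hPx, ← h0]
      refine h2.trans ?_
      calc _ ≤ |R| * qf p ((M * toR a.mat).col i) := by gcongr; exact le_abs_self _
        _ ≤ _ := by gcongr
    refine ⟨h3, ?_⟩
    have h4 : (1 : ℝ) ≤ (fun j => (a.mat.col i j : ℝ)) ⬝ᵥ fun j => (a.mat.col i j : ℝ) := by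
      have hne : a.mat.col i ≠ 0 := fun h => by
        have : a.mat.det = 0 := Matrix.det_eq_zero_of_column_eq_zero i fun j => congrFun h j
        rw [this] at ha
        exact not_isUnit_zero ha
      obtain ⟨j, hj⟩ := Function.ne_iff.1 hne
      refine le_trans ?_ (sq_le_dot _ j)
      have : (1 : ℤ) ≤ (a.mat.col i j) ^ 2 :=
        Int.add_one_le_iff.2 (by simpa using sq_pos_of_ne_zero hj)
      exact_mod_cast this
    have h6 := (hδx _).trans h3
    have h7 : δ ≤ |R| * 2 ^ a.lev i := by nlinarith
    by_contra! hlt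
    have h8 : (2 : ℝ) ^ a.lev i ≤ 2 ^ (-(N : ℤ)) := zpow_le_zpow_right₀ one_le_two hlt.le
    rw [_root_.zpow_neg, zpow_natCast] at h8
    have h9 : |R| < 2 ^ N * δ := by rwa [div_lt_iff₀ hδ] at hN
    have h10 : |R| * 2 ^ a.lev i ≤ |R| * (2 ^ N)⁻¹ := by gcongr
    have h11 : |R| * (2 ^ N : ℝ)⁻¹ < δ := by
      rw [← div_eq_mul_inv, div_lt_iff₀ (by positivity)]
      linarith
    linarith
  set B : ℤ := |c| + N * Fintype.card (Fin n ⊕ Fin n) with hB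
  have hfinc : {b : Fin n ⊕ Fin n → ℤ | qi (Mᵀ * M) b ≤ |R| * 2 ^ B}.Finite := hP.finite_le _
  have hm := (Set.Finite.pi' fun _ : Fin n ⊕ Fin n => hfinc)
  have hl := Set.finite_Icc (fun _ : Fin n ⊕ Fin n => -(N : ℤ)) fun _ => B
  refine ((hm.prod hl).image fun x => (⟨(of x.1)ᵀ, x.2⟩ : Vx n)).subset fun a ha => ?_
  have hlev : ∀ i, a.lev i ≤ B := fun i => by
    have h1 := ha.1.2
    have h2 : a.lev i + N ≤ ∑ i, (a.lev i + N) :=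
      Finset.single_le_sum (f := fun i => a.lev i + (N : ℤ)) (fun j _ => by
        have := (key a ha j).2
        linarith) (Finset.mem_univ i)
    rw [Finset.sum_add_distrib, Finset.sum_const, Finset.card_univ, nsmul_eq_mul] at h2
    have := le_abs_self c
    rw [hB, mul_comm]
    have : (0 : ℤ) ≤ N := Int.natCast_nonneg _
    linarith
  refine ⟨(a.matᵀ, a.lev), ⟨fun i => ?_, fun i => (key a ha i).2, hlev⟩, ?_⟩
  · refine (key a ha i).1.trans ?_
    gcongr
    · norm_num
    · exact hlev i
  · cases a; rfl

end Pieces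

end SpTop

namespace SpTop

open Matrix

lemma LF.comap {E Y Y' : Type*} [NormedAddCommGroup E] [NormedSpace ℝ E] {X : Set E}
    {V : Y → Set E} (h : LF X V) {φ : Y' → Y} (hφ : Function.Injective φ) : LF X (V ∘ φ) where
  sub _ := h.sub _
  conv _ := h.conv _
  cpt _ := h.cpt _
  star a :=
    Set.Finite.preimage (f := φ) (s := {b | (V (φ a) ∩ V b).Nonempty}) hφ.injOn (h.star (φ a))
  seg p hp q hq := Set.Finite.preimage (f := φ) (s := {a | (segment ℝ p q ∩ V a).Nonempty}) hφ.injOn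
    (h.seg p hp q hq)

section Cover

variable {n : ℕ}

/-- The piece of the Siegel space attached to a frame translated by a real matrix. -/
def Vp (M : Matrix (Fin n ⊕ Fin n) (Fin n ⊕ Fin n) ℝ) (c : ℤ) (a : Vx n) : Set (SE n) :=
  {p | a.Ok c ∧ p ∈ Vr (M * toR a.mat) a.lev}

lemma Vp_eq {M : Matrix (Fin n ⊕ Fin n) (Fin n ⊕ Fin n) ℝ} {c : ℤ} {a : Vx n} (ha : a.Ok c) :
    Vp M c a = Vr (M * toR a.mat) a.lev := by simp [Vp, ha]

lemma Vp_eq_empty {M : Matrix (Fin n ⊕ Fin n) (Fin n ⊕ Fin n) ℝ} {c : ℤ} {a : Vx n}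
    (ha : ¬ a.Ok c) : Vp M c a = ∅ := by
  ext p; simp [Vp, ha]

lemma isUnit_det_mul_toR {M : Matrix (Fin n ⊕ Fin n) (Fin n ⊕ Fin n) ℝ} (hM : IsUnit M.det)
    {c : ℤ} {a : Vx n} (ha : a.Ok c) : IsUnit (M * toR a.mat).det := by
  rw [Matrix.det_mul]
  exact hM.mul (isUnit_det_cast ha.1)

lemma exists_qf_le (p : SE n) : ∃ R, 0 < R ∧ ∀ v, qf p v ≤ R * (v ⬝ᵥ v) := by
  obtain ⟨R, hR, h⟩ := exists_dot_bound (qm p)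
  exact ⟨R, hR, fun v => (le_abs_self _).trans (h v)⟩

lemma finite_Vp {M : Bool → Matrix (Fin n ⊕ Fin n) (Fin n ⊕ Fin n) ℝ} (hM : ∀ b, IsUnit (M b).det)
    (c : ℤ) {K : Set (SE n)} {R : ℝ} (hR : ∀ p ∈ K, ∀ v, qf p v ≤ R * (v ⬝ᵥ v)) :
    {a : Bool × Vx n | (K ∩ Vp (M a.1) c a.2).Nonempty}.Finite := by
  refine (Set.finite_iUnion fun b => (finite_meet (hM b) c hR).image (Prod.mk b)).subset ?_
  rintro ⟨b, a⟩ ⟨p, hp, hpa⟩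
  exact Set.mem_iUnion.2 ⟨b, a, ⟨hpa.1, p, hp, hpa.2⟩, rfl⟩

lemma LF_Vp {M : Bool → Matrix (Fin n ⊕ Fin n) (Fin n ⊕ Fin n) ℝ} (hM : ∀ b, IsUnit (M b).det)
    (c : ℤ) : LF (siegel n) fun a : Bool × Vx n => Vp (M a.1) c a.2 where
  sub _ _ hp := hp.2.1
  conv a := by
    by_cases ha : a.2.Ok c
    · rw [Vp_eq ha]; exact convex_Vr _ _
    · rw [Vp_eq_empty ha]; exact convex_empty
  cpt a := by
    by_cases ha : a.2.Ok c
    · rw [Vp_eq ha]; exact isCompact_Vr (isUnit_det_mul_toR (hM _) ha) _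
    · rw [Vp_eq_empty ha]; exact isCompact_empty
  star a := by
    by_cases ha : a.2.Ok c
    · obtain ⟨R, -, hR⟩ := qf_le_of_mem_Vr (isUnit_det_mul_toR (hM a.1) ha) a.2.lev
      exact finite_Vp hM c fun p hp => hR p hp.2
    · simp [Vp_eq_empty ha]
  seg p hp q hq := by
    obtain ⟨R, -, hR⟩ := exists_qf_le p
    obtain ⟨R', -, hR'⟩ := exists_qf_le q
    refine finite_Vp (R := max R R') hM c fun x hx v => ?_
    have h0 : 0 ≤ v ⬝ᵥ v := Finset.sum_nonneg fun i _ => mul_self_nonneg _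
    refine ((convex_qf v (max R R' * (v ⬝ᵥ v))).segment_subset ⟨hp, (hR v).trans ?_⟩
      ⟨hq, (hR' v).trans ?_⟩ hx).2
    · gcongr; exact le_max_left _ _
    · gcongr; exact le_max_right _ _

lemma det_qm {p : SE n} (hp : p ∈ siegel n) : (qm p).det = 1 := by
  have h := congrArg Matrix.det (qm_symp hp)
  rw [Matrix.det_mul, Matrix.det_mul] at h
  have h1 := (isUnit_det_J (Fin n) ℝ).ne_zero
  have h2 := (pd_qm hp).det_pos
  have h3 : (qm p).det * (qm p).det = 1 := by
    apply mul_right_cancel₀ h1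
    linear_combination h
  nlinarith

lemma prod_two_zpow {ι : Type*} (s : Finset ι) (k : ι → ℤ) :
    ∏ i ∈ s, (2 : ℝ) ^ k i = 2 ^ ∑ i ∈ s, k i := by
  classical
  induction s using Finset.induction_on with
  | empty => simp
  | insert a s ha ih =>
    rw [Finset.prod_insert ha, Finset.sum_insert ha, ih, zpow_add₀ two_ne_zero]

variable (n) in
lemma exists_cover : ∃ c, ∀ p ∈ siegel n, ∃ a, p ∈ Vp 1 c a := by
  obtain ⟨C, hC, h⟩ := exists_red (ι := Fin n ⊕ Fin n)
  obtain ⟨N, hN⟩ := pow_unbounded_of_one_lt C one_lt_two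
  refine ⟨N + Fintype.card (Fin n ⊕ Fin n), fun p hp => ?_⟩
  obtain ⟨g, hg, hprod⟩ := h _ (pd_qm hp)
  rw [det_qm hp, mul_one] at hprod
  have hq : ∀ i, qi (qm p) (fun j => g j i) = qf p ((1 * toR g).col i) := fun i => by
    rw [one_mul]; rfl
  have hpos : ∀ i, 0 < qf p ((1 * toR g).col i) := fun i => by
    rw [one_mul]
    refine (pd_qm hp).pos _ fun h => ?_
    have h0 : (toR g).det = 0 := Matrix.det_eq_zero_of_column_eq_zero i fun j => congrFun h j
    exact (isUnit_det_cast hg).ne_zero h0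
  simp only [hq] at hprod
  refine ⟨⟨g, fun i => Int.clog 2 (qf p ((1 * toR g).col i))⟩, ⟨hg, ?_⟩, hp, fun i => ?_⟩
  · have h1 : ∏ i, (2 : ℝ) ^ (Int.clog 2 (qf p ((1 * toR g).col i)) - 1) ≤ 2 ^ (N : ℤ) := by
      rw [zpow_natCast]
      refine le_trans (Finset.prod_le_prod (fun i _ => by positivity) fun i _ => ?_)
        (hprod.trans hN.le)
      have := Int.zpow_pred_clog_lt_self (b := 2) one_lt_two (hpos i)
      exact_mod_cast this.le
    rw [prod_two_zpow, zpow_le_zpow_iff_right₀ one_lt_two, Finset.sum_sub_distrib, Finset.sum_const,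
      Finset.card_univ, nsmul_eq_mul] at h1
    change ∑ i, _ ≤ _
    linarith
  · have := Int.self_le_zpow_clog (b := 2) one_lt_two (qf p ((1 * toR g).col i))
    exact_mod_cast this

lemma isUnit_det_of_symp {R : Type*} [CommRing R] {g : Matrix (Fin n ⊕ Fin n) (Fin n ⊕ Fin n) R}
    (hg : g ∈ symplecticGroup (Fin n) R) : IsUnit g.det := SymplecticGroup.symplectic_det hg

lemma exists_act {g : Matrix (Fin n ⊕ Fin n) (Fin n ⊕ Fin n) ℝ} (hg : g ∈ symplecticGroup (Fin n) ℝ)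
    {p : SE n} (hp : p ∈ siegel n) : ∃ q ∈ siegel n, ∀ v, qf q (g *ᵥ v) = qf p v := by
  have hu := isUnit_det_of_symp hg
  have hi : g⁻¹ ∈ symplecticGroup (Fin n) ℝ := by
    have := SymplecticGroup.coe_inv' (⟨g, hg⟩ : symplecticGroup (Fin n) ℝ)
    rw [← this]
    exact SetLike.coe_mem _
  have hinj : ∀ x, g⁻¹ *ᵥ x = 0 → x = 0 := fun x hx =>
    mulVec_eq_zero_of_isUnit (isUnit_det_of_symp hi) x hx
  obtain ⟨q, hq, hqe⟩ := exists_qm ((pd_qm hp).congr hinj) (by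
    calc g⁻¹ᵀ * qm p * g⁻¹ * J (Fin n) ℝ * (g⁻¹ᵀ * qm p * g⁻¹)
        = g⁻¹ᵀ * (qm p * (g⁻¹ * J (Fin n) ℝ * g⁻¹ᵀ) * qm p) * g⁻¹ := by
          simp only [Matrix.mul_assoc]
      _ = J (Fin n) ℝ := by
        rw [SymplecticGroup.mem_iff.1 hi, qm_symp hp, SymplecticGroup.mem_iff'.1 hi])
  refine ⟨q, hq, fun v => ?_⟩
  have h1 : g⁻¹ *ᵥ (g *ᵥ v) = v := by
    rw [Matrix.mulVec_mulVec, Matrix.nonsing_inv_mul _ hu, Matrix.one_mulVec]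
  rw [qf, hqe, ← Matrix.mulVec_mulVec, ← Matrix.mulVec_mulVec, h1, Matrix.dotProduct_mulVec,
    Matrix.vecMul_transpose, h1, qf]

end Cover

end SpTop

namespace SpTop

section ValuedCochains

variable {Y M M' : Type*} [AddCommGroup M] [Module ℚ M] [AddCommGroup M'] [Module ℚ M']

/-- Coboundary of a cochain with values in a vector space. -/
noncomputable def cobV (T : List Y → M) (l : List Y) : M := Finsupp.linearCombination ℚ T (bdl l)

lemma map_cobV (L : M →ₗ[ℚ] M') (T : List Y → M) (l : List Y) :
    L (cobV T l) = cobV (fun m => L (T m)) l := by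
  rw [cobV, cobV, Finsupp.apply_linearCombination]
  rfl

lemma cobV_map {Y' : Type*} (T : List Y → M) (r : Y' → Y) (l : List Y') :
    cobV T (l.map r) = cobV (fun m => T (m.map r)) l := by
  rw [cobV, cobV, ← mp_bdl, mp, Finsupp.lmapDomain_apply, Finsupp.linearCombination_mapDomain]
  rfl

lemma cobV_eq_cob (f : List Y → ℚ) : cobV f = cob f := rfl

lemma cobV_apply {A : Type*} (T : List Y → (A →₀ ℚ)) (l : List Y) (x : A) :
    cobV T l x = cob (fun m => T m x) l :=
  map_cobV (Finsupp.lapply x) T l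

open Classical in
/-- The coboundary cut off outside a set of lists. -/
noncomputable def dl (N : Set (List Y)) (T : List Y → M) (l : List Y) : M :=
  if l ∈ N then cobV T l else 0

lemma dl_of_mem {N : Set (List Y)} {T : List Y → M} {l : List Y} (h : l ∈ N) :
    dl N T l = cobV T l := if_pos h

lemma dl_of_notMem {N : Set (List Y)} {T : List Y → M} {l : List Y} (h : l ∉ N) :
    dl N T l = 0 := if_neg h

lemma map_dl (N : Set (List Y)) (L : M →ₗ[ℚ] M') (T : List Y → M) (l : List Y) :
    L (dl N T l) = dl N (fun m => L (T m)) l := by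
  by_cases h : l ∈ N
  · rw [dl_of_mem h, dl_of_mem h, map_cobV]
  · rw [dl_of_notMem h, dl_of_notMem h, map_zero]

lemma dl_apply {A : Type*} (N : Set (List Y)) (T : List Y → (A →₀ ℚ)) (l : List Y) (x : A) :
    dl N T l x = dl N (fun m => T m x) l :=
  map_dl N (Finsupp.lapply x) T l

lemma dl_sub (N : Set (List Y)) {A : Type*} (T T' : List Y → (A →₀ ℚ)) :
    dl N (T - T') = dl N T - dl N T' := by
  ext l x
  rw [Pi.sub_apply, Finsupp.sub_apply, dl_apply, dl_apply, dl_apply]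
  by_cases h : l ∈ N
  · rw [dl_of_mem h, dl_of_mem h, dl_of_mem h]
    exact cob_sub _ _ _
  · rw [dl_of_notMem h, dl_of_notMem h, dl_of_notMem h, sub_zero]

end ValuedCochains

section System

variable {G Y : Type*} [Group G] [MulAction G Y]

/-- A group acting freely on the vertices of a complex whose finitely supported cohomology is one
dimensional in a single degree, together with the character by which it acts there. -/
structure Sys (N : Set (List Y)) (k : ℤ) (u : List Y → ℚ) (c : G → ℚ) : Prop where
  free : ∀ (γ : G) (y : Y), γ • y = y → γ = 1
  inv : ∀ (γ : G), ∀ l ∈ N, l.map (γ • ·) ∈ N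
  nil : [] ∉ N
  cplx : Cplx True N
  star : ∀ a, {b | ∃ l ∈ N, a ∈ l ∧ b ∈ l}.Finite
  van : ∀ j : ℤ, j ≠ k → ∀ f, Adm True j f → Coc N f → Cob True j N f
  adm : Adm True k u
  coc : Coc N u
  span : Span True k N u
  ncob : ¬ Cob True k N u
  twist : ∀ γ : G, Cob True k N fun l => u (l.map (γ • ·)) - c γ * u l

lemma Cob.add {Y : Type*} {c : Prop} {k : ℤ} {N : Set (List Y)} {f g : List Y → ℚ}
    (hf : Cob c k N f) (hg : Cob c k N g) : Cob c k N (f + g) := by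
  obtain ⟨a, ha, h1⟩ := hf
  obtain ⟨b, hb, h2⟩ := hg
  exact ⟨a + b, ha.add hb, fun l hl => by rw [Pi.add_apply, h1 l hl, h2 l hl, cob_add]⟩

lemma Cob.smul {Y : Type*} {c : Prop} {k : ℤ} {N : Set (List Y)} {f : List Y → ℚ}
    (hf : Cob c k N f) (r : ℚ) : Cob c k N (r • f) := by
  obtain ⟨a, ha, h1⟩ := hf
  exact ⟨r • a, ha.smul r, fun l hl => by rw [Pi.smul_apply, h1 l hl, cob_smul, smul_eq_mul]⟩

lemma Cob.congr {Y : Type*} {c : Prop} {k : ℤ} {N : Set (List Y)} {f g : List Y → ℚ}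
    (hf : Cob c k N f) (h : ∀ l ∈ N, g l = f l) : Cob c k N g := by
  obtain ⟨a, ha, h1⟩ := hf
  exact ⟨a, ha, fun l hl => by rw [h l hl, h1 l hl]⟩

lemma Cob.zero {Y : Type*} (c : Prop) (k : ℤ) (N : Set (List Y)) : Cob c k N 0 :=
  ⟨0, Adm.zero _ _, fun l _ => by rw [cob_zero]; rfl⟩

lemma Cob.sub {Y : Type*} {c : Prop} {k : ℤ} {N : Set (List Y)} {f g : List Y → ℚ}
    (hf : Cob c k N f) (hg : Cob c k N g) : Cob c k N (f - g) := by
  have := hf.add (hg.smul (-1))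
  rwa [neg_one_smul, ← sub_eq_add_neg] at this

lemma Cob.sum {Y ι : Type*} {c : Prop} {k : ℤ} {N : Set (List Y)} {f : ι → List Y → ℚ}
    {s : Finset ι} (hf : ∀ i ∈ s, Cob c k N (f i)) : Cob c k N (∑ i ∈ s, f i) := by
  classical
  induction s using Finset.induction_on with
  | empty => exact Cob.zero _ _ _
  | insert a s ha ih =>
    rw [Finset.sum_insert ha]
    exact (hf a (Finset.mem_insert_self a s)).add
      (ih fun i hi => hf i (Finset.mem_insert_of_mem hi))

lemma Alt.map {Y Y' : Type*} {f : List Y → ℚ} (hf : Alt f) (r : Y' → Y) :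
    Alt fun l => f (l.map r) := fun l₁ a b l₂ => by
  simpa using hf (l₁.map r) (r a) (r b) (l₂.map r)

lemma Adm.map {Y Y' : Type*} {c : Prop} {k : ℤ} {f : List Y → ℚ} (hf : Adm c k f) {r : Y' → Y}
    (hr : Function.Injective r) : Adm c k fun l => f (l.map r) where
  fin := hf.fin.preimage (hr.list_map.injOn)
  len l h := by simpa using hf.len _ h
  nil h := hf.nil h
  alt h := (hf.alt h).map r

lemma Cob.map {Y Y' : Type*} {c : Prop} {k : ℤ} {N : Set (List Y)} {N' : Set (List Y')}
    {f : List Y → ℚ} (hf : Cob c k N f) {r : Y' → Y} (hr : Function.Injective r)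
    (h : ∀ l ∈ N', l.map r ∈ N) : Cob c k N' fun l => f (l.map r) := by
  obtain ⟨g, hg, h1⟩ := hf
  exact ⟨_, hg.map hr, fun l hl => by
    rw [cob_map]; exact h1 _ (h l hl)⟩

variable {N : Set (List Y)} {k : ℤ} {u : List Y → ℚ} {c : G → ℚ}

lemma map_smul_smul (γ γ' : G) (l : List Y) :
    (l.map (γ' • ·)).map (γ • ·) = l.map ((γ * γ') • ·) := by
  simp [List.map_map, Function.comp_def, mul_smul]

lemma Sys.tw (S : Sys N k u c) {f : List Y → ℚ} (hf : Adm True k f) (hfc : Coc N f) (γ : G) :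
    Cob True k N fun l => f (l.map (γ • ·)) - c γ * f l := by
  obtain ⟨r, hr⟩ := S.span f hf hfc
  have h1 := hr.map (N' := N) (MulAction.injective γ) (S.inv γ)
  have h2 := (S.twist γ).smul r
  refine ((h1.add h2).sub (hr.smul (c γ))).congr fun l _ => ?_
  simp only [Pi.add_apply, Pi.sub_apply, Pi.smul_apply, smul_eq_mul]
  ring

lemma Sys.eq_zero (S : Sys N k u c) {r : ℚ} (h : Cob True k N (r • u)) : r = 0 := by
  by_contra hr
  refine S.ncob ((h.smul r⁻¹).congr fun l _ => ?_)
  simp [hr]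

lemma Sys.c_one (S : Sys N k u c) : c 1 = 1 := by
  have h := S.twist 1
  have : 1 - c 1 = 0 := S.eq_zero (h.congr fun l _ => by simp; ring)
  linarith

lemma Sys.c_mul (S : Sys N k u c) (γ γ' : G) : c (γ * γ') = c γ * c γ' := by
  have h1 := (S.twist γ).map (N' := N) (MulAction.injective γ') (S.inv γ')
  have h2 := (S.twist γ').smul (c γ)
  have h3 := S.twist (γ * γ')
  have : c (γ * γ') - c γ * c γ' = 0 := S.eq_zero (((h1.add h2).sub h3).congr fun l _ => by
    simp only [Pi.add_apply, Pi.sub_apply, Pi.smul_apply, smul_eq_mul, map_smul_smul]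
    ring)
  linarith

lemma Sys.c_ne (S : Sys N k u c) (γ : G) : c γ ≠ 0 := fun h => by
  have h1 := S.c_mul γ γ⁻¹
  rw [mul_inv_cancel, S.c_one, h, zero_mul] at h1
  exact one_ne_zero h1

lemma Sys.c_inv (S : Sys N k u c) (γ : G) : c γ⁻¹ = (c γ)⁻¹ := by
  have h1 := S.c_mul γ γ⁻¹
  rw [mul_inv_cancel, S.c_one] at h1
  exact eq_inv_of_mul_eq_one_right h1.symm

lemma Sys.inv_iff (S : Sys N k u c) (γ : G) (l : List Y) : l.map (γ • ·) ∈ N ↔ l ∈ N := by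
  refine ⟨fun h => ?_, S.inv γ l⟩
  have := S.inv γ⁻¹ _ h
  rw [map_smul_smul] at this
  simpa using this

end System

section Equivariant

variable {G Y : Type*} [Group G] [MulAction G Y]

/-- Equivariant alternating cochains with values in chains of the group, supported near finitely
many orbits of vertices. -/
structure DC (N : Set (List Y)) (c : G → ℚ) (p : ℕ) (k : ℤ) (T : List Y → (List G →₀ ℚ)) :
    Prop where
  supp : ∀ l, T l ≠ 0 → l ∈ N ∧ (l.length : ℤ) = k
  alt : ∀ x, Alt fun l => T l x
  len : ∀ l x, T l x ≠ 0 → x.length = p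
  eqv : ∀ (γ : G) l, T (l.map (γ • ·)) = c γ • mp (γ * ·) (T l)
  fin : ∃ I : Set Y, I.Finite ∧ ∀ l, T l ≠ 0 → ∃ a ∈ l, ∃ γ : G, γ • a ∈ I

lemma mp_apply_map {A B : Type*} {r : A → B} (hr : Function.Injective r) (z : List A →₀ ℚ)
    (x : List A) : mp r z (x.map r) = z x :=
  Finsupp.mapDomain_apply hr.list_map _ _

variable {N : Set (List Y)} {k : ℤ} {u : List Y → ℚ} {c : G → ℚ} {p : ℕ}

lemma DC.eqv_apply {T : List Y → (List G →₀ ℚ)} (hT : DC N c p k T) (γ : G) (l : List Y)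
    (x : List G) : T (l.map (γ • ·)) (x.map (γ * ·)) = c γ * T l x := by
  rw [hT.eqv, Finsupp.smul_apply, mp_apply_map (mul_right_injective γ), smul_eq_mul]

lemma DC.sub {T T' : List Y → (List G →₀ ℚ)} (hT : DC N c p k T) (hT' : DC N c p k T') :
    DC N c p k (T - T') where
  supp l h := by
    by_cases h1 : T l = 0
    · exact hT'.supp l fun h2 => h (by simp [h1, h2])
    · exact hT.supp l h1
  alt x := by
    have := (hT.alt x).sub (hT'.alt x)
    exact this
  len l x h := by
    by_cases h1 : T l x = 0
    · exact hT'.len l x fun h2 => h (by simp [h1, h2])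
    · exact hT.len l x h1
  eqv γ l := by simp [hT.eqv, hT'.eqv, smul_sub]
  fin := by
    obtain ⟨I, hI, h1⟩ := hT.fin
    obtain ⟨I', hI', h2⟩ := hT'.fin
    refine ⟨I ∪ I', hI.union hI', fun l h => ?_⟩
    by_cases h3 : T l = 0
    · obtain ⟨a, ha, γ, hγ⟩ := h2 l fun h2 => h (by simp [h3, h2])
      exact ⟨a, ha, γ, Or.inr hγ⟩
    · obtain ⟨a, ha, γ, hγ⟩ := h1 l h3
      exact ⟨a, ha, γ, Or.inl hγ⟩

lemma DC.zero : DC N c p k 0 where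
  supp l h := by simp at h
  alt x := Alt.zero
  len l x h := by simp at h
  eqv γ l := by simp
  fin := ⟨∅, Set.finite_empty, fun l h => by simp at h⟩

lemma bd_len {z : List G →₀ ℚ} (hz : ∀ x, z x ≠ 0 → x.length = p + 1) (x : List G)
    (hx : bd z x ≠ 0) : x.length = p := by
  classical
  rw [bd, Finsupp.linearCombination_apply, Finsupp.sum, Finsupp.finsetSum_apply] at hx
  obtain ⟨y, hy, h⟩ := Finset.exists_ne_zero_of_sum_ne_zero hx
  have h1 : x ∈ (bdl y).support := Finsupp.mem_support_iff.2 fun h2 => h (by simp [h2])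
  have h2 := (mem_bdl h1).2
  have := hz y (Finsupp.mem_support_iff.1 hy)
  omega

lemma DC.bd {T : List Y → (List G →₀ ℚ)} (hT : DC N c (p + 1) k T) :
    DC N c p k fun l => bd (T l) where
  supp l h := hT.supp l fun h1 => h (by simp [h1])
  alt x l₁ a b l₂ := by
    have : T (l₁ ++ a :: b :: l₂) = -T (l₁ ++ b :: a :: l₂) := by
      ext y
      exact hT.alt y l₁ a b l₂
    simp [this]
  len l x h := bd_len (hT.len l) x h
  eqv γ l := by rw [hT.eqv, map_smul, mp_bd]
  fin := by
    obtain ⟨I, hI, h1⟩ := hT.fin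
    exact ⟨I, hI, fun l h => h1 l fun h2 => h (by simp [h2])⟩

lemma dl_supp_face {T : List Y → (List G →₀ ℚ)}
    {l : List Y} (h : dl N T l ≠ 0) :
    l ∈ N ∧ ∃ l' : List Y, l'.Sublist l ∧ l'.length + 1 = l.length ∧ T l' ≠ 0 := by
  have hl : l ∈ N := by
    by_contra hl
    exact h (dl_of_notMem hl)
  refine ⟨hl, ?_⟩
  by_contra! hc
  refine h ?_
  ext x
  rw [dl_of_mem hl, cobV_apply]
  exact cob_eq_zero fun l' h1 h2 => by rw [hc l' h1 h2]; rfl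

lemma Sys.dl (S : Sys N k u c) {T : List Y → (List G →₀ ℚ)} {j : ℤ} (hT : DC N c p j T) :
    DC N c p (j + 1) (dl N T) where
  supp l h := by
    obtain ⟨hl, l', h1, h2, h3⟩ := dl_supp_face h
    have := (hT.supp l' h3).2
    exact ⟨hl, by omega⟩
  alt x := by
    classical
    have := (hT.alt x).cob.ite Alt.zero S.cplx.perm
    convert this using 2 with l
    rw [dl_apply]
    rfl
  len l x h := by
    rw [dl_apply] at h
    have hl : l ∈ N := by
      by_contra hl
      exact h (dl_of_notMem hl)
    rw [dl_of_mem hl] at h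
    by_contra hc
    refine h (cob_eq_zero fun l' _ _ => ?_)
    by_contra h'
    exact hc (hT.len l' x h')
  eqv γ l := by
    by_cases hl : l ∈ N
    · rw [dl_of_mem hl, dl_of_mem (S.inv γ l hl), cobV_map, ← LinearMap.smul_apply,
        map_cobV]
      congr 1
      funext m
      exact hT.eqv γ m
    · rw [dl_of_notMem hl, dl_of_notMem (by rwa [S.inv_iff]), map_zero, smul_zero]
  fin := by
    obtain ⟨I, hI, h1⟩ := hT.fin
    refine ⟨I, hI, fun l h => ?_⟩
    obtain ⟨hl, l', h2, h3, h4⟩ := dl_supp_face h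
    obtain ⟨a, ha, h5⟩ := h1 l' h4
    exact ⟨a, h2.subset ha, h5⟩

end Equivariant

end SpTop

namespace SpTop

section Rows

variable {G Y : Type*} [Group G] [MulAction G Y]

lemma exists_equivariant (hfree : ∀ (γ : G) (y : Y), γ • y = y → γ = 1) :
    ∃ κ : Y → G, ∀ (γ : G) y, κ (γ • y) = γ * κ y := by
  classical
  have h : ∀ y : Y, ∃ γ : G, γ • (Quotient.out (Quotient.mk (MulAction.orbitRel G Y) y)) = y :=
    fun y => by
      have := Quotient.mk_out (s := MulAction.orbitRel G Y) y
      exact MulAction.mem_orbit_symm.1 this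
  choose κ hκ using h
  refine ⟨κ, fun γ y => ?_⟩
  have h1 : Quotient.mk (MulAction.orbitRel G Y) (γ • y) = Quotient.mk _ y :=
    Quotient.sound (MulAction.mem_orbit y γ)
  have h2 := hκ (γ • y)
  rw [h1] at h2
  have h3 : ((γ * κ y)⁻¹ * κ (γ • y)) •
      (Quotient.out (Quotient.mk (MulAction.orbitRel G Y) y)) =
        Quotient.out (Quotient.mk (MulAction.orbitRel G Y) y) := by
    rw [mul_smul, h2, inv_smul_eq_iff, mul_smul, hκ y]
  have h4 := hfree _ _ h3
  rw [inv_mul_eq_one] at h4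
  exact h4.symm

/-- The cochain is supported near the orbits of `I`. -/
def Near (G : Type*) [Group G] [MulAction G Y] (I : Set Y) {M : Type*} [Zero M] (T : List Y → M) :
    Prop :=
  ∀ l, T l ≠ 0 → ∃ a ∈ l, ∃ γ : G, γ • a ∈ I

/-- Contraction of the rows. -/
noncomputable def rc (κ : Y → G) (T : List Y → (List G →₀ ℚ)) (l : List Y) : List G →₀ ℚ :=
  (l.length : ℚ)⁻¹ • (l.map fun y => cn (κ y) (T l)).sum

variable {N : Set (List Y)} {k : ℤ} {u : List Y → ℚ} {c : G → ℚ} {p : ℕ}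
  {T T' : List Y → (List G →₀ ℚ)} {κ : Y → G}

lemma rc_eq_zero {l : List Y} (h : T l = 0) : rc κ T l = 0 := by
  simp [rc, h]

lemma Near.rc {I : Set Y} (h : Near G I T) : Near G I (rc κ T) :=
  fun l hl => h l fun h1 => hl (rc_eq_zero h1)

lemma cn_apply_ne {a : G} {z : List G →₀ ℚ} {x : List G} (h : cn a z x ≠ 0) :
    ∃ t, x = a :: t ∧ z t ≠ 0 := by
  classical
  rw [cn, Finsupp.lmapDomain_apply] at h
  have := Finsupp.mapDomain_support (Finsupp.mem_support_iff.2 h)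
  obtain ⟨t, ht, rfl⟩ := Finset.mem_image.1 this
  exact ⟨t, rfl, Finsupp.mem_support_iff.1 ht⟩

lemma DC.rc (hκ : ∀ (γ : G) y, κ (γ • y) = γ * κ y) (hT : DC N c p k T) :
    DC N c (p + 1) k (rc κ T) where
  supp l h := hT.supp l fun h1 => h (rc_eq_zero h1)
  alt x l₁ a b l₂ := by
    have h : T (l₁ ++ a :: b :: l₂) = -T (l₁ ++ b :: a :: l₂) := by
      ext y
      exact hT.alt y l₁ a b l₂
    have h1 : SpTop.rc κ T (l₁ ++ a :: b :: l₂) = -SpTop.rc κ T (l₁ ++ b :: a :: l₂) := by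
      simp only [SpTop.rc, h, List.length_append, List.length_cons, List.map_append, List.map_cons,
        List.sum_append, List.sum_cons, map_neg]
      have h2 : ∀ m : List Y, (m.map fun y => -cn (κ y) (T (l₁ ++ b :: a :: l₂))).sum =
          -(m.map fun y => cn (κ y) (T (l₁ ++ b :: a :: l₂))).sum := fun m => by
        rw [List.sum_neg, List.map_map]
        rfl
      rw [h2, h2, ← smul_neg]
      congr 1
      abel
    show SpTop.rc κ T _ x = -SpTop.rc κ T _ x
    rw [h1, Finsupp.neg_apply]
  len l x h := by
    by_contra hx
    refine h ?_
    rw [SpTop.rc, Finsupp.smul_apply]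
    have : ∀ m : List Y, ((m.map fun y => cn (κ y) (T l)).sum : List G →₀ ℚ) x = 0 := fun m => by
      induction m with
      | nil => simp
      | cons a m ih =>
        rw [List.map_cons, List.sum_cons, Finsupp.add_apply, ih, add_zero]
        by_contra h1
        obtain ⟨t, rfl, ht⟩ := cn_apply_ne h1
        exact hx (by rw [List.length_cons, hT.len l t ht])
    rw [this, smul_zero]
  eqv γ l := by
    simp only [SpTop.rc, List.length_map, List.map_map, map_smul, map_list_sum]
    rw [smul_comm (c γ)]
    congr 1
    rw [List.smul_sum, List.map_map]
    congr 1
    refine List.map_congr_left fun y _ => ?_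
    simp only [Function.comp_def, hκ, hT.eqv, map_smul, mp_cn]
  fin := by
    obtain ⟨I, hI, h1⟩ := hT.fin
    exact ⟨I, hI, Near.rc (G := G) h1⟩

lemma bd_rc (S : Sys N k u c) {j : ℤ} (hT : DC N c p j T) (h : ∀ l, bd (T l) = 0) (l : List Y) :
    bd (rc κ T l) = T l := by
  rcases eq_or_ne l [] with rfl | hl
  · have : T [] = 0 := by
      by_contra h1
      exact S.nil (hT.supp _ h1).1
    rw [rc_eq_zero this, this, map_zero]
  · rw [rc, map_smul, map_list_sum, List.map_map]
    have : ((bd : (List G →₀ ℚ) →ₗ[ℚ] _) ∘ fun y => cn (κ y) (T l)) = fun _ => T l := by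
      funext y
      simp [bd_cn, h l]
    rw [this]
    simp only [List.map_const', List.sum_replicate]
    rw [← Nat.cast_smul_eq_nsmul ℚ, smul_smul, inv_mul_cancel₀, one_smul]
    simpa using hl

lemma DC.nil (S : Sys N k u c) {j : ℤ} (hT : DC N c p j T) : T [] = 0 := by
  by_contra h1
  exact S.nil (hT.supp _ h1).1

lemma dl_dl (S : Sys N k u c) (T : List Y → (List G →₀ ℚ)) : dl N (dl N T) = 0 := by
  funext l
  by_cases hl : l ∈ N
  · ext x
    rw [dl_of_mem hl, cobV_apply, Pi.zero_apply, Finsupp.zero_apply,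
      ← cob_cob (fun m => T m x) l]
    refine S.cplx.cob_congr (fun _ => ?_) (fun _ => cob_nil _) hl fun l' hl' _ => ?_
    · rw [dl_of_notMem S.nil]; rfl
    · rw [dl_of_mem hl', cobV_apply]
  · rw [dl_of_notMem hl]; rfl

lemma Near.dl {I : Set Y} (h : Near G I T) : Near G I (dl N T) := fun l hl => by
  obtain ⟨_, l', h2, h3, h4⟩ := dl_supp_face hl
  obtain ⟨a, ha, h5⟩ := h l' h4
  exact ⟨a, h2.subset ha, h5⟩

lemma finite_lists (s : Set Y) (hs : s.Finite) (j : ℕ) :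
    {l : List Y | l.length = j ∧ ∀ a ∈ l, a ∈ s}.Finite := by
  have := hs.to_subtype
  refine ((List.finite_length_eq s j).image (List.map Subtype.val)).subset ?_
  rintro l ⟨h, h1⟩
  refine ⟨l.attach.map fun a => ⟨a.1, h1 _ a.2⟩, by simpa using h, ?_⟩
  simp [List.map_map, Function.comp_def]

lemma Sys.finite_near (S : Sys N k u c) {I : Set Y} (hI : I.Finite) :
    {b | ∃ a ∈ I, ∃ l ∈ N, a ∈ l ∧ b ∈ l}.Finite :=
  (hI.biUnion fun _ _ => S.star _).subset fun _ ⟨_, ha, h⟩ => Set.mem_biUnion ha h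

/-- Up to translation the support is finite. -/
lemma DC.exists_reps (S : Sys N k u c) {j : ℤ} (hT : DC N c p j T) :
    ∃ F : Set (List Y), F.Finite ∧ ∀ l, T l ≠ 0 → ∃ γ : G, l.map (γ • ·) ∈ F := by
  obtain ⟨I, hI, h⟩ := hT.fin
  refine ⟨_, finite_lists _ (S.finite_near hI) j.toNat, fun l hl => ?_⟩
  obtain ⟨a, ha, γ, hγ⟩ := h l hl
  obtain ⟨h1, h2⟩ := hT.supp l hl
  refine ⟨γ, by simp; omega, fun b hb => ⟨_, hγ, _, S.inv γ l h1, List.mem_map_of_mem ha, hb⟩⟩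

lemma DC.finite_heads (S : Sys N k u c) {j : ℤ} (hT : DC N c p j T) :
    {t : List G | ∃ l, T l (1 :: t) ≠ 0}.Finite := by
  obtain ⟨F, hF, h⟩ := hT.exists_reps S
  refine (hF.biUnion fun l _ => (T l).support.finite_toSet.image
    fun x : List G => (x.map ((x.headD 1)⁻¹ * ·)).tail).subset ?_
  rintro t ⟨l, hl⟩
  obtain ⟨γ, hγ⟩ := h l fun h1 => hl (by simp [h1])
  refine Set.mem_biUnion hγ ⟨(1 :: t).map (γ * ·), ?_, ?_⟩
  · rw [Finset.mem_coe, Finsupp.mem_support_iff, hT.eqv_apply]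
    exact mul_ne_zero (S.c_ne γ) hl
  · simp [Function.comp_def]

lemma DC.adm (S : Sys N k u c) {j : ℤ} (hT : DC N c (p + 1) j T) (x : List G) :
    Adm True j fun l => T l x where
  fin := by
    obtain ⟨F, hF, h⟩ := hT.exists_reps S
    refine (hF.biUnion fun l _ => (T l).support.finite_toSet.image
      fun y : List G => l.map ((x.headD 1 * (y.headD 1)⁻¹) • ·)).subset ?_
    intro l hl
    obtain ⟨γ, hγ⟩ := h l fun h1 => hl (by simp [h1])
    refine Set.mem_biUnion hγ ⟨x.map (γ * ·), ?_, ?_⟩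
    · rw [Finset.mem_coe, Finsupp.mem_support_iff, hT.eqv_apply]
      exact mul_ne_zero (S.c_ne γ) hl
    · have h1 := hT.len l x hl
      cases x with
      | nil => simp at h1
      | cons a x => simp [Function.comp_def]
  len l h := (hT.supp l fun h1 => h (by simp [h1])).2
  nil _ := by rw [hT.nil S]; rfl
  alt _ := hT.alt x

lemma DC.ext (hT : DC N c (p + 1) k T) (hT' : DC N c (p + 1) k T')
    (h : ∀ l t, T l (1 :: t) = T' l (1 :: t)) : T = T' := by
  funext l
  ext x
  cases x with
  | nil =>
    have h1 : ∀ T, DC N c (p + 1) k T → T l [] = 0 := fun T hT => by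
      by_contra h1
      simpa using hT.len l [] h1
    rw [h1 T hT, h1 T' hT']
  | cons a x =>
    have h1 := hT.eqv_apply a (l.map (a⁻¹ • ·)) ((a :: x).map (a⁻¹ * ·))
    have h2 := hT'.eqv_apply a (l.map (a⁻¹ • ·)) ((a :: x).map (a⁻¹ * ·))
    simp only [List.map_map, Function.comp_def, smul_inv_smul, mul_inv_cancel_left, List.map_id',
      List.map_cons, inv_mul_cancel, mul_one] at h1 h2
    rw [h1, h2, h]

end Rows

end SpTop

namespace SpTop

section Columns

variable {G Y : Type*} [Group G] [MulAction G Y]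
  {N : Set (List Y)} {k : ℤ} {u : List Y → ℚ} {c : G → ℚ} {p : ℕ}
  {T T' : List Y → (List G →₀ ℚ)} {κ : Y → G}

lemma exists_ind (S : Sys N k u c) {j : ℤ} {g : List G → List Y → ℚ}
    (hfin : {x | g x ≠ 0}.Finite) (hlen : ∀ x, g x ≠ 0 → x.length = p + 1)
    (hadm : ∀ x, Adm True j (g x)) (hN : ∀ x l, g x l ≠ 0 → l ∈ N) :
    ∃ T, DC N c (p + 1) j T ∧ ∀ l t, T l (1 :: t) = g (1 :: t) l := by
  classical
  set F : List Y → List G → ℚ := fun l x =>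
    c (x.headD 1) * g (x.map ((x.headD 1)⁻¹ * ·)) (l.map ((x.headD 1)⁻¹ • ·)) with hF
  have hne : ∀ l x, F l x ≠ 0 → g (x.map ((x.headD 1)⁻¹ * ·)) (l.map ((x.headD 1)⁻¹ • ·)) ≠ 0 :=
    fun l x h => right_ne_zero_of_mul h
  have hne' : ∀ l x, F l x ≠ 0 → g (x.map ((x.headD 1)⁻¹ * ·)) ≠ 0 :=
    fun l x h h1 => hne l x h (by rw [h1]; rfl)
  have hl : ∀ l x, F l x ≠ 0 → x.length = p + 1 := fun l x h => by
    simpa using hlen _ (hne' l x h)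
  have hFf : ∀ l, (Function.support (F l)).Finite := fun l => by
    rcases l with - | ⟨b, l⟩
    · convert Set.finite_empty
      ext x
      simp only [Function.mem_support, Set.mem_empty_iff_false, iff_false, not_not]
      by_contra h
      exact S.nil (hN _ _ (hne _ _ h))
    · have h1 : {γ : G | ∃ x ∈ {x | g x ≠ 0}, ∃ m, g x m ≠ 0 ∧ γ⁻¹ • b ∈ m}.Finite := by
        refine ((hfin.biUnion fun x _ => (hadm x).fin.biUnion fun m _ =>
          m.finite_toSet).preimage (f := fun γ : G => γ⁻¹ • b) ?_).subset ?_
        · intro γ _ γ' _ h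
          have h2 : (γ * γ'⁻¹) • b = b := by
            rw [mul_smul, smul_eq_iff_eq_inv_smul]
            exact h.symm
          exact mul_inv_eq_one.1 (S.free _ _ h2)
        · rintro γ ⟨x, hx, m, hm, h⟩
          exact Set.mem_biUnion hx (Set.mem_biUnion (show m ∈ Function.support (g x) from hm) h)
      refine ((h1.prod hfin).image fun q : G × List G => q.2.map (q.1 * ·)).subset fun x hx => ?_
      refine ⟨(x.headD 1, x.map ((x.headD 1)⁻¹ * ·)), ⟨⟨_, hne' _ _ hx, _, hne _ _ hx, ?_⟩,
        hne' _ _ hx⟩, ?_⟩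
      · simp
      · simp [Function.comp_def]
  have hFN : ∀ l x, F l x ≠ 0 → l ∈ N := fun l x h => by
    have := hN _ _ (hne l x h)
    rwa [S.inv_iff] at this
  have hex : ∀ l : List Y, Finsupp.ofSupportFinite (F l) (hFf l) ≠ 0 →
      ∃ x, F l x ≠ 0 := fun l h => by
    by_contra! hc
    exact h (Finsupp.ext hc)
  refine ⟨fun l => Finsupp.ofSupportFinite (F l) (hFf l), ⟨fun l h => ?_, fun x => ?_,
    fun l x h => hl l x h, fun γ l => ?_, ?_⟩, fun l t => ?_⟩
  · obtain ⟨x, hx⟩ := hex l h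
    exact ⟨hFN l x hx, by simpa using (hadm _).len _ (hne l x hx)⟩
  · intro l₁ a b l₂
    show F _ x = -F _ x
    simp only [hF, List.map_append, List.map_cons]
    rw [((hadm _).alt trivial) _ _ _ _, mul_neg]
  · ext x
    obtain ⟨x, rfl⟩ : ∃ y : List G, x = y.map (γ * ·) :=
      ⟨x.map (γ⁻¹ * ·), by simp [Function.comp_def]⟩
    rw [Finsupp.smul_apply, mp_apply_map (mul_right_injective γ)]
    show F _ _ = c γ * F _ _
    cases x with
    | nil =>
      have : ∀ l, F l [] = 0 := fun l => by
        by_contra h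
        simpa using hl l _ h
      simp [this]
    | cons a x =>
      simp only [hF, List.map_cons, List.headD_cons, S.c_mul, List.map_map, Function.comp_def,
        mul_inv_rev, mul_assoc, inv_mul_cancel_left, smul_smul, inv_mul_cancel, mul_one]
  · refine ⟨⋃ x ∈ {x | g x ≠ 0}, ⋃ m ∈ Function.support (g x), {a | a ∈ m},
      hfin.biUnion fun x _ => (hadm x).fin.biUnion fun m _ => m.finite_toSet, fun l h => ?_⟩
    obtain ⟨x, hx⟩ := hex l h
    rcases l with - | ⟨b, l⟩
    · exact absurd (hFN _ _ hx) S.nil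
    · exact ⟨b, by simp, (x.headD 1)⁻¹, Set.mem_biUnion (hne' _ _ hx)
        (Set.mem_biUnion (show _ ∈ Function.support (g _) from hne _ _ hx) (by simp))⟩
  · show F _ _ = _
    simp [hF, S.c_one]

lemma DC.coc (hd : dl N T = 0) (x : List G) : Coc N fun l => T l x := fun l hl => by
  have := DFunLike.congr_fun (congrFun hd l) x
  rwa [dl_of_mem hl, cobV_apply] at this

open Classical in
/-- Exactness of the columns. -/
lemma DC.exists_dl_eq (S : Sys N k u c) {j : ℤ} (hT : DC N c (p + 1) j T)
    (hx : ∀ t, Cob True j N fun l => T l (1 :: t)) :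
    ∃ T', DC N c (p + 1) (j - 1) T' ∧ dl N T' = T := by
  have h1 : ∀ x : List G, ∃ g : List Y → ℚ, Adm True (j - 1) g ∧ (∀ l, g l ≠ 0 → l ∈ N) ∧
      (g ≠ 0 → x.length = p + 1 ∧ ∃ t ∈ {t : List G | ∃ l, T l (1 :: t) ≠ 0}, x = 1 :: t) ∧
      ∀ t, x = 1 :: t → ∀ l ∈ N, T l x = cob g l := fun x => by
    by_cases h : ∃ l t, x = 1 :: t ∧ T l x ≠ 0
    · obtain ⟨l, t, rfl, h⟩ := h
      obtain ⟨g, hg, h2⟩ := hx t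
      refine ⟨fun l => if l ∈ N then g l else 0, hg.ite (Adm.zero _ _) S.cplx.perm,
        fun l h => by_contra fun h1 => h (if_neg h1), fun _ => ⟨hT.len l _ h, t, ⟨l, h⟩, rfl⟩,
        fun t' _ l hl => ?_⟩
      refine (h2 l hl).trans ?_
      exact S.cplx.cob_congr hg.nil (fun _ => if_neg S.nil) hl fun l' hl' _ => (if_pos hl').symm
    · push Not at h
      exact ⟨0, Adm.zero _ _, fun l h => absurd rfl h, fun h => absurd rfl h, fun t ht l _ => by
        rw [h l t ht, cob_zero]⟩
  choose g hg hgN hg0 hgc using h1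
  obtain ⟨T', hT', h⟩ := exists_ind S (g := g) (p := p)
    (((hT.finite_heads S).image (List.cons 1)).subset fun x hx => by
      obtain ⟨-, t, ht, rfl⟩ := hg0 x hx
      exact ⟨t, ht, rfl⟩) (fun x hx => (hg0 x hx).1) hg hgN
  have hd' := S.dl hT'
  rw [sub_add_cancel] at hd'
  refine ⟨T', hT', hd'.ext hT fun l t => ?_⟩
  by_cases hl : l ∈ N
  · rw [dl_of_mem hl, cobV_apply, hgc _ t rfl l hl]
    simp only [h]
  · rw [dl_of_notMem hl]
    by_contra h2
    exact hl (hT.supp l fun h3 => h2 (by rw [h3])).1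

lemma DC.exists_dl_eq' (S : Sys N k u c) {j : ℤ} (hj : j ≠ k) (hT : DC N c (p + 1) j T)
    (hd : dl N T = 0) : ∃ T', DC N c (p + 1) (j - 1) T' ∧ dl N T' = T :=
  hT.exists_dl_eq S fun _ => S.van j hj _ (hT.adm S _) (DC.coc hd _)

end Columns

section Classes

variable {G Y : Type*} [Group G] [MulAction G Y]
  {N : Set (List Y)} {k : ℤ} {u : List Y → ℚ} {c : G → ℚ} {p : ℕ}
  {T T' : List Y → (List G →₀ ℚ)} {κ : Y → G}

open Classical in
/-- Restriction of a cochain on the group to the lists starting with the identity. -/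
noncomputable def h1 (φ : List G → ℚ) (x : List G) : ℚ := if x.head? = some 1 then φ x else 0

@[simp] lemma h1_cons_one (φ : List G → ℚ) (t : List G) : h1 φ (1 :: t) = φ (1 :: t) := by
  simp [h1]

lemma ev_eq_sum {A : Type*} (f : List A → ℚ) (z : List A →₀ ℚ) (s : Finset (List A))
    (h : ∀ x, z x ≠ 0 → f x ≠ 0 → x ∈ s) : ev f z = ∑ x ∈ s, z x * f x := by
  classical
  rw [ev, Finsupp.linearCombination_apply, Finsupp.sum]
  simp only [smul_eq_mul]
  have h1 : ∑ x ∈ z.support, z x * f x = ∑ x ∈ z.support ∪ s, z x * f x := by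
    refine Finset.sum_subset Finset.subset_union_left fun x _ hx => ?_
    rw [Finsupp.notMem_support_iff.1 hx, zero_mul]
  rw [h1]
  symm
  refine Finset.sum_subset Finset.subset_union_right fun x _ hx => ?_
  by_contra h2
  exact hx (h x (left_ne_zero_of_mul h2) (right_ne_zero_of_mul h2))

/-- The classes of the coordinates are compatible with the differentials. -/
lemma DC.cob_class (S : Sys N k u c) (hT : DC N c (p + 1 + 1) k T) (hd : dl N T = 0)
    {φ : List G → ℚ} (hφ : ∀ (γ : G) x, φ (x.map (γ * ·)) = φ x) :
    Cob True k N fun l => ev (h1 φ) (SpTop.bd (T l)) - ev (h1 (cob φ)) (T l) := by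
  classical
  set E0 : List G → ℚ := fun x => if x.head? = some 1 then φ x.tail else 0 with hE0
  set E1 : List G → ℚ := fun x => if x.tail.head? = some 1 then φ x.tail else 0 with hE1
  have hdiff : ∀ l, ev (h1 φ) (SpTop.bd (T l)) - ev (h1 (cob φ)) (T l) =
      ev E1 (T l) - ev E0 (T l) := by
    intro l
    rw [ev_bd, ← ev_sub, ← ev_sub]
    rw [ev_eq_sum _ _ (T l).support fun x hx _ => Finsupp.mem_support_iff.2 hx,
      ev_eq_sum _ _ (T l).support fun x hx _ => Finsupp.mem_support_iff.2 hx]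
    refine Finset.sum_congr rfl fun x hx => ?_
    congr 1
    have h2 := hT.len l x (Finsupp.mem_support_iff.1 hx)
    rcases x with - | ⟨a, - | ⟨b, t⟩⟩
    · simp at h2
    · simp at h2
    · have h3 : cob (fun m => h1 φ (a :: m)) (b :: t) =
          if a = 1 then cob (fun m => φ (a :: m)) (b :: t) else 0 := by
        split_ifs with ha
        · exact cob_congr fun m _ _ => by simp [h1, ha]
        · exact cob_eq_zero fun m _ _ => by simp [h1, ha]
      simp only [Pi.sub_apply, hE0, hE1, List.head?_cons, List.tail_cons, Option.some.injEq]
      rw [cob_cons, h3]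
      simp only [h1, List.head?_cons, Option.some.injEq]
      by_cases ha : a = 1 <;> by_cases hb : b = 1 <;> simp only [ha, hb, if_true, if_false,
        cob_cons φ 1] <;> ring
  set F : Finset (List G) := ((hT.finite_heads S).toFinset).image (List.cons 1) with hF
  have e0 : ∀ l, ev E0 (T l) = ∑ x ∈ F, T l x * φ x.tail := fun l => by
    rw [ev_eq_sum _ _ F fun x hx hx0 => ?_]
    · refine Finset.sum_congr rfl fun x hx => ?_
      obtain ⟨t, -, rfl⟩ := Finset.mem_image.1 hx
      simp [hE0]
    · rcases x with - | ⟨a, t⟩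
      · simp [hE0] at hx0
      · simp only [hE0, List.head?_cons, Option.some.injEq, ne_eq, ite_eq_right_iff,
          Classical.not_imp] at hx0
        obtain ⟨rfl, -⟩ := hx0
        exact Finset.mem_image_of_mem _ ((Set.Finite.mem_toFinset _).2 ⟨l, hx⟩)
  set ρ : List G → List G := fun x => x.map ((x.tail.headD 1)⁻¹ * ·) with hρ
  have e1 : ∀ l, ev E1 (T l) = ∑ x ∈ F, T l (ρ x) * φ x.tail := fun l => by
    have hinj : Set.InjOn ρ F := by
      intro x hx y hy hxy
      obtain ⟨t, -, rfl⟩ := Finset.mem_image.1 (Finset.mem_coe.1 hx)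
      obtain ⟨s, -, rfl⟩ := Finset.mem_image.1 (Finset.mem_coe.1 hy)
      simp only [hρ, List.map_cons, List.tail_cons, mul_one, List.cons.injEq] at hxy ⊢
      obtain ⟨h2, h3⟩ := hxy
      rw [h2] at h3
      exact ⟨trivial, (mul_right_injective _).list_map h3⟩
    rw [ev_eq_sum _ _ (F.image ρ) fun x hx hx0 => ?_, Finset.sum_image hinj]
    · by_cases hTl : T l = 0
      · simp [hTl]
      refine Finset.sum_congr rfl fun x hx => ?_
      congr 1
      obtain ⟨t, ht, rfl⟩ := Finset.mem_image.1 hx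
      obtain ⟨l', hl'⟩ := (Set.Finite.mem_toFinset _).1 ht
      have := hT.len _ _ hl'
      rcases t with - | ⟨b, t⟩
      · simp at this
      · have h5 := hφ b⁻¹ (b :: t)
        simp only [List.map_cons, inv_mul_cancel] at h5
        simp [hρ, hE1, h5]
    · have h2 := hT.len l x hx
      rcases x with - | ⟨a, - | ⟨b, t⟩⟩
      · simp at h2
      · simp at h2
      · simp only [hE1, List.head?_cons, List.tail_cons, Option.some.injEq, ne_eq,
          ite_eq_right_iff, Classical.not_imp] at hx0
        obtain ⟨rfl, -⟩ := hx0
        refine Finset.mem_image.2 ⟨(a :: 1 :: t).map (a⁻¹ * ·), ?_, ?_⟩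
        · simp only [List.map_cons, inv_mul_cancel]
          refine Finset.mem_image_of_mem _ ((Set.Finite.mem_toFinset _).2
            ⟨l.map (a⁻¹ • ·), ?_⟩)
          have h6 := hT.eqv_apply a⁻¹ l (a :: 1 :: t)
          simp only [List.map_cons, inv_mul_cancel] at h6
          rw [h6]
          exact mul_ne_zero (S.c_ne _) hx
        · simp [hρ, Function.comp_def]
  have hsum : Cob True k N (∑ x ∈ F, φ x.tail • ((fun l => T l (ρ x)) - fun l => T l x)) := by
    refine Cob.sum fun x hx => ?_
    refine Cob.smul ?_ _
    set γ := (x.tail.headD 1)⁻¹ with hγ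
    have hf := hT.adm S x
    have hc := DC.coc (T := T) hd x
    refine ((S.tw hf hc γ⁻¹).smul (c γ)).congr fun l _ => ?_
    have h7 := hT.eqv_apply γ (l.map (γ⁻¹ • ·)) x
    simp only [List.map_map, Function.comp_def, smul_inv_smul, List.map_id'] at h7
    simp only [Pi.sub_apply, Pi.smul_apply, smul_eq_mul, hρ]
    rw [h7, S.c_inv γ]
    have := S.c_ne γ
    field_simp
  refine hsum.congr fun l _ => ?_
  rw [hdiff, e0, e1, Finset.sum_apply, ← Finset.sum_sub_distrib]
  refine Finset.sum_congr rfl fun x _ => ?_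
  simp only [Pi.smul_apply, Pi.sub_apply, smul_eq_mul]
  ring

end Classes

end SpTop

namespace SpTop

section Spectral

variable {G Y : Type*} [Group G] [MulAction G Y]
  {N : Set (List Y)} {k : ℤ} {u : List Y → ℚ} {c : G → ℚ} {p : ℕ}
  {T T' : List Y → (List G →₀ ℚ)} {κ : Y → G}

lemma bd_dl (N : Set (List Y)) (T : List Y → (List G →₀ ℚ)) (l : List Y) :
    bd (dl N T l) = dl N (fun m => bd (T m)) l := map_dl N bd T l

lemma DC.cast {j j' : ℤ} (h : DC N c p j T) (hj : j = j') : DC N c p j' T := hj ▸ h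

/-- Zigzag towards the corner of the double complex. -/
lemma zigzag (S : Sys N k u c) (hκ : ∀ (γ : G) y, κ (γ • y) = γ * κ y) (n : ℤ) (i : ℕ)
    (hk : k = n + 1 + i)
    (hmain : ∀ T, DC N c 0 (n + 1) T → dl N T = 0 → ∃ T', DC N c 0 n T' ∧ dl N T' = T) :
    ∀ p ≤ i, ∀ R, DC N c p (n + 1 + p) R → (∀ l, bd (R l) = 0) → dl N R = 0 →
      (p = i → ∀ t, Cob True k N fun l => R l (1 :: t)) →
      ∃ Q, DC N c (p + 1) (n + p) Q ∧ dl N (fun l => bd (Q l)) = R := by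
  intro p
  induction p with
  | zero =>
    intro _ R hR hb hd _
    obtain ⟨β, hβ, h⟩ := hmain R (by simpa using hR) hd
    have hb0 : ∀ l, bd (β l) = 0 := fun l => by
      have h1 : β l = Finsupp.single [] (β l []) := by
        ext x
        by_cases hx : x = []
        · simp [hx]
        · rw [Finsupp.single_eq_of_ne hx]
          by_contra h2
          exact hx (List.length_eq_zero_iff.1 (hβ.len l x h2))
      rw [h1, bd_single, bdl_nil, smul_zero]
    refine ⟨rc κ β, by simpa using hβ.rc hκ, ?_⟩
    rw [← h]
    congr 1
    exact funext fun l => bd_rc S hβ hb0 l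
  | succ p ih =>
    intro hp R hR hb hd hcl
    have hT : ∃ T, DC N c (p + 1) (n + 1 + (p + 1 : ℕ) - 1) T ∧ dl N T = R := by
      by_cases hpi : p + 1 = i
      · refine hR.exists_dl_eq S fun t => ?_
        have : n + 1 + (p + 1 : ℕ) = k := by omega
        rw [this]
        exact hcl hpi t
      · exact hR.exists_dl_eq' S (by omega) hd
    obtain ⟨T, hT, rfl⟩ := hT
    have hT1 : DC N c (p + 1) (n + 1 + p) T := hT.cast (by push_cast; ring)
    obtain ⟨Q', hQ', hQ'd⟩ := ih (by omega) (fun l => bd (T l)) hT1.bd (fun l => bd_bd _)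
      (funext fun l => by rw [← bd_dl, hb]; rfl) fun h => by omega
    have hD := hT1.sub ((S.dl hQ').cast (show n + (p : ℤ) + 1 = n + 1 + p by ring))
    have hDb : ∀ l, bd ((T - dl N Q') l) = 0 := fun l => by
      rw [Pi.sub_apply, map_sub, bd_dl, hQ'd, sub_self]
    refine ⟨rc κ (T - dl N Q'), (hD.rc hκ).cast (by push_cast; ring), ?_⟩
    have : (fun l => bd (rc κ (T - dl N Q') l)) = T - dl N Q' :=
      funext fun l => bd_rc S hD hDb l
    rw [this, dl_sub, dl_dl S, sub_zero]

lemma DC.eq_zero_of_lt (S : Sys N k u c) {I : Set Y} (hI : I.Finite) {j : ℤ}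
    (hT : DC N c p j T) (hn : Near G I T) (hj : ((S.finite_near hI).toFinset.card : ℤ) < j) :
    T = 0 := by
  classical
  funext l
  by_contra h
  obtain ⟨a, ha, γ, hγ⟩ := hn l h
  obtain ⟨hl, hlen⟩ := hT.supp l h
  obtain ⟨x, hx⟩ := Finsupp.ne_iff.1 h
  have h1 := (hT.alt x).nodup hx
  have h2 : (l.map (γ • ·)).toFinset ⊆ (S.finite_near hI).toFinset := fun b hb => by
    rw [Set.Finite.mem_toFinset]
    exact ⟨_, hγ, _, S.inv γ l hl, List.mem_map_of_mem ha, List.mem_toFinset.1 hb⟩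
  have h3 := Finset.card_le_card h2
  rw [List.toFinset_card_of_nodup (h1.map (MulAction.injective γ)), List.length_map] at h3
  omega

/-- Above the exceptional degree the rows and columns cancel. -/
lemma descend (S : Sys N k u c) (hκ : ∀ (γ : G) y, κ (γ • y) = γ * κ y) {I : Set Y}
    (hI : I.Finite) (m : ℕ) : ∀ j ≥ k, ((S.finite_near hI).toFinset.card : ℤ) < j + m →
    ∀ p R, DC N c (p + 1) j R → Near G I R → (∀ l, bd (R l) = 0) → dl N R = 0 →
      ∃ Q, DC N c (p + 1 + 1) j Q ∧ dl N Q = 0 ∧ (fun l => bd (Q l)) = R := by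
  induction m with
  | zero =>
    intro j _ hj p R hR hn _ _
    have := hR.eq_zero_of_lt S hI hn (by simpa using hj)
    subst this
    refine ⟨0, DC.zero, funext fun l => ?_, funext fun l => by simp⟩
    by_cases hl : l ∈ N
    · rw [dl_of_mem hl]
      ext x
      rw [cobV_apply]
      exact cob_zero l
    · rw [dl_of_notMem hl]
      rfl
  | succ m ih =>
    intro j hj hcard p R hR hn hb hd
    have hQ0 := hR.rc hκ
    have hbQ : (fun l => bd (rc κ R l)) = R := funext fun l => bd_rc S hR hb l
    obtain ⟨Q1, hQ1, hQ1d, hQ1b⟩ := ih (j + 1) (by omega) (by push_cast at hcard; omega) (p + 1)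
      (dl N (rc κ R)) (S.dl hQ0) (hn.rc.dl) (fun l => by rw [bd_dl, hbQ, hd]; rfl) (dl_dl S _)
    obtain ⟨X, hX, hXd⟩ := hQ1.exists_dl_eq' S (by omega) hQ1d
    rw [add_sub_cancel_right] at hX
    refine ⟨rc κ R - fun l => bd (X l), hQ0.sub hX.bd, ?_, ?_⟩
    · rw [dl_sub, ← hQ1b, sub_eq_zero, ← hXd]
      exact funext fun l => bd_dl N X l
    · funext l
      rw [Pi.sub_apply, map_sub, bd_bd, sub_zero]
      exact congrFun hbQ l

/-- An invariant cocycle on the group vanishes on every chain of homogeneous coinvariant cycles. -/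
theorem ev_eq_zero_of_sys (S : Sys N k u c) (n : ℤ) (i : ℕ) (hk : k = n + 1 + (i + 1 : ℕ))
    (hmain : ∀ T, DC N c 0 (n + 1) T → dl N T = 0 → ∃ T', DC N c 0 n T' ∧ dl N T' = T)
    (z : List G →₀ ℚ) (hz : ∀ x, z x ≠ 0 → ∃ t, x = 1 :: t ∧ t.length = i + 1)
    (hzb : ∀ φ : List G → ℚ, (∀ (γ : G) x, φ (x.map (γ * ·)) = φ x) → ev φ (bd z) = 0)
    (φ : List G → ℚ) (hφ : ∀ (γ : G) x, φ (x.map (γ * ·)) = φ x)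
    (hφc : ∀ x : List G, x.length = i + 3 → cob φ x = 0) : ev φ z = 0 := by
  classical
  obtain ⟨κ, hκ⟩ := exists_equivariant S.free
  set u' : List Y → ℚ := fun l => if l ∈ N then u l else 0 with hu'
  have hau' : Adm True k u' := S.adm.ite (Adm.zero _ _) S.cplx.perm
  have hcob' : ∀ l ∈ N, cob u' l = 0 := fun l hl => by
    rw [← S.coc l hl]
    exact S.cplx.cob_congr hau'.nil S.adm.nil hl fun l' hl' _ => if_pos hl'
  obtain ⟨T, hT, hTx⟩ := exists_ind S (p := i + 1) (j := k) (g := fun x => z x • u')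
    (z.support.finite_toSet.subset fun x hx => by
      rw [Finset.mem_coe, Finsupp.mem_support_iff]
      rintro h
      exact hx (by simp [h]))
    (fun x hx => by
      obtain ⟨t, rfl, ht⟩ := hz x fun h => hx (by simp [h])
      simp [ht])
    (fun x => hau'.smul _)
    (fun x l h => by
      by_contra hl
      exact h (by simp [hu', hl]))
  have hTev : ∀ ψ : List G → ℚ, ∀ l, ev (h1 ψ) (T l) = ev ψ z * u' l := fun ψ l => by
    rw [ev_eq_sum (h1 ψ) (T l) z.support, ev_eq_sum ψ z z.support, Finset.sum_mul]
    · refine Finset.sum_congr rfl fun x hx => ?_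
      obtain ⟨t, rfl, -⟩ := hz x (Finsupp.mem_support_iff.1 hx)
      rw [hTx, h1_cons_one]
      simp only [Pi.smul_apply, smul_eq_mul]
      ring
    · exact fun x hx _ => Finsupp.mem_support_iff.2 hx
    · intro x hx hx1
      rcases x with - | ⟨a, t⟩
      · simp [h1] at hx1
      · have : a = 1 := by
          by_contra h
          simp [h1, h] at hx1
        subst this
        rw [hTx] at hx
        exact Finsupp.mem_support_iff.2 fun h => hx (by simp [h])
  have hTd : dl N T = 0 := by
    refine (S.dl hT).ext DC.zero fun l t => ?_
    by_cases hl : l ∈ N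
    · rw [dl_of_mem hl, cobV_apply]
      simp only [hTx]
      rw [cob_smul, hcob' l hl, mul_zero]
      rfl
    · rw [dl_of_notMem hl]
      rfl
  have hRd : dl N (fun l => bd (T l)) = 0 := funext fun l => by
    rw [← bd_dl, hTd]
    simp
  have hcl : ∀ t, Cob True k N fun l => bd (T l) (1 :: t) := fun t => by
    set ψ : List G → ℚ := fun x => if ∃ γ : G, x = (1 :: t).map (γ * ·) then 1 else 0 with hψ
    have hψi : ∀ (γ : G) x, ψ (x.map (γ * ·)) = ψ x := fun γ x => by
      have : (∃ δ : G, x.map (γ * ·) = (1 :: t).map (δ * ·)) ↔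
          ∃ δ : G, x = (1 :: t).map (δ * ·) := by
        constructor
        · rintro ⟨δ, h⟩
          refine ⟨γ⁻¹ * δ, ?_⟩
          have := congrArg (List.map (γ⁻¹ * ·)) h
          simpa [Function.comp_def, mul_assoc] using this
        · rintro ⟨δ, rfl⟩
          exact ⟨γ * δ, by simp [Function.comp_def, mul_assoc]⟩
      simp only [hψ, this]
    refine (hT.cob_class S hTd hψi).congr fun l _ => ?_
    rw [hTev, ← ev_bd, hzb ψ hψi, zero_mul, sub_zero]
    rw [ev_eq_sum (h1 ψ) _ {1 :: t}]
    · have : ψ (1 :: t) = 1 := if_pos ⟨1, by simp⟩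
      simp [this]
    · intro x _ hx
      rcases x with - | ⟨a, s⟩
      · simp [h1] at hx
      · have ha : a = 1 := by
          by_contra h
          simp [h1, h] at hx
        subst ha
        rw [h1_cons_one] at hx
        have : ∃ γ : G, 1 :: s = (1 :: t).map (γ * ·) := by
          by_contra h
          exact hx (if_neg h)
        obtain ⟨γ, hγ⟩ := this
        simp only [List.map_cons, mul_one, List.cons.injEq] at hγ
        obtain ⟨rfl, h⟩ := hγ
        simp [h]
  obtain ⟨Q, hQ, hQd⟩ := zigzag S hκ n (i + 1) hk hmain (i + 1) le_rfl (fun l => bd (T l))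
    (hT.bd.cast hk) (fun l => bd_bd _) hRd fun _ => hcl
  have hR0 := hT.sub ((S.dl hQ).cast (show n + (i + 1 : ℕ) + 1 = k by omega))
  have hR0b : ∀ l, bd ((T - dl N Q) l) = 0 := fun l => by
    rw [Pi.sub_apply, map_sub, bd_dl, hQd, sub_self]
  have hR0d : dl N (T - dl N Q) = 0 := by rw [dl_sub, hTd, dl_dl S, sub_zero]
  obtain ⟨I, hI, hn⟩ := hR0.fin
  obtain ⟨Q2, hQ2, hQ2d, hQ2b⟩ := descend S hκ hI
    ((S.finite_near hI).toFinset.card + 1 + k.natAbs) k le_rfl (by omega) (i + 1) _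
    hR0 hn hR0b hR0d
  have hA := hQ2.cob_class S hQ2d hφ
  have hQa : Adm True (k - 1) fun l => ev (h1 φ) (Q l) := by
    set F : Finset (List G) := ((hQ.finite_heads S).toFinset).image (List.cons 1)
    have : (fun l => ev (h1 φ) (Q l)) = ∑ x ∈ F, (φ x) • fun l => Q l x := by
      funext l
      rw [Finset.sum_apply, ev_eq_sum _ _ F]
      · refine Finset.sum_congr rfl fun x hx => ?_
        obtain ⟨t, -, rfl⟩ := Finset.mem_image.1 hx
        simp [mul_comm]
      · intro x hx hx1
        rcases x with - | ⟨a, t⟩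
        · simp [h1] at hx1
        · have ha : a = 1 := by
            by_contra h
            simp [h1, h] at hx1
          subst ha
          exact Finset.mem_image_of_mem _ ((Set.Finite.mem_toFinset _).2 ⟨l, hx⟩)
    rw [this]
    have hj : n + (i + 1 : ℕ) = k - 1 := by omega
    have h3 : ∀ x, Adm True (k - 1) fun l => Q l x := fun x => hj ▸ hQ.adm S x
    refine Finset.sum_induction _ (Adm True (k - 1)) (fun _ _ => Adm.add) (Adm.zero _ _) ?_
    exact fun x _ => (h3 x).smul _
  refine S.eq_zero (((hA.add ⟨_, hQa, fun l _ => rfl⟩)).congr fun l hl => ?_)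
  have h2 : ev (h1 (cob φ)) (Q2 l) = 0 := by
    rw [ev_eq_sum _ _ ∅, Finset.sum_empty]
    intro x hx hx1
    refine absurd ?_ hx1
    rw [h1, hφc x (hQ2.len l x hx)]
    simp
  have h3 : ev (h1 φ) (dl N Q l) = cob (fun l => ev (h1 φ) (Q l)) l := by
    rw [map_dl, dl_of_mem hl, cobV_eq_cob]
  have h4 : bd (Q2 l) = T l - dl N Q l := congrFun hQ2b l
  rw [Pi.add_apply, h4, h2, map_sub, h3, hTev]
  simp [hu', hl]

end Spectral

end SpTop

namespace SpTop

open Matrix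

variable {n : ℕ}

/-- The real vector underlying an integral one. -/
def vR {ι : Type*} (v : ι → ℤ) : ι → ℝ := fun i => v i

lemma toR_mulVec' {ι κ : Type*} [Fintype ι] [Fintype κ] (g : Matrix ι κ ℤ) (v : κ → ℤ) :
    vR (g *ᵥ v) = toR g *ᵥ vR v := toR_mulVec g v

lemma toR_J : toR (J (Fin n) ℤ) = J (Fin n) ℝ := by
  ext (i | i) (j | j) <;> simp [toR, J, Matrix.one_apply]

lemma om_vR (v w : Fin n ⊕ Fin n → ℤ) : om n ℝ (vR v) (vR w) = om n ℤ v w := by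
  rw [om_apply, om_apply, ← toR_J, ← toR_mulVec']
  simp [vR, dotProduct]

lemma toR_rot (v v' : Fin n ⊕ Fin n → ℤ) (c s : ℤ) :
    toR (rot v v' c s) = rot (vR v) (vR v') c s := by
  have h : ∀ w : Fin n ⊕ Fin n → ℤ, ∀ j, (J (Fin n) ℝ *ᵥ vR w) j = ((J (Fin n) ℤ *ᵥ w) j : ℝ) :=
    fun w j => by rw [← toR_J, ← toR_mulVec']; rfl
  ext i j
  simp only [toR, rot, Matrix.map_apply, Matrix.add_apply, Matrix.sub_apply, vecMulVec_apply, h]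
  simp only [vR, Pi.add_apply, Pi.smul_apply, smul_eq_mul, Matrix.one_apply]
  split_ifs <;> push_cast <;> ring

lemma toR_mem {γ : Matrix (Fin n ⊕ Fin n) (Fin n ⊕ Fin n) ℤ} (h : γ ∈ symplecticGroup (Fin n) ℤ) :
    toR γ ∈ symplecticGroup (Fin n) ℝ := by
  rw [SymplecticGroup.mem_iff] at h ⊢
  rw [← toR_J, show (toR γ)ᵀ = toR γᵀ from rfl, ← toR_mul, ← toR_mul, h]

variable (n) in
/-- Unimodular frames with bounded total level. -/
def Yc (b : ℤ) := {a : Vx n // a.Ok b}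

/-- The piece of the Siegel space attached to a frame. -/
def Vy {b : ℤ} (a : Yc n b) : Set (SE n) := Vr (toR a.1.mat) a.1.lev

instance (b : ℤ) : MulAction (symplecticGroup (Fin n) ℤ) (Yc n b) where
  smul γ a := ⟨⟨γ.1 * a.1.mat, a.1.lev⟩, by
    rw [Matrix.det_mul]
    exact (isUnit_det_of_symp γ.2).mul a.2.1, a.2.2⟩
  one_smul a := Subtype.ext (Vx.ext (one_mul _) rfl)
  mul_smul γ γ' a := Subtype.ext (Vx.ext (mul_assoc _ _ _) rfl)

lemma smul_mat {b : ℤ} (γ : symplecticGroup (Fin n) ℤ) (a : Yc n b) :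
    (γ • a).1.mat = γ.1 * a.1.mat := rfl

lemma smul_lev {b : ℤ} (γ : symplecticGroup (Fin n) ℤ) (a : Yc n b) :
    (γ • a).1.lev = a.1.lev := rfl

lemma Yc.free {b : ℤ} (γ : symplecticGroup (Fin n) ℤ) (a : Yc n b) (h : γ • a = a) : γ = 1 := by
  have h1 : γ.1 * a.1.mat = a.1.mat := by rw [← smul_mat, h]
  refine Subtype.ext ?_
  have h2 := congrArg (· * a.1.mat⁻¹) h1
  simpa [Matrix.mul_assoc, Matrix.mul_nonsing_inv _ a.2.1] using h2

lemma LF_Vy (b : ℤ) : LF (siegel n) (Vy (n := n) (b := b)) := by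
  have h := (LF_Vp (n := n) (M := fun _ => 1) (fun _ => by simp) b).comap
    (φ := fun a : Yc n b => (false, a.1)) fun _ _ h => Subtype.ext (Prod.mk.inj h).2
  convert h using 1
  funext a
  simp only [Function.comp_apply]
  rw [Vp_eq a.2, one_mul]
  rfl

/-- The translate of a point of the Siegel space. -/
lemma mem_Vr_mul {g h : Matrix (Fin n ⊕ Fin n) (Fin n ⊕ Fin n) ℝ} {k : Fin n ⊕ Fin n → ℤ}
    {p q : SE n} (hq : q ∈ siegel n) (hpq : ∀ v, qf q (h *ᵥ v) = qf p v) (hp : p ∈ Vr g k) :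
    q ∈ Vr (h * g) k := by
  refine ⟨hq, fun i => ?_⟩
  have : (h * g).col i = h *ᵥ g.col i := by
    ext j; simp [Matrix.mul_apply, Matrix.mulVec, dotProduct, Matrix.col]
  rw [this, hpq]
  exact hp.2 i

lemma mem_Vy_smul {b : ℤ} {γ : symplecticGroup (Fin n) ℤ} {p q : SE n} (hq : q ∈ siegel n)
    (hpq : ∀ v, qf q (toR γ.1 *ᵥ v) = qf p v) {a : Yc n b} (hp : p ∈ Vy a) : q ∈ Vy (γ • a) := by
  have := mem_Vr_mul hq hpq hp
  rwa [← toR_mul] at this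

variable (n) in
/-- The nerve of the covering of the Siegel space. -/
def Ny (b : ℤ) : Set (List (Yc n b)) := Nv True Vy Set.univ (siegel n)

lemma Ny_smul {b : ℤ} (γ : symplecticGroup (Fin n) ℤ) (l : List (Yc n b)) (h : l ∈ Ny n b) :
    l.map (γ • ·) ∈ Ny n b := by
  obtain ⟨h1, -, p, hp, h2⟩ := h
  obtain ⟨q, hq, hpq⟩ := exists_act (toR_mem γ.2) hp
  refine ⟨by simpa using h1, by simp, q, hq, fun a ha => ?_⟩
  obtain ⟨a, ha', rfl⟩ := List.mem_map.1 ha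
  exact mem_Vy_smul hq hpq (h2 a ha')

lemma Coc.map {Y Y' : Type*} {N : Set (List Y)} {N' : Set (List Y')} {f : List Y → ℚ}
    (hf : Coc N f) {r : Y' → Y} (h : ∀ l ∈ N', l.map r ∈ N) : Coc N' fun l => f (l.map r) :=
  fun l hl => by rw [cob_map]; exact hf _ (h l hl)

variable (n) in
/-- The vertices of the auxiliary covering attached to a square root of a symplectic matrix. -/
abbrev Yd (b : ℤ) := Bool × Yc n b

/-- The pieces of the auxiliary covering. -/
def Vd (h : Matrix (Fin n ⊕ Fin n) (Fin n ⊕ Fin n) ℝ) {b : ℤ} (a : Yd n b) : Set (SE n) :=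
  Vr ((if a.1 then h else 1) * toR a.2.1.mat) a.2.1.lev

lemma LF_Vd {h : Matrix (Fin n ⊕ Fin n) (Fin n ⊕ Fin n) ℝ} (hh : IsUnit h.det) (b : ℤ) :
    LF (siegel n) (Vd (n := n) h (b := b)) := by
  have h := (LF_Vp (n := n) (M := fun i => if i then h else 1)
    (fun i => by cases i <;> simp [hh.ne_zero]) b).comap
    (φ := fun a : Yd n b => (a.1, a.2.1)) fun _ _ h =>
      Prod.ext (Prod.mk.inj h).1 (Subtype.ext (Prod.mk.inj h).2)
  convert h using 1
  funext a
  simp only [Function.comp_apply]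
  rw [Vp_eq a.2.2]
  rfl

lemma hsqrt : (√2 / 2 : ℝ) ^ 2 + (√2 / 2) ^ 2 = 1 := by
  have : √(2 : ℝ) ^ 2 = 2 := Real.sq_sqrt (by norm_num)
  rw [div_pow, this]
  norm_num

/-- A symplectic matrix with a real symplectic square root acts on the top class by a square. -/
lemma exists_sq {b : ℤ} (hn : 1 ≤ n) (hcov : ∀ p ∈ siegel n, ∃ a : Yc n b, p ∈ Vy a)
    {u : List (Yc n b) → ℚ} {c : symplecticGroup (Fin n) ℤ → ℚ}
    (S : Sys (Ny n b) (n + 1 + (n ^ 2 : ℕ)) u c) {γ : symplecticGroup (Fin n) ℤ}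
    {h : Matrix (Fin n ⊕ Fin n) (Fin n ⊕ Fin n) ℝ} (hh : h ∈ symplecticGroup (Fin n) ℝ)
    (hγ : h * h = toR γ.1) : ∃ r : ℚ, c γ = r ^ 2 := by
  classical
  have hLF := LF_Vd (isUnit_det_of_symp hh) b
  obtain ⟨m, hm⟩ : ∃ m, n ^ 2 + n = m + 1 := ⟨n ^ 2 + n - 1, by omega⟩
  have hk : (n + 1 + (n ^ 2 : ℕ) : ℤ) = m + 2 := by
    have : ((n ^ 2 + n : ℕ) : ℤ) = (m + 1 : ℕ) := by rw [hm]
    push_cast at this ⊢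
    linarith
  rw [hk] at S
  obtain ⟨-, u', hu', huc, hun⟩ := exists_top_class hLF flat_siegel siegel_nonempty
    (finrank_SE.trans hm)
  set N' : Set (List (Yd n b)) := Nv True (Vd h) Set.univ (siegel n) with hN'
  set ι : Yc n b → Yd n b := fun a => (false, a) with hι
  have hιi : Function.Injective ι := fun _ _ h => (Prod.mk.inj h).2
  have hιV : ∀ a, Vd h (ι a) = Vy a := fun a => by
    show Vr (1 * toR a.1.mat) a.1.lev = _
    rw [one_mul]
    rfl
  set σ : Yd n b → Yd n b := fun a => if a.1 then (false, γ • a.2) else (true, a.2) with hσ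
  have hσi : Function.Injective σ := by
    rintro ⟨i, a⟩ ⟨j, a'⟩ hij
    cases i <;> cases j <;> simp [hσ] at hij ⊢ <;> exact hij
  have hσN : ∀ l ∈ N', l.map σ ∈ N' := by
    rintro l ⟨h1, -, p, hp, h2⟩
    obtain ⟨q, hq, hpq⟩ := exists_act hh hp
    refine ⟨by simpa using h1, by simp, q, hq, fun a ha => ?_⟩
    obtain ⟨⟨i, a⟩, ha', rfl⟩ := List.mem_map.1 ha
    have h3 := mem_Vr_mul hq hpq (h2 _ ha')
    cases i
    · simpa [hσ, Vd] using h3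
    · simp only [if_true, ← Matrix.mul_assoc, hγ, ← toR_mul] at h3
      simpa [hσ, Vd, smul_mat, smul_lev] using h3
  have hιN : ∀ l ∈ Ny n b, l.map ι ∈ N' := by
    rintro l ⟨h1, -, p, hp, h2⟩
    refine ⟨by simpa using h1, by simp, p, hp, fun a ha => ?_⟩
    obtain ⟨a, ha', rfl⟩ := List.mem_map.1 ha
    rw [hιV]
    exact h2 a ha'
  have hcov' : ∀ p ∈ siegel n, ∃ a ∈ Set.range ι, p ∈ Vd h a := fun p hp => by
    obtain ⟨a, ha⟩ := hcov p hp
    exact ⟨_, ⟨a, rfl⟩, (hιV a).symm ▸ ha⟩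
  obtain ⟨hspan, -⟩ := hun Set.univ fun p hp => by
    obtain ⟨a, -, ha⟩ := hcov' p hp
    exact ⟨a, trivial, ha⟩
  obtain ⟨-, hncob⟩ := hun _ hcov'
  obtain ⟨r, hr⟩ := hspan _ (hu'.map hσi) (huc.map hσN)
  have h2 := (hr.map hσi hσN).add (hr.smul r)
  have h3 := h2.map hιi hιN
  set w : List (Yc n b) → ℚ := fun l => u' (l.map ι) with hw
  have hwa : Adm True (m + 2) w := hu'.map hιi
  have hwc : Coc (Ny n b) w := huc.map hιN
  have hwn : ¬ Cob True (m + 2) (Ny n b) w := by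
    rintro ⟨g, hg, hgw⟩
    refine hncob ⟨fun l => if ∀ a ∈ l, a.1 = false then g (l.map Prod.snd) else 0, ?_, ?_⟩
    · refine ⟨(hg.fin.image (List.map ι)).subset fun l hl => ?_, fun l hl => ?_, fun _ => ?_,
        fun _ => ?_⟩
      · simp only [Function.mem_support, ne_eq, ite_eq_right_iff, Classical.not_imp] at hl
        refine ⟨_, hl.2, ?_⟩
        rw [List.map_map]
        conv_rhs => rw [← List.map_id l]
        exact List.map_congr_left fun a ha => Prod.ext (hl.1 a ha).symm rfl
      · simp only [ne_eq, ite_eq_right_iff, Classical.not_imp] at hl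
        simpa using hg.len _ hl.2
      · simpa using hg.nil trivial
      · exact ((hg.alt trivial).map Prod.snd).ite Alt.zero fun l l' hp h a ha =>
          h a (hp.mem_iff.2 ha)
    · rintro l ⟨h1, h2, p, hp, h4⟩
      obtain ⟨l, rfl⟩ : ∃ l' : List (Yc n b), l = l'.map ι := by
        refine ⟨l.map Prod.snd, ?_⟩
        rw [List.map_map]
        conv_lhs => rw [← List.map_id l]
        refine List.map_congr_left fun a ha => ?_
        obtain ⟨a', rfl⟩ := h2 a ha
        rfl
      have hl : l ∈ Ny n b := ⟨by simpa using h1, by simp, p, hp, fun a ha => by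
        rw [← hιV]
        exact h4 _ (List.mem_map_of_mem ha)⟩
      rw [← cob_map]
      refine (hgw l hl).trans (congrArg (fun f => cob f l) ?_)
      funext l
      simp [hι, Function.comp_def]
  have h4 := S.tw hwa hwc γ
  refine ⟨r, ?_⟩
  by_contra hne
  refine hwn (((h3.sub h4).smul (c γ - r ^ 2)⁻¹).congr fun l _ => ?_)
  have hne' : c γ - r ^ 2 ≠ 0 := sub_ne_zero.2 hne
  have h5 : ((l.map ι).map σ).map σ = (l.map (γ • ·)).map ι := by
    simp [hσ, hι, Function.comp_def]
  simp only [hw, Pi.add_apply, Pi.sub_apply, Pi.smul_apply, smul_eq_mul, h5]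
  field_simp
  ring

/-- The complex attached to the integral symplectic group. -/
theorem exists_sys (hn : 1 ≤ n) : ∃ (b : ℤ) (u : List (Yc n b) → ℚ)
    (c : symplecticGroup (Fin n) ℤ → ℚ), Sys (Ny n b) (n + 1 + (n ^ 2 : ℕ)) u c ∧
      (∀ p ∈ siegel n, ∃ a : Yc n b, p ∈ Vy a) ∧ ∀ v v', om n ℤ v v' = 1 →
      ∀ γ : symplecticGroup (Fin n) ℤ, γ.1 = rot v v' 0 1 → c γ ≠ -1 := by
  obtain ⟨b, hb⟩ := exists_cover n
  have hcov : ∀ p ∈ siegel n, ∃ a : Yc n b, p ∈ Vy a := fun p hp => by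
    obtain ⟨a, ha⟩ := hb p hp
    have hok : a.Ok b := ha.1
    rw [Vp_eq hok, one_mul] at ha
    exact ⟨⟨a, hok⟩, ha⟩
  obtain ⟨m, hm⟩ : ∃ m, n ^ 2 + n = m + 1 := ⟨n ^ 2 + n - 1, by omega⟩
  have hk : (n + 1 + (n ^ 2 : ℕ) : ℤ) = m + 2 := by
    have : ((n ^ 2 + n : ℕ) : ℤ) = (m + 1 : ℕ) := by rw [hm]
    push_cast at this ⊢
    linarith
  have hcov' : ∀ p ∈ siegel n, ∃ a ∈ (Set.univ : Set (Yc n b)), p ∈ Vy a := fun p hp => by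
    obtain ⟨a, ha⟩ := hcov p hp
    exact ⟨a, trivial, ha⟩
  obtain ⟨hvan, u, hu, huc, hun⟩ := exists_top_class (LF_Vy b) flat_siegel siegel_nonempty
    (finrank_SE.trans hm)
  obtain ⟨hspan, hncob⟩ := hun _ hcov'
  have htw : ∀ γ : symplecticGroup (Fin n) ℤ, ∃ r : ℚ, Cob True (m + 2) (Ny n b)
      ((fun l => u (l.map (γ • ·))) - r • u) := fun γ =>
    hspan _ (hu.map (MulAction.injective γ)) (huc.map (Ny_smul γ))
  choose c hc using htw
  have S : Sys (Ny n b) (n + 1 + (n ^ 2 : ℕ)) u c := by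
    rw [hk]
    exact {
      free := Yc.free
      inv := Ny_smul
      nil := fun h => h.1 trivial rfl
      cplx := (LF_Vy b).cplx _ _
      star := fun a => ((LF_Vy b).star a).subset fun _ ⟨_, ⟨_, _, p, _, h⟩, ha, hb⟩ =>
        ⟨p, h _ ha, h _ hb⟩
      van := hvan _ hcov'
      adm := hu
      coc := huc
      span := hspan
      ncob := hncob
      twist := hc }
  refine ⟨b, u, c, S, hcov, fun v v' hv γ hγ h => ?_⟩
  have hv' : om n ℝ (vR v) (vR v') = 1 := by rw [om_vR, hv, Int.cast_one]
  obtain ⟨r, hr⟩ := exists_sq hn hcov S (rot_mem hv' hsqrt) (γ := γ) (by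
    rw [rot_mul hv', hγ, toR_rot]
    congr 1
    · simp
    · rw [Int.cast_one, ← hsqrt]; ring)
  have := sq_nonneg r
  linarith

end SpTop

namespace SpTop

section Alternation

variable {A B : Type*}

/-- The alternating sum over the ways of extracting an entry of a list. -/
def ext1 : (A → List A → ℚ) → List A → ℚ
  | _, [] => 0
  | F, a :: l => F a l - ext1 (fun b m => F b (a :: m)) l

@[simp] lemma ext1_nil (F : A → List A → ℚ) : ext1 F [] = 0 := rfl

lemma ext1_cons (F : A → List A → ℚ) (a : A) (l : List A) :
    ext1 F (a :: l) = F a l - ext1 (fun b m => F b (a :: m)) l := rfl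

lemma ext1_congr {F F' : A → List A → ℚ} {l : List A}
    (h : ∀ a m, (a :: m).Perm l → F a m = F' a m) : ext1 F l = ext1 F' l := by
  induction l generalizing F F' with
  | nil => rfl
  | cons a l ih =>
    rw [ext1_cons, ext1_cons, h a l (List.Perm.refl _)]
    congr 1
    exact ih fun b m hb => h b (a :: m) ((List.Perm.swap a b m).trans (hb.cons a))

lemma ext1_add (F F' : A → List A → ℚ) (l : List A) :
    ext1 (fun a m => F a m + F' a m) l = ext1 F l + ext1 F' l := by
  induction l generalizing F F' with
  | nil => simp
  | cons a l ih => simp only [ext1_cons, ih]; ring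

lemma ext1_smul (c : ℚ) (F : A → List A → ℚ) (l : List A) :
    ext1 (fun a m => c * F a m) l = c * ext1 F l := by
  induction l generalizing F with
  | nil => simp
  | cons a l ih => simp only [ext1_cons, ih]; ring

lemma ext1_neg (F : A → List A → ℚ) (l : List A) :
    ext1 (fun a m => -F a m) l = -ext1 F l := by
  have := ext1_smul (-1) F l
  simpa using this

lemma ext1_sub (F F' : A → List A → ℚ) (l : List A) :
    ext1 (fun a m => F a m - F' a m) l = ext1 F l - ext1 F' l := by
  simp only [sub_eq_add_neg, ext1_add, ext1_neg]

lemma ext1_map (F : B → List B → ℚ) (r : A → B) (l : List A) :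
    ext1 (fun a m => F (r a) (m.map r)) l = ext1 F (l.map r) := by
  induction l generalizing F with
  | nil => rfl
  | cons a l ih =>
    rw [ext1_cons, List.map_cons, ext1_cons, ← ih]
    rfl

lemma ext1_const (f : List A → ℚ) (l : List A) : ext1 (fun _ m => f m) l = cob f l := by
  induction l generalizing f with
  | nil => simp
  | cons a l ih => rw [ext1_cons, ih, cob_cons]

lemma ext1_alt {F : A → List A → ℚ} (hF : ∀ a, Alt (F a)) : Alt (ext1 F) := by
  intro l₁ a b l₂
  induction l₁ generalizing F with
  | nil =>
    have : (fun c m => F c (a :: b :: m)) = fun c m => -F c (b :: a :: m) := by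
      funext c m
      exact hF c [] a b m
    simp only [List.nil_append, ext1_cons, this, ext1_neg]
    ring
  | cons x l₁ ih =>
    simp only [List.cons_append, ext1_cons]
    rw [hF x l₁ a b l₂, ih fun c => (hF c).cons x]
    ring

lemma ext1_cob (H : A → List A → ℚ) (l : List A) :
    ext1 (fun a m => cob (H a) m) l = -cob (ext1 H) l := by
  induction l generalizing H with
  | nil => simp
  | cons a l ih =>
    have h1 : (fun m => ext1 H (a :: m)) =
        H a - ext1 (fun b m => H b (a :: m)) := by
      funext m
      rfl
    rw [ext1_cons, cob_cons, h1, cob_sub]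
    simp only [cob_cons, ext1_sub]
    rw [ih]
    ring

lemma ext1_of_alt {f : List A → ℚ} (hf : Alt f) (l : List A) :
    ext1 (fun a m => f (a :: m)) l = l.length * f l := by
  induction l generalizing f with
  | nil => simp
  | cons a l ih =>
    have : (fun b m => f (b :: a :: m)) = fun b m => -f (a :: b :: m) := by
      funext b m
      exact hf [] b a m
    rw [ext1_cons, this, ext1_neg, ih (hf.cons a)]
    push_cast [List.length_cons]
    ring

/-- The unnormalized antisymmetrization of a cochain in a given degree. -/
def asm : ℕ → (List A → ℚ) → List A → ℚ
  | 0, f => fun l => if l.isEmpty then f l else 0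
  | m + 1, f => ext1 fun a => asm m fun x => f (a :: x)

lemma asm_alt (m : ℕ) (f : List A → ℚ) : Alt (asm m f) := by
  induction m generalizing f with
  | zero => intro l₁ a b l₂; simp [asm]
  | succ m ih => exact ext1_alt fun a => ih _

lemma asm_congr {m : ℕ} {f g : List A → ℚ} {l : List A} (h : ∀ x, x.Perm l → f x = g x) :
    asm m f l = asm m g l := by
  induction m generalizing f g l with
  | zero => simp only [asm, h l (List.Perm.refl _)]
  | succ m ih =>
    refine ext1_congr fun a x hx => ih fun y hy => h _ ((hy.cons a).trans hx)

lemma asm_sub (m : ℕ) (f g : List A → ℚ) (l : List A) :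
    asm m (fun x => f x - g x) l = asm m f l - asm m g l := by
  induction m generalizing f g l with
  | zero => simp only [asm]; split_ifs <;> simp
  | succ m ih =>
    rw [asm, asm, asm, ← ext1_sub]
    congr 1
    funext a x
    exact ih _ _ _

lemma asm_smul (m : ℕ) (c : ℚ) (f : List A → ℚ) (l : List A) :
    asm m (fun x => c * f x) l = c * asm m f l := by
  induction m generalizing f l with
  | zero => simp only [asm]; split_ifs <;> simp
  | succ m ih =>
    rw [asm, asm, ← ext1_smul]
    congr 1
    funext a x
    exact ih _ _

lemma asm_map (m : ℕ) (f : List B → ℚ) (r : A → B) (l : List A) :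
    asm m (fun x => f (x.map r)) l = asm m f (l.map r) := by
  induction m generalizing f l with
  | zero => simp [asm]
  | succ m ih =>
    rw [asm, asm, ← ext1_map]
    congr 1
    funext a x
    exact ih (fun y => f (r a :: y)) x

lemma asm_eq_zero {m : ℕ} {f : List A → ℚ} {l : List A} (h : ∀ x, x.Perm l → f x = 0) :
    asm m f l = 0 := by
  rw [asm_congr (g := fun x => 0 * f x) fun x hx => by rw [h x hx, zero_mul], asm_smul, zero_mul]

lemma asm_of_alt {f : List A → ℚ} (hf : Alt f) (l : List A) :
    asm l.length f l = (l.length.factorial : ℚ) * f l := by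
  suffices ∀ m, m = l.length → asm m f l = (m.factorial : ℚ) * f l from this _ rfl
  intro m hm
  induction m generalizing f l with
  | zero =>
    obtain rfl := List.length_eq_zero_iff.1 hm.symm
    simp [asm]
  | succ m ih =>
    have h1 : asm (m + 1) f l = ext1 (fun a x => (m.factorial : ℚ) * f (a :: x)) l := by
      refine ext1_congr fun a x hx => ih (hf.cons a) x ?_
      have := hx.length_eq
      simp only [List.length_cons] at this
      omega
    rw [h1, ext1_smul, ext1_of_alt hf, ← hm, Nat.factorial_succ]
    push_cast
    ring

lemma asm_cob (m : ℕ) (f : List A → ℚ) (l : List A) :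
    asm (m + 1) (cob f) l = (m + 1) * cob (asm m f) l := by
  have h0 : ∀ (m : ℕ) (f : List A → ℚ) l, asm (m + 1) (cob f) l =
      cob (asm m f) l - ext1 (fun a => asm m (cob fun x => f (a :: x))) l := fun m f l => by
    rw [asm, ← ext1_const, ← ext1_sub]
    congr 1
    funext a x
    rw [← asm_sub]
    congr 1
    funext y
    exact cob_cons f a y
  induction m generalizing f l with
  | zero =>
    have h1 : ext1 (fun a => asm 0 (cob fun x => f (a :: x))) l = 0 := by
      rw [ext1_congr (F' := fun _ _ => 0 * 0), ext1_smul, zero_mul]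
      intro a x _
      simp only [asm]
      split_ifs with hx
      · rw [List.isEmpty_iff.1 hx, cob_nil, zero_mul]
      · simp
    rw [h0, h1]
    simp
  | succ m ih =>
    rw [h0, ext1_congr fun a x _ => ih (fun x => f (a :: x)) x, ext1_smul, ext1_cob]
    change cob (asm (m + 1) f) l - (m + 1) * -cob (asm (m + 1) f) l = _
    push_cast
    ring

end Alternation

end SpTop

namespace SpTop

section Filling

variable {G W : Type*} [Group G] [MulAction G W]

/-- Chains on lists of length `j` in `N` with entries in `K`. -/
noncomputable abbrev Ch (N : Set (List W)) (K : Set W) (j : ℕ) : Submodule ℚ (List W →₀ ℚ) :=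
  Finsupp.supported ℚ ℚ {l | l.length = j ∧ l ∈ N ∧ ∀ a ∈ l, a ∈ K}

/-- The linear extension of a map on lists. -/
noncomputable abbrev lin (s : List W → (List W →₀ ℚ)) : (List W →₀ ℚ) →ₗ[ℚ] (List W →₀ ℚ) :=
  Finsupp.linearCombination ℚ s

lemma lin_mem {s : List W → (List W →₀ ℚ)} {M : Submodule ℚ (List W →₀ ℚ)} {z : List W →₀ ℚ}
    (h : ∀ l ∈ z.support, s l ∈ M) : lin s z ∈ M := by
  rw [lin, Finsupp.linearCombination_apply]
  exact M.sum_mem fun l hl => M.smul_mem _ (h l hl)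

lemma lin_congr {s s' : List W → (List W →₀ ℚ)} {z : List W →₀ ℚ}
    (h : ∀ l ∈ z.support, s l = s' l) : lin s z = lin s' z := by
  rw [lin, Finsupp.linearCombination_apply, lin, Finsupp.linearCombination_apply]
  exact Finset.sum_congr rfl fun l hl => congrArg (z l • ·) (h l hl)

lemma ev_lin (f : List W → ℚ) (s : List W → (List W →₀ ℚ)) (z : List W →₀ ℚ) :
    ev f (lin s z) = ev (fun l => ev f (s l)) z := by
  induction z using Finsupp.induction_linear with
  | zero => simp
  | add x y hx hy => simp [hx, hy]
  | single l c => simp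

lemma mp_lin {s : List W → (List W →₀ ℚ)} {γ : G} (hs : ∀ l, s (l.map (γ • ·)) = mp (γ • ·) (s l))
    (z : List W →₀ ℚ) : mp (γ • ·) (lin s z) = lin s (mp (γ • ·) z) := by
  induction z using Finsupp.induction_linear with
  | zero => simp
  | add x y hx hy => simp only [map_add, hx, hy]
  | single l c => simp [hs]

lemma exists_list_equivariant (K : Set W) (hK : ∀ (γ : G), ∀ a, γ • a ∈ K ↔ a ∈ K) (κ : W → G)
    (hκ : ∀ a ∉ K, ∀ γ : G, κ (γ • a) = γ * κ a) :
    ∃ σ : List W → G, ∀ l : List W, (∃ a ∈ l, a ∉ K) → ∀ γ : G, σ (l.map (γ • ·)) = γ * σ l := by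
  classical
  let σ : List W → G := fun l => l.rec 1 fun a _ ih => if a ∈ K then ih else κ a
  have hσ : ∀ a l, σ (a :: l) = if a ∈ K then σ l else κ a := fun _ _ => rfl
  refine ⟨σ, fun l => ?_⟩
  induction l with
  | nil => simp
  | cons a l ih =>
    rintro ⟨b, hb, hbK⟩ γ
    rw [List.map_cons, hσ, hσ]
    by_cases ha : a ∈ K
    · rw [if_pos ((hK γ a).2 ha), if_pos ha]
      refine ih ⟨b, ?_, hbK⟩ γ
      rcases List.mem_cons.1 hb with rfl | h
      · exact absurd ha hbK
      · exact h
    · rw [if_neg fun h => ha ((hK γ a).1 h), if_neg ha, hκ a ha]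

/-- The data of a filling `w` of a list relative to `K`-chains. -/
def Fills (N : Set (List W)) (K : Set W) (s : List W → (List W →₀ ℚ)) (l : List W)
    (w : List W →₀ ℚ) : Prop :=
  w ∈ Ch N Set.univ (l.length + 1) ∧
    bd w + lin s (bdl l) - Finsupp.single l 1 ∈ Ch N K l.length

variable {N : Set (List W)} {K : Set W} {n : ℕ}

lemma Ch.mp (hinv : ∀ (γ : G), ∀ l ∈ N, l.map (γ • ·) ∈ N)
    (hK : ∀ (γ : G), ∀ a, γ • a ∈ K ↔ a ∈ K) {j : ℕ} {z : List W →₀ ℚ} (hz : z ∈ Ch N K j) (γ : G) :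
    SpTop.mp (γ • ·) z ∈ Ch N K j :=
  mp_mem (fun l hl => by
    refine ⟨by simpa using hl.1, hinv γ l hl.2.1, fun a ha => ?_⟩
    obtain ⟨b, hb, rfl⟩ := List.mem_map.1 ha
    exact (hK γ b).2 (hl.2.2 b hb)) hz

lemma Fills.map (hinv : ∀ (γ : G), ∀ l ∈ N, l.map (γ • ·) ∈ N)
    (hK : ∀ (γ : G), ∀ a, γ • a ∈ K ↔ a ∈ K) {s : List W → (List W →₀ ℚ)}
    (hs : ∀ (γ : G) l, s (l.map (γ • ·)) = mp (γ • ·) (s l)) {l : List W} {w : List W →₀ ℚ}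
    (h : Fills N K s l w) (γ : G) : Fills N K s (l.map (γ • ·)) (mp (γ • ·) w) := by
  refine ⟨?_, ?_⟩
  · rw [List.length_map]
    exact Ch.mp hinv (by simp) h.1 γ
  · rw [List.length_map, ← mp_bd, ← mp_bdl, ← mp_lin (hs γ), ← mp_single, ← map_add, ← map_sub]
    exact Ch.mp hinv hK h.2 γ

lemma Fills.congr {s s' : List W → (List W →₀ ℚ)} {l : List W} {w : List W →₀ ℚ}
    (h : Fills N K s l w) (hs : ∀ x, x.length + 1 = l.length → s' x = s x) : Fills N K s' l w := by
  refine ⟨h.1, ?_⟩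
  rw [lin_congr fun x hx => hs x (mem_bdl hx).2]
  exact h.2

lemma bd_sub_lin (hsub : ∀ l ∈ N, ∀ l' : List W, (∀ a ∈ l', a ∈ l) → l' ∈ N)
    {s : List W → (List W →₀ ℚ)} {l : List W} {m : ℕ} (hl : l ∈ N) (hm : l.length = m + 1)
    (hs : ∀ x ∈ N, x.length = m → Fills N K s x (s x)) :
    Finsupp.single l 1 - lin s (bdl l) ∈ Ch N Set.univ (m + 1) ∧
      bd (Finsupp.single l 1 - lin s (bdl l)) ∈ Ch N K m := by
  have hf : ∀ x ∈ (bdl l).support, x ∈ N ∧ x.length = m := fun x hx => by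
    obtain ⟨h1, h2⟩ := mem_bdl hx
    exact ⟨hsub l hl x h1.subset, by omega⟩
  refine ⟨Submodule.sub_mem _ (Finsupp.single_mem_supported _ _ ⟨hm, hl, by simp⟩)
    (lin_mem fun x hx => ?_), ?_⟩
  · have := (hs x (hf x hx).1 (hf x hx).2).1
    rwa [(hf x hx).2] at this
  · have h1 : bd (Finsupp.single l 1 - lin s (bdl l)) =
        -lin (fun x => bd (s x) + lin s (bdl x) - Finsupp.single x 1) (bdl l) := by
      have h2 : ∀ z : List W →₀ ℚ, lin (fun x => bd (s x) + lin s (bdl x) - Finsupp.single x 1) z =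
          bd (lin s z) + lin s (bd z) - z := fun z => by
        induction z using Finsupp.induction_linear with
        | zero => simp
        | add x y hx hy => simp only [map_add, hx, hy]; abel
        | single l c => simp [smul_sub]
      rw [h2, bd_bdl, map_zero, map_sub, bd_single, one_smul]
      abel
    rw [h1]
    refine Submodule.neg_mem _ (lin_mem fun x hx => ?_)
    have := (hs x (hf x hx).1 (hf x hx).2).2
    rwa [(hf x hx).2] at this

theorem exists_fill (hsub : ∀ l ∈ N, ∀ l' : List W, (∀ a ∈ l', a ∈ l) → l' ∈ N)
    (hinv : ∀ (γ : G), ∀ l ∈ N, l.map (γ • ·) ∈ N) (hK : ∀ (γ : G), ∀ a, γ • a ∈ K ↔ a ∈ K)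
    (κ : W → G) (hκ : ∀ a ∉ K, ∀ γ : G, κ (γ • a) = γ * κ a)
    (hac : ∀ j, ∀ z ∈ Ch N Set.univ j, bd z = 0 → ∃ w ∈ Ch N Set.univ (j + 1), bd w = z)
    (hacK : ∀ q < n, ∀ z ∈ Ch N K q, bd z = 0 → ∃ w ∈ Ch N K (q + 1), bd w = z) :
    ∀ m ≤ n, ∃ s : List W → (List W →₀ ℚ), (∀ (γ : G) l, s (l.map (γ • ·)) = mp (γ • ·) (s l)) ∧
      (∀ l, (∀ a ∈ l, a ∈ K) → s l = 0) ∧ ∀ l ∈ N, l.length ≤ m → Fills N K s l (s l) := by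
  classical
  obtain ⟨σ, hσ⟩ := exists_list_equivariant K hK κ hκ
  intro m
  induction m with
  | zero =>
    refine fun _ => ⟨0, fun γ l => by simp, fun _ _ => rfl, fun l hl h0 => ?_⟩
    obtain rfl := List.length_eq_zero_iff.1 (Nat.le_zero.1 h0)
    refine ⟨Submodule.zero_mem _, ?_⟩
    simp only [Pi.zero_apply, map_zero, bdl_nil, add_zero]
    exact Submodule.sub_mem _ (Submodule.zero_mem _)
      (Finsupp.single_mem_supported _ _ ⟨rfl, hl, by simp⟩)
  | succ m ih =>
    intro hmn
    obtain ⟨s, hs, hs0, hsf⟩ := ih (by omega)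
    have ht : ∀ l, l ∈ N → l.length = m + 1 → ∃ w, Fills N K s l w := by
      intro l hl hm
      obtain ⟨h1, h2⟩ := bd_sub_lin hsub hl hm fun x hx hxm => hsf x hx hxm.le
      obtain ⟨k, hk, hkb⟩ := hacK m (by omega) _ h2 (bd_bd _)
      obtain ⟨w, hw, hwb⟩ := hac (m + 1) (Finsupp.single l 1 - lin s (bdl l) - k)
        (Submodule.sub_mem _ h1 (Finsupp.supported_mono
          (fun l hl => show _ ∧ _ from ⟨hl.1, hl.2.1, fun _ _ => Set.mem_univ _⟩) hk))
        (by rw [map_sub, hkb, sub_self])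
      refine ⟨w, hm ▸ hw, ?_⟩
      rw [hwb, hm, show Finsupp.single l 1 - lin s (bdl l) - k + lin s (bdl l) -
        Finsupp.single l 1 = -k by abel]
      exact Submodule.neg_mem _ hk
    choose! t ht using ht
    let s' : List W → (List W →₀ ℚ) := fun l =>
      if l.length = m + 1 then
        if l ∈ N ∧ ∃ a ∈ l, a ∉ K then mp (σ l • ·) (t (l.map ((σ l)⁻¹ • ·))) else 0
      else s l
    have hs'0 : ∀ l, (∀ a ∈ l, a ∈ K) → s' l = 0 := fun l hl => by
      simp only [s']
      split_ifs with h1 h2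
      · obtain ⟨-, a, ha, haK⟩ := h2
        exact absurd (hl a ha) haK
      · rfl
      · exact hs0 l hl
    have hss : ∀ x, x.length ≠ m + 1 → s' x = s x := fun x hx => if_neg hx
    refine ⟨s', fun γ l => ?_, hs'0, fun l hl hlm => ?_⟩
    · by_cases hm : l.length = m + 1
      · by_cases hc : l ∈ N ∧ ∃ a ∈ l, a ∉ K
        · have hc' : l.map (γ • ·) ∈ N ∧ ∃ a ∈ l.map (γ • ·), a ∉ K := by
            refine ⟨hinv γ l hc.1, ?_⟩
            obtain ⟨a, ha, haK⟩ := hc.2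
            exact ⟨γ • a, List.mem_map_of_mem ha, fun h => haK ((hK γ a).1 h)⟩
          have h1 : (l.map (γ • ·)).map ((γ * σ l)⁻¹ • ·) = l.map ((σ l)⁻¹ • ·) := by
            rw [List.map_map]
            refine List.map_congr_left fun a _ => ?_
            simp [smul_smul, mul_assoc]
          have h2 : ∀ z : List W →₀ ℚ, mp ((γ * σ l) • ·) z = mp (γ • ·) (mp (σ l • ·) z) := by
            intro z
            induction z using Finsupp.induction_linear with
            | zero => simp
            | add x y hx hy => simp only [map_add, hx, hy]
            | single l c => simp [mul_smul, Function.comp_def]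
          simp only [s']
          rw [if_pos (by simpa using hm), if_pos hc', if_pos hm, if_pos hc, hσ l hc.2, h1, h2]
        · have hc' : ¬(l.map (γ • ·) ∈ N ∧ ∃ a ∈ l.map (γ • ·), a ∉ K) := by
            rintro ⟨h1, a, ha, haK⟩
            obtain ⟨b, hb, rfl⟩ := List.mem_map.1 ha
            refine hc ⟨?_, b, hb, fun h => haK ((hK γ b).2 h)⟩
            have := hinv γ⁻¹ _ h1
            simpa [List.map_map, Function.comp_def] using this
          simp only [s']
          rw [if_pos (by simpa using hm), if_neg hc', if_pos hm, if_neg hc, map_zero]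
      · rw [hss l hm, hss _ (by simpa using hm), hs]
    · refine Fills.congr (s := s) ?_ fun x hx => hss x (by omega)
      by_cases hm : l.length = m + 1
      · by_cases hc : ∃ a ∈ l, a ∉ K
        · have h1 : s' l = mp (σ l • ·) (t (l.map ((σ l)⁻¹ • ·))) := by
            simp only [s']
            rw [if_pos hm, if_pos ⟨hl, hc⟩]
          have h2 := (ht _ (hinv (σ l)⁻¹ l hl) (by simpa using hm)).map hinv hK hs (σ l)
          rw [h1]
          simpa [List.map_map, Function.comp_def] using h2
        · push Not at hc
          rw [hs'0 l hc]
          refine ⟨Submodule.zero_mem _, ?_⟩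
          have h0 : lin s (bdl l) = 0 := by
            rw [lin_congr (s' := 0) fun x hx => hs0 x fun a ha => hc a ((mem_bdl hx).1.subset ha)]
            simp [lin]
          rw [h0, map_zero, add_zero]
          exact Submodule.sub_mem _ (Submodule.zero_mem _)
            (Finsupp.single_mem_supported _ _ ⟨rfl, hl, hc⟩)
      · rw [hss l hm]
        exact hsf l hl (by omega)

/-- Vanishing of a twisted-equivariant cochain on relative cycles yields an equivariant primitive
vanishing on `K`. -/
theorem exists_primitive (hsub : ∀ l ∈ N, ∀ l' : List W, (∀ a ∈ l', a ∈ l) → l' ∈ N)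
    (hinv : ∀ (γ : G), ∀ l ∈ N, l.map (γ • ·) ∈ N) (hK : ∀ (γ : G), ∀ a, γ • a ∈ K ↔ a ∈ K)
    (κ : W → G) (hκ : ∀ a ∉ K, ∀ γ : G, κ (γ • a) = γ * κ a)
    (hac : ∀ j, ∀ z ∈ Ch N Set.univ j, bd z = 0 → ∃ w ∈ Ch N Set.univ (j + 1), bd w = z)
    (hacK : ∀ q < n, ∀ z ∈ Ch N K q, bd z = 0 → ∃ w ∈ Ch N K (q + 1), bd w = z)
    {c : G → ℚ} {α : List W → ℚ} (hα : ∀ (γ : G) l, α (l.map (γ • ·)) = c γ * α l)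
    (hrel : ∀ z ∈ Ch N Set.univ (n + 1), bd z ∈ Ch N K n → ev α z = 0) :
    ∃ β : List W → ℚ, (∀ (γ : G) l, β (l.map (γ • ·)) = c γ * β l) ∧
      (∀ l, (∀ a ∈ l, a ∈ K) → β l = 0) ∧ ∀ l ∈ N, l.length = n + 1 → cob β l = α l := by
  obtain ⟨s, hs, hs0, hsf⟩ := exists_fill hsub hinv hK κ hκ hac hacK n le_rfl
  refine ⟨fun l => ev α (s l), fun γ l => ?_, fun l hl => ?_, fun l hl hn => ?_⟩
  · show ev α (s _) = c γ * ev α (s l)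
    rw [hs, ev_mp, show (fun m : List W => α (m.map (γ • ·))) = c γ • α from funext fun m => hα γ m,
      ev_smul]
  · simp only [hs0 l hl, map_zero]
  · obtain ⟨h1, h2⟩ := bd_sub_lin hsub hl hn fun x hx hxm => hsf x hx hxm.le
    have := hrel _ h1 h2
    rw [map_sub, ev_single, one_mul, ev_lin, sub_eq_zero] at this
    exact this.symm

end Filling

end SpTop

namespace SpTop

open Matrix

variable {n : ℕ}

instance : MulAction (symplecticGroup (Fin n) ℤ) (Fin n ⊕ Fin n → ℤ) where
  smul γ v := γ.1 *ᵥ v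
  one_smul v := Matrix.one_mulVec v
  mul_smul γ γ' v := (Matrix.mulVec_mulVec v γ.1 γ'.1).symm

lemma smul_vec (γ : symplecticGroup (Fin n) ℤ) (v : Fin n ⊕ Fin n → ℤ) : γ • v = γ.1 *ᵥ v := rfl

lemma smul_vec_eq_zero (γ : symplecticGroup (Fin n) ℤ) (v : Fin n ⊕ Fin n → ℤ) :
    γ • v = 0 ↔ v = 0 :=
  ⟨fun h => mulVec_eq_zero_of_isUnit (isUnit_det_of_symp γ.2) v h, fun h => by
    rw [h, smul_vec, Matrix.mulVec_zero]⟩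

/-- The horoball-like neighbourhoods attached to nonzero vectors. -/
def Uv (ε : ℝ) (v : Fin n ⊕ Fin n → ℤ) : Set (SE n) :=
  {p | p ∈ siegel n ∧ v ≠ 0 ∧ qf p (vR v) ≤ ε}

lemma mem_Uv_smul {ε : ℝ} {γ : symplecticGroup (Fin n) ℤ} {p q : SE n} (hq : q ∈ siegel n)
    (hpq : ∀ v, qf q (toR γ.1 *ᵥ v) = qf p v) {v : Fin n ⊕ Fin n → ℤ} (hp : p ∈ Uv ε v) :
    q ∈ Uv ε (γ • v) := by
  refine ⟨hq, fun h => hp.2.1 ((smul_vec_eq_zero γ v).1 h), ?_⟩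
  rw [smul_vec, toR_mulVec', hpq]
  exact hp.2.2

variable (n) in
/-- The vertices of the augmented covering. -/
abbrev Wc (b : ℤ) := Yc n b ⊕ (Fin n ⊕ Fin n → ℤ)

/-- The pieces of the augmented covering. -/
def Vh (ε : ℝ) {b : ℤ} : Wc n b → Set (SE n) := Sum.elim Vy (Uv ε)

variable (n) in
/-- The nerve of the augmented covering. -/
def Nh (b : ℤ) (ε : ℝ) : Set (List (Wc n b)) := Nv False (Vh ε) Set.univ (siegel n)

lemma Nh_sub {b : ℤ} {ε : ℝ} : ∀ l ∈ Nh n b ε, ∀ l' : List (Wc n b), (∀ a ∈ l', a ∈ l) →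
    l' ∈ Nh n b ε := fun _ hl _ h =>
  ⟨False.elim, fun _ _ => Set.mem_univ _, let ⟨p, hp, h2⟩ := hl.2.2
    ⟨p, hp, fun a ha => h2 a (h a ha)⟩⟩

lemma Nh_inv {b : ℤ} {ε : ℝ} (γ : symplecticGroup (Fin n) ℤ) :
    ∀ l ∈ Nh n b ε, l.map (γ • ·) ∈ Nh n b ε := by
  intro l h
  obtain ⟨h1, -, p, hp, h2⟩ := h
  obtain ⟨q, hq, hpq⟩ := exists_act (toR_mem γ.2) hp
  refine ⟨False.elim, by simp, q, hq, fun a ha => ?_⟩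
  obtain ⟨a, ha', rfl⟩ := List.mem_map.1 ha
  have := h2 a ha'
  rcases a with a | v
  · exact mem_Vy_smul hq hpq this
  · exact mem_Uv_smul hq hpq this

lemma vecMulVec_sum_mulVec {ι : Type*} [Fintype ι] (l : List (ι → ℝ)) (x : ι → ℝ) :
    (l.map fun v => vecMulVec v v).sum *ᵥ x = (l.map fun v => (v ⬝ᵥ x) • v).sum := by
  induction l with
  | nil => simp
  | cons a l ih =>
    simp only [List.map_cons, List.sum_cons, Matrix.add_mulVec, ih, Matrix.vecMulVec_mulVec]
    simp

lemma dot_vecMulVec_sum {ι : Type*} [Fintype ι] (l : List (ι → ℝ)) (x : ι → ℝ) :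
    x ⬝ᵥ ((l.map fun v => vecMulVec v v).sum *ᵥ x) = (l.map fun v => (v ⬝ᵥ x) ^ 2).sum := by
  rw [vecMulVec_sum_mulVec]
  induction l with
  | nil => simp
  | cons a l ih =>
    simp only [List.map_cons, List.sum_cons, dotProduct_add, ih, dotProduct_smul, smul_eq_mul]
    rw [dotProduct_comm x a]
    ring

/-- Points of the Siegel space at which finitely many orthogonal vectors are short. -/
lemma exists_short (l : List (Fin n ⊕ Fin n → ℝ)) (hl : ∀ v ∈ l, ∀ w ∈ l, om n ℝ v w = 0) {ε : ℝ}
    (hε : 0 < ε) : ∃ p ∈ siegel n, ∀ v ∈ l, qf p v ≤ ε := by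
  set S : Matrix (Fin n ⊕ Fin n) (Fin n ⊕ Fin n) ℝ := (l.map fun v => vecMulVec v v).sum with hS
  set t : ℝ := ε⁻¹ with ht
  have ht0 : 0 < t := inv_pos.2 hε
  have hsq : ∀ x, 0 ≤ x ⬝ᵥ (S *ᵥ x) := fun x => by
    rw [hS, dot_vecMulVec_sum]
    exact List.sum_nonneg fun y hy => by
      obtain ⟨v, -, rfl⟩ := List.mem_map.1 hy
      positivity
  have hST : Sᵀ = S := by
    rw [hS, Matrix.transpose_list_sum, List.map_map]
    congr 1
    refine List.map_congr_left fun v _ => ?_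
    simp [Matrix.transpose_vecMulVec]
  set j := J (Fin n) ℝ with hj
  have hjj : j * j = -1 := J_squared (Fin n) ℝ
  have hjT : jᵀ = -j := J_transpose (Fin n) ℝ
  have hjS : ∀ v ∈ l, S *ᵥ (j *ᵥ v) = 0 := fun v hv => by
    rw [hS, vecMulVec_sum_mulVec]
    refine List.sum_eq_zero fun x hx => ?_
    obtain ⟨w, hw, rfl⟩ := List.mem_map.1 hx
    rw [← om_apply, hl w hw v hv, zero_smul]
  have hSJS : S * j * S = 0 := by
    refine Matrix.ext_of_mulVec_single fun i => ?_
    rw [← Matrix.mulVec_mulVec, ← Matrix.mulVec_mulVec, Matrix.zero_mulVec, hS,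
      vecMulVec_sum_mulVec l (Pi.single i 1), ← hS]
    have : ∀ m : List (Fin n ⊕ Fin n → ℝ), (∀ v ∈ m, v ∈ l) → S *ᵥ (j *ᵥ
        (m.map fun v => (v ⬝ᵥ (Pi.single i 1 : Fin n ⊕ Fin n → ℝ)) • v).sum) = 0 := by
      intro m hm
      induction m with
      | nil => simp
      | cons a m ih =>
        rw [List.map_cons, List.sum_cons, Matrix.mulVec_add, Matrix.mulVec_add,
          Matrix.mulVec_smul, Matrix.mulVec_smul, hjS a (hm a (by simp)), smul_zero, zero_add,
          ih fun v hv => hm v (List.mem_cons_of_mem _ hv)]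
    exact this l fun _ h => h
  have hA : PD (1 + t • S) := by
    refine ⟨by simp [hST], fun x hx => ?_⟩
    rw [Matrix.add_mulVec, Matrix.one_mulVec, dotProduct_add, Matrix.smul_mulVec,
      dotProduct_smul, smul_eq_mul]
    have h1 : 0 < x ⬝ᵥ x := by
      refine lt_of_le_of_ne (Finset.sum_nonneg fun i _ => mul_self_nonneg _) fun h => hx ?_
      exact dotProduct_self_eq_zero.1 h.symm
    have := hsq x
    positivity
  set A := 1 + t • S with hAdef
  have hAu := hA.isUnit_det
  have hjSj : ∀ x, x ⬝ᵥ ((-(j * S * j)) *ᵥ x) = (j *ᵥ x) ⬝ᵥ (S *ᵥ (j *ᵥ x)) := fun x => by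
    rw [Matrix.neg_mulVec, ← Matrix.mulVec_mulVec, ← Matrix.mulVec_mulVec, dotProduct_neg,
      Matrix.dotProduct_mulVec, ← Matrix.mulVec_transpose, hjT, Matrix.neg_mulVec,
      neg_dotProduct, neg_neg]
  have hQ : PD (A⁻¹ + t • -(j * S * j)) := by
    refine ⟨?_, fun x hx => ?_⟩
    · rw [Matrix.transpose_add, hA.inv.symm, Matrix.transpose_smul, Matrix.transpose_neg,
        Matrix.transpose_mul, Matrix.transpose_mul, hST, hjT]
      simp [Matrix.mul_assoc]
    · rw [Matrix.add_mulVec, dotProduct_add, Matrix.smul_mulVec, dotProduct_smul, smul_eq_mul,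
        hjSj]
      have := hA.inv.pos x hx
      have := hsq (j *ᵥ x)
      positivity
  have hQJ : (A⁻¹ + t • -(j * S * j)) * j * (A⁻¹ + t • -(j * S * j)) = j := by
    have h1 : j * (j * S * j) = -(S * j) := by
      rw [← Matrix.mul_assoc, ← Matrix.mul_assoc, hjj]; simp
    have h2 : (j * S * j) * j = -(j * S) := by
      rw [Matrix.mul_assoc, hjj]; simp
    have h3 : A * j * A = j + t • (S * j + j * S) := by
      have h4 : S * (j * S) = 0 := by rw [← Matrix.mul_assoc, hSJS]
      simp only [hAdef, add_mul, mul_add, one_mul, mul_one, smul_mul_assoc, mul_smul_comm,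
        Matrix.mul_assoc, h4, smul_zero, add_zero, smul_add]
      abel
    have h5 : A * (j * S) = j * S := by
      rw [hAdef, add_mul, one_mul, smul_mul_assoc, ← Matrix.mul_assoc, hSJS, smul_zero, add_zero]
    have h6 : (S * j) * A = S * j := by
      rw [hAdef, mul_add, mul_one, mul_smul_comm, hSJS, smul_zero, add_zero]
    have h7 : j * S * (j * S * j) = 0 := by
      rw [show j * S * (j * S * j) = j * (S * j * S) * j by
        simp only [Matrix.mul_assoc], hSJS]
      simp
    have h8 : (A⁻¹ + t • -(j * S * j)) * j * (A⁻¹ + t • -(j * S * j)) =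
        A⁻¹ * j * A⁻¹ + t • (A⁻¹ * (S * j) + (j * S) * A⁻¹) := by
      have e1 : A⁻¹ * j * (j * S * j) = -(A⁻¹ * (S * j)) := by
        rw [Matrix.mul_assoc, h1, mul_neg]
      simp only [add_mul, mul_add, smul_mul_assoc, mul_smul_comm, neg_mul, mul_neg, h7, h2, e1,
        neg_neg, smul_add, smul_zero, add_zero]
      abel
    have h9 : A * (A⁻¹ * j * A⁻¹ + t • (A⁻¹ * (S * j) + (j * S) * A⁻¹)) * A = A * j * A := by
      have c1 : A * A⁻¹ = 1 := Matrix.mul_nonsing_inv A hAu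
      have c2 : A⁻¹ * A = 1 := Matrix.nonsing_inv_mul A hAu
      rw [h3]
      simp only [mul_add, add_mul, mul_smul_comm, smul_mul_assoc, smul_add]
      rw [show A * (A⁻¹ * j * A⁻¹) * A = (A * A⁻¹) * j * (A⁻¹ * A) by
        simp only [Matrix.mul_assoc], show A * (A⁻¹ * (S * j)) * A = (A * A⁻¹) * ((S * j) * A) by
        simp only [Matrix.mul_assoc], show A * (j * S * A⁻¹) * A = (A * (j * S)) * (A⁻¹ * A) by
        simp only [Matrix.mul_assoc], c1, c2, h5, h6]
      simp
    rw [h8]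
    have c1 : A * A⁻¹ = 1 := Matrix.mul_nonsing_inv A hAu
    have c2 : A⁻¹ * A = 1 := Matrix.nonsing_inv_mul A hAu
    have h10 := congrArg (fun X => A⁻¹ * X * A⁻¹) h9
    have h11 : ∀ X : Matrix (Fin n ⊕ Fin n) (Fin n ⊕ Fin n) ℝ, A⁻¹ * (A * X * A) * A⁻¹ = X := by
      intro X
      rw [show A⁻¹ * (A * X * A) * A⁻¹ = (A⁻¹ * A) * X * (A * A⁻¹) by
        simp only [Matrix.mul_assoc], c1, c2]
      simp
    rwa [h11, h11] at h10
  obtain ⟨p, hp, hpQ⟩ := exists_qm hQ hQJ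
  refine ⟨p, hp, fun v hv => ?_⟩
  rw [qf, hpQ, Matrix.add_mulVec, dotProduct_add, Matrix.smul_mulVec, dotProduct_smul, hjSj,
    hjS v hv, dotProduct_zero, smul_zero, add_zero]
  set x := A⁻¹ *ᵥ v with hx
  have hAx : A *ᵥ x = v := by
    rw [hx, Matrix.mulVec_mulVec, Matrix.mul_nonsing_inv A hAu, Matrix.one_mulVec]
  have h1 : t * (v ⬝ᵥ x) ^ 2 ≤ v ⬝ᵥ x := by
    have h2 : v ⬝ᵥ x = x ⬝ᵥ x + t * (x ⬝ᵥ (S *ᵥ x)) := by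
      conv_lhs => rw [dotProduct_comm, ← hAx, hAdef]
      rw [Matrix.add_mulVec, Matrix.one_mulVec, dotProduct_add, Matrix.smul_mulVec,
        dotProduct_smul, smul_eq_mul]
    have h3 : (v ⬝ᵥ x) ^ 2 ≤ x ⬝ᵥ (S *ᵥ x) := by
      rw [hS, dot_vecMulVec_sum]
      refine List.single_le_sum (fun y hy => ?_) _
        (List.mem_map_of_mem (f := fun v => (v ⬝ᵥ x) ^ 2) hv)
      obtain ⟨v, -, rfl⟩ := List.mem_map.1 hy
      positivity
    have h4 : 0 ≤ x ⬝ᵥ x := Finset.sum_nonneg fun i _ => mul_self_nonneg _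
    nlinarith
  by_contra! h
  have h2 : 1 < t * (v ⬝ᵥ x) := by
    have := mul_lt_mul_of_pos_left h ht0
    rwa [ht, inv_mul_cancel₀ hε.ne'] at this
  nlinarith

lemma map_inr_mem_Nh {b : ℤ} {ε : ℝ} (hε : 0 < ε) (hε1 : ε < 1) {l : List (Fin n ⊕ Fin n → ℤ)} :
    l.map Sum.inr ∈ Nh n b ε ↔ l ∈ Orth (om n ℤ) (nz ⊤) l.length := by
  constructor
  · rintro ⟨-, -, p, hp, h⟩
    have h' : ∀ v ∈ l, p ∈ Uv ε v := fun v hv => h _ (List.mem_map_of_mem hv)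
    refine ⟨rfl, fun v hv => ⟨⟨trivial, (h' v hv).2.1⟩, fun w hw => ?_⟩⟩
    have h1 := om_sq_le hp (vR v) (vR w)
    have h2 : qf p (vR v) * qf p (vR w) ≤ ε * ε :=
      mul_le_mul (h' v hv).2.2 (h' w hw).2.2 ((pd_qm hp).nonneg _) hε.le
    rw [om_vR] at h1
    have h3 : ((om n ℤ v w : ℤ) : ℝ) ^ 2 < 1 := by nlinarith
    have h4 : (om n ℤ v w) ^ 2 < 1 := by exact_mod_cast h3
    by_contra h5
    have := Int.one_le_abs h5
    have := sq_abs (om n ℤ v w)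
    nlinarith
  · rintro ⟨-, h⟩
    obtain ⟨p, hp, hpv⟩ := exists_short (l.map vR) (by
      intro v hv w hw
      obtain ⟨v, hv', rfl⟩ := List.mem_map.1 hv
      obtain ⟨w, hw', rfl⟩ := List.mem_map.1 hw
      rw [om_vR, (h v hv').2 w hw', Int.cast_zero]) hε
    refine ⟨False.elim, fun _ _ => Set.mem_univ _, p, hp, fun a ha => ?_⟩
    obtain ⟨v, hv, rfl⟩ := List.mem_map.1 ha
    exact ⟨hp, (h v hv).1.2, hpv _ (List.mem_map_of_mem hv)⟩

end SpTop

namespace SpTop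

open Matrix

variable {n : ℕ}

lemma ev_eq_zero {A : Type*} {f : List A → ℚ} {s : Set (List A)} (h : ∀ l ∈ s, f l = 0)
    {z : List A →₀ ℚ} (hz : z ∈ Finsupp.supported ℚ ℚ s) : ev f z = 0 := by
  have := map_mem_of_supported (N := (⊥ : Submodule ℚ ℚ)) (ev f) (fun l hl => by simp [h l hl]) hz
  simpa using this

lemma mp_mp {A B C : Type*} (r : A → B) (r' : B → C) (z : List A →₀ ℚ) :
    mp r' (mp r z) = mp (r' ∘ r) z := by
  induction z using Finsupp.induction_linear with
  | zero => simp
  | add x y hx hy => simp only [map_add, hx, hy]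
  | single l c => simp

lemma mp_eq_self {A : Type*} {r : A → A} {z : List A →₀ ℚ}
    (h : ∀ l ∈ z.support, l.map r = l) : mp r z = z := by
  have : mp r z = Finsupp.mapDomain (List.map r) z := rfl
  rw [this, Finsupp.mapDomain_congr (g := id) h, Finsupp.mapDomain_id]

theorem Nh_acyclic {b : ℤ} {ε : ℝ} (hcov : ∀ p ∈ siegel n, ∃ a : Yc n b, p ∈ Vy a) (j : ℕ)
    (z : List (Wc n b) →₀ ℚ) (hz : z ∈ Ch (Nh n b ε) Set.univ j) (hbd : bd z = 0) :
    ∃ w ∈ Ch (Nh n b ε) Set.univ (j + 1), bd w = z := by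
  classical
  rcases eq_or_ne z 0 with rfl | hz0
  · exact ⟨0, Submodule.zero_mem _, map_zero _⟩
  have hz' : ∀ l ∈ z.support, l.length = j ∧ l ∈ Nh n b ε := fun l hl =>
    have := (Finsupp.mem_supported ℚ z).1 hz hl
    ⟨this.1, this.2.1⟩
  have hpt : ∀ l ∈ z.support, ∃ p ∈ siegel n, ∀ a ∈ l, p ∈ Vh ε a := fun l hl => (hz' l hl).2.2.2
  choose! p hp hpV using hpt
  choose R hR0 hR using fun p : SE n => exists_qf_le p
  set Z : Set (SE n) := convexHull ℝ (p '' (z.support : Set (List (Wc n b)))) with hZ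
  have hZs : Z ⊆ siegel n := convexHull_min (by
    rintro _ ⟨l, hl, rfl⟩
    exact hp l hl) convex_siegel
  have hpZ : ∀ l ∈ z.support, p l ∈ Z := fun l hl => subset_convexHull ℝ _ ⟨l, hl, rfl⟩
  have hZc : IsCompact Z :=
    (z.support.finite_toSet.image p).isCompact_convexHull (𝕜 := ℝ)
  obtain ⟨l₀, hl₀⟩ := Finsupp.support_nonempty_iff.2 hz0
  have hRZ : ∀ q ∈ Z, ∀ v, qf q v ≤ (∑ l ∈ z.support, R (p l)) * (v ⬝ᵥ v) := by
    intro q hq v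
    have : Z ⊆ {q | q ∈ siegel n ∧ qf q v ≤ (∑ l ∈ z.support, R (p l)) * (v ⬝ᵥ v)} := by
      refine convexHull_min ?_ (convex_qf _ _)
      rintro _ ⟨l, hl, rfl⟩
      refine ⟨hp l hl, (hR (p l) v).trans (mul_le_mul_of_nonneg_right ?_ ?_)⟩
      · exact Finset.single_le_sum (f := fun l => R (p l)) (fun l _ => (hR0 _).le) hl
      · exact Finset.sum_nonneg fun i _ => mul_self_nonneg _
    exact (this hq).2
  have hfin : {a : Yc n b | (Z ∩ Vy a).Nonempty}.Finite := by
    have h1 := finite_meet (M := 1) (by simp) b hRZ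
    refine (h1.preimage Subtype.val_injective.injOn).subset fun a ha => ⟨a.2, ?_⟩
    rw [one_mul]
    exact ha
  set F : Set (Wc n b) := Sum.inl '' {a : Yc n b | (Z ∩ Vy a).Nonempty} ∪
    ⋃ l ∈ z.support, {a | a ∈ l} with hF
  have hFf : F.Finite := (hfin.image _).union
    (z.support.finite_toSet.biUnion fun l _ => List.finite_toSet l)
  have : Finite F := hFf
  have hcovF : ∀ x ∈ Z, ∃ a : F, x ∈ Vh ε a.1 ∩ Z := fun x hx => by
    obtain ⟨a, ha⟩ := hcov x (hZs hx)
    exact ⟨⟨Sum.inl a, Or.inl ⟨a, ⟨x, hx, ha⟩, rfl⟩⟩, ha, hx⟩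
  obtain ⟨f₀, -⟩ := hcovF _ (hpZ l₀ hl₀)
  let ρ : Wc n b → F := fun a => if h : a ∈ F then ⟨a, h⟩ else f₀
  have hρ : ∀ a ∈ F, (ρ a).1 = a := fun a ha => by simp [ρ, ha]
  have hlF : ∀ l ∈ z.support, ∀ a ∈ l, a ∈ F := fun l hl a ha =>
    Or.inr (Set.mem_biUnion (t := fun l : List (Wc n b) => {a | a ∈ l}) hl ha)
  have hconv : ∀ a : F, Convex ℝ (Vh ε a.1 ∩ Z) := by
    rintro ⟨a | v, -⟩
    · exact (convex_Vr _ _).inter (convex_convexHull ℝ _)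
    · refine Convex.inter ?_ (convex_convexHull ℝ _)
      by_cases hv : v = 0
      · convert convex_empty (𝕜 := ℝ) (E := SE n)
        ext q
        simp [Vh, Uv, hv]
      · convert convex_qf (vR v) ε using 1
        ext q
        simp [Vh, Uv, hv]
  have hclosed : ∀ a : F, IsClosed (Vh ε a.1 ∩ Z) := by
    rintro ⟨a | v, -⟩
    · exact (isClosed_Vr (isUnit_det_cast a.2.1) _).inter hZc.isClosed
    · by_cases hv : v = 0
      · convert isClosed_empty (X := SE n)
        ext q
        simp [Vh, Uv, hv]
      · have : Vh ε (Sum.inr v : Wc n b) ∩ Z = (⋂ w, {q | aff (vR v) w q ≤ ε}) ∩ Z := by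
          ext q
          simp only [Vh, Uv, Sum.elim_inr, Set.mem_inter_iff, Set.mem_iInter, Set.mem_ofPred_eq]
          constructor
          · rintro ⟨⟨h1, -, h2⟩, h3⟩
            exact ⟨(qf_le_iff h1 _ _).1 h2, h3⟩
          · rintro ⟨h1, h2⟩
            exact ⟨⟨hZs h2, hv, (qf_le_iff (hZs h2) _ _).2 h1⟩, h2⟩
        change IsClosed (Vh ε (Sum.inr v : Wc n b) ∩ Z)
        rw [this]
        exact (isClosed_iInter fun w => isClosed_le (continuous_aff _ _) continuous_const).inter
          hZc.isClosed
  obtain ⟨w, hw, hwz⟩ := acyclic_chains hconv hclosed (convex_convexHull ℝ _) hZc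
    ⟨_, hpZ l₀ hl₀⟩ hcovF (mp ρ z) j (by
      have : mp ρ z ∈ Finsupp.supported ℚ ℚ {l : List F | l.length = j ∧
          l ∈ Nv False (fun a : F => Vh ε a.1 ∩ Z) Set.univ Z} := by
        refine mp_mem (s := z.support) (fun l hl => ?_) ((Finsupp.mem_supported ℚ z).2 subset_rfl)
        refine ⟨?_, False.elim, by simp, p l, hpZ l hl, ?_⟩
        · rw [List.length_map]
          exact (hz' l hl).1
        · intro a ha
          obtain ⟨a', ha', rfl⟩ := List.mem_map.1 ha
          refine ⟨?_, hpZ l hl⟩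
          rw [hρ a' (hlF l hl a' ha')]
          exact hpV l hl a' ha'
      exact fun l hl => (Finsupp.mem_supported ℚ _).1 this hl)
    (by rw [← mp_bd, hbd, map_zero])
  refine ⟨mp Subtype.val w, mp_mem (s := w.support) (fun l hl => ?_)
    ((Finsupp.mem_supported ℚ w).2 subset_rfl), ?_⟩
  · obtain ⟨h1, -, -, q, hq, h2⟩ := hw l hl
    refine ⟨by simpa using h1, ⟨False.elim, by simp, q, hZs hq, fun a ha => ?_⟩, by simp⟩
    obtain ⟨a', ha', rfl⟩ := List.mem_map.1 ha
    exact (h2 a' ha').1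
  · rw [← mp_bd, hwz, mp_mp]
    refine mp_eq_self fun l hl => ?_
    conv_rhs => rw [← List.map_id l]
    exact List.map_congr_left fun a ha => hρ a (hlF l hl a ha)

variable (n) in
/-- The vertices of the augmented covering given by vectors. -/
def Kc (b : ℤ) : Set (Wc n b) := Set.range Sum.inr

lemma Kc_smul {b : ℤ} (γ : symplecticGroup (Fin n) ℤ) (a : Wc n b) :
    γ • a ∈ Kc n b ↔ a ∈ Kc n b := by
  rcases a with a | v
  · simp [Kc, Sum.smul_inl]
  · simp [Kc, Sum.smul_inr]

lemma mp_inr_mem {b : ℤ} {ε : ℝ} (hε : 0 < ε) (hε1 : ε < 1) {q : ℕ}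
    {y : List (Fin n ⊕ Fin n → ℤ) →₀ ℚ} (hy : y ∈ OC (om n ℤ) (nz ⊤) q) :
    mp (Sum.inr : _ → Wc n b) y ∈ Ch (Nh n b ε) (Kc n b) q :=
  mp_mem (fun l hl => by
    refine ⟨by simpa using hl.1, (map_inr_mem_Nh hε hε1).2 (hl.1 ▸ hl), fun a ha => ?_⟩
    obtain ⟨v, -, rfl⟩ := List.mem_map.1 ha
    exact ⟨v, rfl⟩) hy

lemma exists_mp_inr {b : ℤ} {ε : ℝ} (hε : 0 < ε) (hε1 : ε < 1) {q : ℕ} {z : List (Wc n b) →₀ ℚ}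
    (hz : z ∈ Ch (Nh n b ε) (Kc n b) q) :
    ∃ y ∈ OC (om n ℤ) (nz ⊤) q, mp (Sum.inr : _ → Wc n b) y = z := by
  let r : Wc n b → (Fin n ⊕ Fin n → ℤ) := Sum.elim (fun _ => 0) id
  have hr : ∀ l : List (Wc n b), (∀ a ∈ l, a ∈ Kc n b) → (l.map r).map Sum.inr = l := by
    intro l hl
    rw [List.map_map]
    conv_rhs => rw [← List.map_id l]
    refine List.map_congr_left fun a ha => ?_
    obtain ⟨v, rfl⟩ := hl a ha
    rfl
  refine ⟨mp r z, mp_mem (fun l hl => ?_) hz, ?_⟩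
  · have h1 := hl.2.1
    rw [← hr l hl.2.2, map_inr_mem_Nh hε hε1, List.length_map, hl.1] at h1
    exact h1
  · rw [mp_mp]
    refine mp_eq_self fun l hl => ?_
    rw [← List.map_map]
    exact hr l ((Finsupp.mem_supported ℚ z).1 hz hl).2.2

lemma mp_injective {A B : Type*} {r : A → B} (hr : Function.Injective r) :
    Function.Injective (mp r) :=
  Finsupp.mapDomain_injective (List.map_injective_iff.2 hr)

theorem Kc_acyclic {b : ℤ} {ε : ℝ} (hε : 0 < ε) (hε1 : ε < 1) (q : ℕ) (hq : q < n)
    (z : List (Wc n b) →₀ ℚ) (hz : z ∈ Ch (Nh n b ε) (Kc n b) q) (hbd : bd z = 0) :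
    ∃ w ∈ Ch (Nh n b ε) (Kc n b) (q + 1), bd w = z := by
  obtain ⟨y, hy, rfl⟩ := exists_mp_inr hε hε1 hz
  have hby : bd y = 0 := mp_injective (r := (Sum.inr : _ → Wc n b)) Sum.inr_injective (by
    rw [mp_bd, hbd, map_zero])
  have h1 := building om_isAlt n ⊤ uni_top big_top q hq.le y hy hby
  have h2 : Tgt (om n ℤ) (nz ⊤) n q ≤ (OC (om n ℤ) (nz ⊤) (q + 1)).map bd :=
    Tgt.le (fun z hz => ⟨z, hz, rfl⟩) fun _ _ _ h => absurd h hq.ne'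
  obtain ⟨w, hw, hwy⟩ := h2 h1
  exact ⟨_, mp_inr_mem hε hε1 hw, by rw [← mp_bd, hwy]⟩

/-- Cocycles vanishing on lists of vectors vanish on cycles relative to lists of vectors. -/
theorem ev_rel_eq_zero (hn : 1 ≤ n) {b : ℤ} {ε : ℝ} (hε : 0 < ε) (hε1 : ε < 1)
    (hcov : ∀ p ∈ siegel n, ∃ a : Yc n b, p ∈ Vy a) {c : symplecticGroup (Fin n) ℤ → ℚ}
    (hc : ∀ v v', om n ℤ v v' = 1 → ∀ γ : symplecticGroup (Fin n) ℤ, γ.1 = rot v v' 0 1 → c γ ≠ -1)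
    {α : List (Wc n b) → ℚ}
    (hα : ∀ (γ : symplecticGroup (Fin n) ℤ) l, α (l.map (γ • ·)) = c γ * α l)
    (hαK : ∀ l ∈ Nh n b ε, l.length = n + 1 → (∀ a ∈ l, a ∈ Kc n b) → α l = 0)
    (hαc : ∀ l ∈ Nh n b ε, l.length = n + 2 → cob α l = 0)
    (z : List (Wc n b) →₀ ℚ) (hz : z ∈ Ch (Nh n b ε) Set.univ (n + 1))
    (hbd : bd z ∈ Ch (Nh n b ε) (Kc n b) n) : ev α z = 0 := by
  have hcyc : ∀ z ∈ Ch (Nh n b ε) Set.univ (n + 1), bd z = 0 → ev α z = 0 := by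
    intro z hz hbd
    obtain ⟨w, hw, rfl⟩ := Nh_acyclic hcov _ z hz hbd
    rw [ev_bd]
    exact ev_eq_zero (fun l hl => hαc l hl.2.1 hl.1) hw
  have hKu : ∀ q, Ch (Nh n b ε) (Kc n b) q ≤ Ch (Nh n b ε) Set.univ q := fun q =>
    Finsupp.supported_mono fun l hl => show _ ∧ _ from ⟨hl.1, hl.2.1, fun _ _ => Set.mem_univ _⟩
  have hK0 : ∀ y ∈ OC (om n ℤ) (nz ⊤) (n + 1), ev α (mp (Sum.inr : _ → Wc n b) y) = 0 :=
    fun y hy => ev_eq_zero (fun l hl => hαK l hl.2.1 hl.1 hl.2.2) (mp_inr_mem hε hε1 hy)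
  let M : Submodule ℚ (List (Fin n ⊕ Fin n → ℤ) →₀ ℚ) :=
    ((Ch (Nh n b ε) Set.univ (n + 1) ⊓ LinearMap.ker (ev α)).map bd).comap
      (mp (Sum.inr : _ → Wc n b))
  have hM : Tgt (om n ℤ) (nz ⊤) n n ≤ M := by
    refine Tgt.le (fun y hy => ?_) fun s hs hsn _ => ?_
    · exact ⟨mp Sum.inr y, ⟨hKu _ (mp_inr_mem hε hε1 hy), hK0 y hy⟩, (mp_bd _ _).symm⟩
    · rcases s with _ | ⟨p, s⟩
      · rw [List.length_nil] at hsn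
        omega
      have hA : apt (p :: s) ∈ OC (om n ℤ) (nz ⊤) n :=
        (congrArg (apt (p :: s) ∈ OC (om n ℤ) (nz ⊤) ·) hsn).mp (hs.apt_mem om_self)
      obtain ⟨z, hz, hzA⟩ := Nh_acyclic hcov n _ (hKu _ (mp_inr_mem hε hε1 hA))
        (by rw [← mp_bd, bd_apt, map_zero])
      obtain ⟨y, hy, hyA⟩ := exists_rotation hs
      have hsl : s.length + 2 = n + 1 := congrArg (· + 1) hsn
      rw [hsl] at hy
      have hp := (hs.1 p (by simp)).2.2
      let γ : symplecticGroup (Fin n) ℤ := ⟨rot p.1 p.2 0 1, rot_mem hp (by norm_num)⟩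
      have hγz : mp (γ • ·) z ∈ Ch (Nh n b ε) Set.univ (n + 1) := Ch.mp Nh_inv (by simp) hz γ
      have hγA : bd (mp (γ • ·) z) =
          mp (Sum.inr : _ → Wc n b) (mp (fun x => rot p.1 p.2 0 1 *ᵥ x) (apt (p :: s))) := by
        rw [← mp_bd, hzA, mp_mp, mp_mp]
        rfl
      have h0 := hcyc (z + mp (γ • ·) z - mp Sum.inr y)
        (Submodule.sub_mem _ (Submodule.add_mem _ hz hγz) (hKu _ (mp_inr_mem hε hε1 hy)))
        (by rw [map_sub, map_add, hzA, hγA, ← map_add, ← hyA, ← mp_bd, sub_self])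
      rw [map_sub, map_add, hK0 y hy, sub_zero, ev_mp,
        show (fun m : List (Wc n b) => α (m.map (γ • ·))) = c γ • α from funext fun m => hα γ m,
        ev_smul] at h0
      have h1 : (1 + c γ) * ev α z = 0 := by linarith
      have h2 : 1 + c γ ≠ 0 := fun h => hc _ _ hp γ rfl (by linarith)
      exact ⟨z, ⟨hz, (mul_eq_zero.1 h1).resolve_left h2⟩, hzA⟩
  obtain ⟨y, hy, hyz⟩ := exists_mp_inr hε hε1 hbd
  have hby : bd y = 0 := mp_injective (r := (Sum.inr : _ → Wc n b)) Sum.inr_injective (by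
    rw [mp_bd, hyz, bd_bd, map_zero])
  obtain ⟨z₁, ⟨hz₁, hz₁α⟩, hz₁b⟩ := hM (building om_isAlt n ⊤ uni_top big_top n le_rfl y hy hby)
  have := hcyc (z - z₁) (Submodule.sub_mem _ hz hz₁) (by rw [map_sub, hz₁b, hyz, sub_self])
  rw [map_sub, LinearMap.mem_ker.1 hz₁α, sub_zero] at this
  exact this

end SpTop

namespace SpTop

open Matrix

variable {n : ℕ}

lemma exists_om_col_ne_zero {g : Matrix (Fin n ⊕ Fin n) (Fin n ⊕ Fin n) ℤ} (hg : IsUnit g.det)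
    {v : Fin n ⊕ Fin n → ℤ} (hv : v ≠ 0) : ∃ i, om n ℤ v (g.col i) ≠ 0 := by
  by_contra! h
  refine hv ?_
  have hu : IsUnit ((J (Fin n) ℤ * g)ᵀ).det := by
    rw [Matrix.det_transpose, Matrix.det_mul]
    exact (isUnit_det_J (Fin n) ℤ).mul hg
  refine mulVec_eq_zero_of_isUnit hu v ?_
  funext i
  rw [Matrix.mulVec_transpose]
  have := h i
  rw [om_apply] at this
  rw [Pi.zero_apply, ← this]
  rfl

lemma col_ne_zero {g : Matrix (Fin n ⊕ Fin n) (Fin n ⊕ Fin n) ℤ} (hg : IsUnit g.det)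
    (i : Fin n ⊕ Fin n) : g.col i ≠ 0 := fun h => by
  rw [Matrix.det_eq_zero_of_column_eq_zero i fun j => congrFun h j] at hg
  exact not_isUnit_zero hg

lemma one_le_of_mem_Vy {b : ℤ} {a : Yc n b} {p : SE n} (hp : p ∈ Vy a) {v : Fin n ⊕ Fin n → ℤ}
    (hv : v ≠ 0) : ∃ i, 1 ≤ qf p (vR v) * 2 ^ a.1.lev i := by
  obtain ⟨i, hi⟩ := exists_om_col_ne_zero a.2.1 hv
  refine ⟨i, ?_⟩
  have h1 := om_sq_le hp.1 (vR v) (vR (a.1.mat.col i))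
  rw [om_vR] at h1
  have h2 : (1 : ℤ) ≤ (om n ℤ v (a.1.mat.col i)) ^ 2 := by
    have := pow_pos (abs_pos.2 hi) 2
    rw [sq_abs] at this
    omega
  have h3 : (1 : ℝ) ≤ ((om n ℤ v (a.1.mat.col i) : ℤ) : ℝ) ^ 2 := by exact_mod_cast h2
  exact (h3.trans h1).trans
    (mul_le_mul_of_nonneg_left (hp.2 i) ((pd_qm hp.1).nonneg _))

/-- The neighbourhoods of vectors can be chosen to avoid finitely many orbits of pieces. -/
lemma exists_eps {b : ℤ} {I : Set (Yc n b)} (hI : I.Finite) : ∃ ε : ℝ, 0 < ε ∧ ε < 1 ∧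
    ∀ a : Yc n b, (∃ γ : symplecticGroup (Fin n) ℤ, γ • a ∈ I) → ∀ v, Disjoint (Vy a) (Uv ε v) := by
  obtain ⟨C, hC⟩ := ((hI.prod (Set.finite_univ (α := Fin n ⊕ Fin n))).image
    fun x : Yc n b × (Fin n ⊕ Fin n) => (2 : ℝ) ^ x.1.1.lev x.2).bddAbove
  have hC' : ∀ a ∈ I, ∀ i, (2 : ℝ) ^ a.1.lev i ≤ C := fun a ha i =>
    hC ⟨(a, i), ⟨ha, trivial⟩, rfl⟩
  have h2 : 0 < 2 + |C| := by positivity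
  refine ⟨(2 + |C|)⁻¹, by positivity, inv_lt_one_of_one_lt₀ (by linarith [abs_nonneg C]), ?_⟩
  rintro a ⟨γ, hγ⟩ v
  rw [Set.disjoint_left]
  rintro p hp ⟨-, hv, hpv⟩
  obtain ⟨i, hi⟩ := one_le_of_mem_Vy hp hv
  have h3 := hC' _ hγ i
  rw [smul_lev] at h3
  have h4 : qf p (vR v) * 2 ^ a.1.lev i ≤ (2 + |C|)⁻¹ * |C| :=
    mul_le_mul hpv (h3.trans (le_abs_self C)) (by positivity) (by positivity)
  have h5 : (2 + |C|)⁻¹ * |C| < 1 := by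
    rw [inv_mul_lt_iff₀ h2]
    linarith
  linarith

/-- The levels and the Gram matrix of a frame. -/
noncomputable def gram {b : ℤ} (a : Yc n b) :
    (Fin n ⊕ Fin n → ℤ) × (Fin n ⊕ Fin n → Fin n ⊕ Fin n → ℤ) :=
  (a.1.lev, fun i j => om n ℤ (a.1.mat.col i) (a.1.mat.col j))

lemma exists_smul_of_gram_eq {b : ℤ} {a a' : Yc n b} (h : gram a = gram a') :
    ∃ γ : symplecticGroup (Fin n) ℤ, γ • a = a' := by
  have hg : a.1.matᵀ * J (Fin n) ℤ * a.1.mat = a'.1.matᵀ * J (Fin n) ℤ * a'.1.mat := by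
    ext i j
    have h1 := congrFun (congrFun (congrArg Prod.snd h) i) j
    simp only [gram, om_apply] at h1
    rw [Matrix.mul_assoc, Matrix.mul_assoc]
    exact h1
  refine ⟨⟨a'.1.mat * a.1.mat⁻¹, ?_⟩, Subtype.ext (Vx.ext ?_ (congrArg Prod.fst h))⟩
  · rw [SymplecticGroup.mem_iff']
    have h2 : a.1.mat * a.1.mat⁻¹ = 1 := Matrix.mul_nonsing_inv _ a.2.1
    calc (a'.1.mat * a.1.mat⁻¹)ᵀ * J (Fin n) ℤ * (a'.1.mat * a.1.mat⁻¹)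
        = a.1.mat⁻¹ᵀ * (a'.1.matᵀ * J (Fin n) ℤ * a'.1.mat) * a.1.mat⁻¹ := by
          rw [Matrix.transpose_mul]
          simp only [Matrix.mul_assoc]
      _ = (a.1.mat * a.1.mat⁻¹)ᵀ * J (Fin n) ℤ * (a.1.mat * a.1.mat⁻¹) := by
          rw [← hg, Matrix.transpose_mul]
          simp only [Matrix.mul_assoc]
      _ = J (Fin n) ℤ := by rw [h2]; simp
  · rw [smul_mat, Matrix.mul_assoc, Matrix.nonsing_inv_mul _ a.2.1, Matrix.mul_one]

lemma gram_mem_Icc {b : ℤ} {ε : ℝ} (hε : 0 < ε) {a : Yc n b} (hne : (Vy a).Nonempty)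
    (h : ∀ i, ε < 2 ^ a.1.lev i) {K R : ℤ}
    (hK : K = |b| + Fintype.card (Fin n ⊕ Fin n) * |Int.log 2 ε|) (hR : (2 : ℝ) ^ K ≤ R) :
    gram a ∈ Set.Icc ((fun _ => -K, fun _ _ => -R) :
      (Fin n ⊕ Fin n → ℤ) × (Fin n ⊕ Fin n → Fin n ⊕ Fin n → ℤ)) (fun _ => K, fun _ _ => R) := by
  have hm : ∀ i, -|Int.log 2 ε| ≤ a.1.lev i := fun i => by
    have h1 : (2 : ℝ) ^ Int.log 2 ε < 2 ^ a.1.lev i :=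
      lt_of_le_of_lt (by exact_mod_cast Int.zpow_log_le_self (b := 2) one_lt_two hε) (h i)
    rw [zpow_lt_zpow_iff_right₀ one_lt_two] at h1
    have := neg_abs_le (Int.log 2 ε)
    omega
  have hb := le_abs_self b
  have hb0 := abs_nonneg b
  have hl0 := abs_nonneg (Int.log 2 ε)
  have hup : ∀ i, a.1.lev i ≤ K := fun i => by
    have h1 : a.1.lev i + |Int.log 2 ε| ≤ ∑ j, (a.1.lev j + |Int.log 2 ε|) :=
      Finset.single_le_sum (f := fun j => a.1.lev j + |Int.log 2 ε|)
        (fun j _ => by have := hm j; omega) (Finset.mem_univ i)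
    rw [Finset.sum_add_distrib, Finset.sum_const, Finset.card_univ, nsmul_eq_mul] at h1
    have := a.2.2
    linarith
  have hlo : ∀ i, -K ≤ a.1.lev i := fun i => by
    have hc : (1 : ℤ) ≤ Fintype.card (Fin n ⊕ Fin n) := by
      exact_mod_cast Fintype.card_pos_iff.2 ⟨i⟩
    have := hm i
    nlinarith
  obtain ⟨p, hp⟩ := hne
  have hgr : ∀ i j, |om n ℤ (a.1.mat.col i) (a.1.mat.col j)| ≤ R := fun i j => by
    have h1 := om_sq_le hp.1 (vR (a.1.mat.col i)) (vR (a.1.mat.col j))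
    rw [om_vR] at h1
    have h2 : ∀ i, qf p (vR (a.1.mat.col i)) ≤ 2 ^ K := fun i =>
      (hp.2 i).trans (zpow_le_zpow_right₀ one_le_two (hup i))
    have h3 : qf p (vR (a.1.mat.col i)) * qf p (vR (a.1.mat.col j)) ≤ 2 ^ K * 2 ^ K :=
      mul_le_mul (h2 i) (h2 j) ((pd_qm hp.1).nonneg _) (by positivity)
    have h4 := abs_le_of_sq_le_sq ((h1.trans h3).trans (sq _).ge) (by positivity)
    have h5 := h4.trans hR
    exact_mod_cast h5
  exact ⟨⟨hlo, fun i j => (abs_le.1 (hgr i j)).1⟩, hup, fun i j => (abs_le.1 (hgr i j)).2⟩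

/-- All but finitely many orbits of pieces lie in neighbourhoods of vectors. -/
lemma exists_finite_orbits (hn : 1 ≤ n) (b : ℤ) {ε : ℝ} (hε : 0 < ε) : ∃ I : Set (Yc n b),
    I.Finite ∧ ∀ a : Yc n b, (¬ ∃ v, Vy a ⊆ Uv ε v) →
      ∃ γ : symplecticGroup (Fin n) ℤ, γ • a ∈ I := by
  classical
  have i₀ : Fin n ⊕ Fin n := Sum.inl ⟨0, hn⟩
  obtain ⟨R, hR⟩ := exists_int_gt
    ((2 : ℝ) ^ (|b| + Fintype.card (Fin n ⊕ Fin n) * |Int.log 2 ε|))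
  have hfin : (gram '' {a : Yc n b | ¬ ∃ v, Vy a ⊆ Uv ε v}).Finite := by
    refine (Set.finite_Icc _ _).subset (Set.image_subset_iff.2 fun a ha =>
      gram_mem_Icc hε ?_ (fun i => ?_) rfl hR.le)
    · by_contra hne
      rw [Set.not_nonempty_iff_eq_empty] at hne
      exact ha ⟨a.1.mat.col i₀, by rw [hne]; exact Set.empty_subset _⟩
    · by_contra! hle
      exact ha ⟨a.1.mat.col i, fun p hp => ⟨hp.1, col_ne_zero a.2.1 i, (hp.2 i).trans hle⟩⟩
  obtain ⟨I, -, hI⟩ := Set.exists_subset_bijOn {a : Yc n b | ¬ ∃ v, Vy a ⊆ Uv ε v} gram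
  refine ⟨I, hI.finite_iff_finite.2 hfin, fun a ha => ?_⟩
  obtain ⟨a', ha', h⟩ := hI.surjOn ⟨a, ha, rfl⟩
  obtain ⟨γ, rfl⟩ := exists_smul_of_gram_eq h.symm
  exact ⟨γ, ha'⟩

lemma Vy_smul_subset {b : ℤ} {ε : ℝ} {a : Yc n b} {v : Fin n ⊕ Fin n → ℤ} (h : Vy a ⊆ Uv ε v)
    (γ : symplecticGroup (Fin n) ℤ) : Vy (γ • a) ⊆ Uv ε (γ • v) := by
  intro p hp
  obtain ⟨q, hq, hpq⟩ := exists_act (toR_mem γ⁻¹.2) hp.1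
  have h1 := mem_Vy_smul hq hpq hp
  rw [inv_smul_smul] at h1
  refine mem_Uv_smul hp.1 (fun w => ?_) (h h1)
  rw [← hpq, Matrix.mulVec_mulVec, ← toR_mul]
  have h2 : γ⁻¹.1 * γ.1 = 1 := congrArg Subtype.val (inv_mul_cancel γ)
  rw [h2]
  have h3 : toR (1 : Matrix (Fin n ⊕ Fin n) (Fin n ⊕ Fin n) ℤ) = 1 := by
    ext i j
    simp [toR, Matrix.one_apply]
  rw [h3, Matrix.one_mulVec]

/-- Frames far out in the Siegel space can be replaced equivariantly by vectors. -/
theorem exists_retract (hn : 1 ≤ n) (b : ℤ) {ε : ℝ} (hε : 0 < ε) :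
    ∃ (r : Yc n b → Wc n b) (I : Set (Yc n b)), I.Finite ∧
      (∀ (γ : symplecticGroup (Fin n) ℤ) a, r (γ • a) = γ • r a) ∧
      ∀ a, (r a = Sum.inl a ∧ ∃ γ : symplecticGroup (Fin n) ℤ, γ • a ∈ I) ∨
        ∃ v, r a = Sum.inr v ∧ Vy a ⊆ Uv ε v := by
  classical
  obtain ⟨I, hI, h⟩ := exists_finite_orbits hn b hε
  obtain ⟨κ, hκ⟩ := exists_equivariant (Yc.free (n := n) (b := b))
  let r₀ : Yc n b → Wc n b := fun a =>
    if h : ∃ v, Vy a ⊆ Uv ε v then Sum.inr h.choose else Sum.inl a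
  refine ⟨fun a => κ a • r₀ ((κ a)⁻¹ • a), I, hI, fun γ a => ?_, fun a => ?_⟩
  · simp only [hκ, _root_.mul_inv_rev, mul_smul, inv_smul_smul]
  · by_cases ha : ∃ v, Vy ((κ a)⁻¹ • a) ⊆ Uv ε v
    · right
      refine ⟨κ a • ha.choose, by simp only [r₀, dif_pos ha, Sum.smul_inr], ?_⟩
      have := Vy_smul_subset ha.choose_spec (κ a)
      rwa [smul_inv_smul] at this
    · left
      refine ⟨by simp only [r₀, dif_neg ha, Sum.smul_inl, smul_inv_smul], ?_⟩
      obtain ⟨γ, hγ⟩ := h _ ha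
      exact ⟨γ * (κ a)⁻¹, by rwa [mul_smul]⟩

end SpTop

namespace SpTop

section Left

variable {A B : Type*}

/-- Extension of a cochain by zero along the left inclusion. -/
def lft (f : List A → ℚ) (l : List (A ⊕ B)) : ℚ :=
  if ∀ a ∈ l, a.isLeft then f (l.filterMap Sum.getLeft?) else 0

lemma lft_map_inl (f : List A → ℚ) (l : List A) : lft f (l.map (Sum.inl : A → A ⊕ B)) = f l := by
  rw [lft, if_pos (by simp), List.filterMap_map]
  exact congrArg f (List.filterMap_some)

lemma lft_inr {f : List A → ℚ} {l : List (A ⊕ B)} {v : B} (h : Sum.inr v ∈ l) : lft f l = 0 :=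
  if_neg fun h1 => by simpa using h1 _ h

lemma exists_map_inl {l : List (A ⊕ B)} (h : ∀ a ∈ l, a.isLeft) :
    ∃ l' : List A, l'.map Sum.inl = l := by
  rw [← Set.mem_range, Set.range_list_map]
  intro a ha
  obtain ⟨x, rfl⟩ := Sum.isLeft_iff.1 (h a ha)
  exact ⟨x, rfl⟩

lemma eq_map_inl {f : List A → ℚ} {l : List (A ⊕ B)} (h : lft f l ≠ 0) :
    ∃ l' : List A, l = l'.map Sum.inl ∧ f l' ≠ 0 := by
  have hl : ∀ a ∈ l, a.isLeft := by
    by_contra h1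
    exact h (if_neg h1)
  obtain ⟨l', rfl⟩ := exists_map_inl hl
  exact ⟨l', rfl, by rwa [lft_map_inl] at h⟩

lemma lft_alt {f : List A → ℚ} (hf : Alt f) : Alt (lft (B := B) f) := by
  intro l₁ a b l₂
  have hp : (l₁ ++ a :: b :: l₂).Perm (l₁ ++ b :: a :: l₂) :=
    List.Perm.append_left _ (List.Perm.swap _ _ _)
  by_cases h : ∀ x ∈ l₁ ++ a :: b :: l₂, x.isLeft
  · have h' : ∀ x ∈ l₁ ++ b :: a :: l₂, x.isLeft := fun x hx => h x (hp.mem_iff.2 hx)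
    rw [lft, lft, if_pos h, if_pos h']
    obtain ⟨a, rfl⟩ := Sum.isLeft_iff.1 (h a (by simp))
    obtain ⟨b, rfl⟩ := Sum.isLeft_iff.1 (h b (by simp))
    simpa using hf _ a b _
  · have h' : ¬ ∀ x ∈ l₁ ++ b :: a :: l₂, x.isLeft := fun h1 => h fun x hx => h1 x (hp.mem_iff.1 hx)
    rw [lft, lft, if_neg h, if_neg h', neg_zero]

lemma lft_smul {G : Type*} [Group G] [MulAction G A] [MulAction G B] {f : List A → ℚ} {c : G → ℚ}
    (hf : ∀ (γ : G) l, f (l.map (γ • ·)) = c γ * f l) (γ : G) (l : List (A ⊕ B)) :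
    lft f (l.map (γ • ·)) = c γ * lft f l := by
  by_cases h : ∀ x ∈ l, x.isLeft
  · obtain ⟨l, rfl⟩ := exists_map_inl h
    have h1 : (l.map (Sum.inl : A → A ⊕ B)).map (γ • ·) = (l.map (γ • ·)).map Sum.inl := by
      rw [List.map_map, List.map_map]
      rfl
    rw [h1, lft_map_inl, lft_map_inl, hf]
  · push Not at h
    obtain ⟨x, hx, hxl⟩ := h
    rcases x with x | v
    · simp at hxl
    · rw [lft_inr hx, lft_inr (v := γ • v) (List.mem_map.2 ⟨_, hx, rfl⟩), mul_zero]

end Left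

variable {n : ℕ}

lemma lft_cob {b : ℤ} {ε : ℝ} {α : List (Yc n b) → ℚ}
    (hα : ∀ l, α l ≠ 0 → ∃ a ∈ l, ∀ v, Disjoint (Vy a) (Uv ε v))
    (hc : ∀ l ∈ Ny n b, cob α l = 0) {l : List (Wc n b)} (hl : l ∈ Nh n b ε) (hne : l ≠ []) :
    cob (lft α) l = 0 := by
  obtain ⟨-, -, p, hp, hpV⟩ := hl
  by_cases h : ∃ v, Sum.inr v ∈ l
  · obtain ⟨v, hv⟩ := h
    refine cob_eq_zero fun l' hl' _ => ?_
    by_contra h1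
    obtain ⟨m, rfl, hm⟩ := eq_map_inl h1
    obtain ⟨a, ha, had⟩ := hα m hm
    exact Set.disjoint_left.1 (had v)
      (hpV _ (hl'.subset (List.mem_map_of_mem ha))) (hpV _ hv)
  · obtain ⟨m, rfl⟩ : ∃ m : List (Yc n b), m.map Sum.inl = l := by
      rw [← Set.mem_range, Set.range_list_map]
      rintro (a | v) ha
      · exact ⟨a, rfl⟩
      · exact absurd ⟨v, ha⟩ h
    rw [← cob_map]
    simp only [lft_map_inl]
    exact hc m ⟨fun _ => by simpa using hne, fun _ _ => Set.mem_univ _, p, hp, fun a ha =>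
      hpV _ (List.mem_map_of_mem ha)⟩

lemma cob_asm {A B : Type*} (r : A → B) {m : ℕ} {f g : List B → ℚ} (hg : Alt g) {l : List A}
    (hl : l.length = m + 1) (h : ∀ x : List B, x.Perm (l.map r) → cob f x = g x) :
    cob (fun x => (m.factorial : ℚ)⁻¹ * asm m f (x.map r)) l = g (l.map r) := by
  have h1 : cob (fun x => (m.factorial : ℚ)⁻¹ * asm m f (x.map r)) l =
      (m.factorial : ℚ)⁻¹ * cob (asm m f) (l.map r) := by
    rw [← cob_map]
    exact cob_smul _ _ _
  have h2 := asm_cob m f (l.map r)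
  have h3 := asm_of_alt hg (l.map r)
  rw [asm_congr h] at h2
  rw [List.length_map, hl, h2, Nat.factorial_succ] at h3
  have h4 : (m.factorial : ℚ) ≠ 0 := by exact_mod_cast m.factorial_ne_zero
  have h5 : (m + 1 : ℚ) ≠ 0 := by positivity
  rw [h1, inv_mul_eq_iff_eq_mul₀ h4]
  apply mul_left_cancel₀ h5
  rw [h3]
  push_cast
  ring

/-- Equivariant cocycles near the bottom degree are coboundaries. -/
theorem exists_row_primitive (hn : 1 ≤ n) {b : ℤ}
    (hcov : ∀ p ∈ siegel n, ∃ a : Yc n b, p ∈ Vy a) {c : Matrix.symplecticGroup (Fin n) ℤ → ℚ}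
    (hc : ∀ v v', om n ℤ v v' = 1 → ∀ γ : Matrix.symplecticGroup (Fin n) ℤ,
      γ.1 = rot v v' 0 1 → c γ ≠ -1)
    (T : List (Yc n b) → (List (Matrix.symplecticGroup (Fin n) ℤ) →₀ ℚ))
    (hT : DC (Ny n b) c 0 (n + 1) T) (hTc : dl (Ny n b) T = 0) :
    ∃ T', DC (Ny n b) c 0 n T' ∧ dl (Ny n b) T' = T := by
  classical
  obtain ⟨I₀, hI₀, hTI⟩ := hT.fin
  obtain ⟨ε, hε, hε1, hεI⟩ := exists_eps hI₀
  obtain ⟨r, I, hI, hrγ, hr⟩ := exists_retract hn b hε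
  obtain ⟨κ, hκ⟩ := exists_equivariant (Yc.free (n := n) (b := b))
  set α : List (Yc n b) → ℚ := fun l => T l [] with hα
  have hαγ : ∀ (γ : Matrix.symplecticGroup (Fin n) ℤ) l, α (l.map (γ • ·)) = c γ * α l :=
    fun γ l => hT.eqv_apply γ l []
  have hαd : ∀ l, α l ≠ 0 → ∃ a ∈ l, ∀ v, Disjoint (Vy a) (Uv ε v) := fun l hl => by
    obtain ⟨a, ha, h⟩ := hTI l fun h => hl (by simp [hα, h])
    exact ⟨a, ha, hεI a h⟩
  have hαc : ∀ l ∈ Ny n b, cob α l = 0 := fun l hl => by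
    have := dl_apply (Ny n b) T l []
    rw [hTc, dl_of_mem hl] at this
    exact this.symm
  have hαN : ∀ l, α l ≠ 0 → l ∈ Ny n b ∧ l.length = n + 1 := fun l hl => by
    have := hT.supp l fun h => hl (by simp [hα, h])
    exact ⟨this.1, by exact_mod_cast this.2⟩
  have hr' : ∀ a, Vy a ⊆ Vh ε (r a) := fun a => by
    rcases hr a with ⟨h, -⟩ | ⟨v, h, hv⟩ <;> rw [h]
    · exact subset_rfl
    · exact hv
  have hrN : ∀ l ∈ Ny n b, l.map r ∈ Nh n b ε := by
    rintro l ⟨-, -, p, hp, h⟩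
    refine ⟨False.elim, fun _ _ => Set.mem_univ _, p, hp, fun a ha => ?_⟩
    obtain ⟨a, ha', rfl⟩ := List.mem_map.1 ha
    exact hr' a (h a ha')
  obtain ⟨β, hβγ, hβK, hβ⟩ := exists_primitive (n := n) (N := Nh n b ε) (K := Kc n b) Nh_sub Nh_inv
    Kc_smul (Sum.elim κ fun _ => 1) (fun a ha γ => by
      rcases a with a | v
      · exact hκ γ a
      · exact absurd ⟨v, rfl⟩ ha) (Nh_acyclic hcov) (Kc_acyclic hε hε1)
    (lft_smul hαγ) (ev_rel_eq_zero hn hε hε1 hcov hc (lft_smul hαγ)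
      (fun l _ hl hK => by
        obtain ⟨a, l, rfl⟩ := List.exists_cons_of_length_eq_add_one hl
        obtain ⟨v, rfl⟩ := hK a (by simp)
        exact lft_inr (v := v) (by simp))
      fun l hl hlen => lft_cob hαd hαc hl fun h => by simp [h] at hlen)
  set g : List (Yc n b) → ℚ := fun l =>
    if l ∈ Ny n b ∧ l.length = n then (n.factorial : ℚ)⁻¹ * asm n β (l.map r) else 0 with hg
  have hgalt : Alt g := by
    refine Alt.ite (((asm_alt n β).map r).smul _) Alt.zero fun l l' hp h => ⟨?_, ?_⟩
    · obtain ⟨⟨h1, -, p, hp', h2⟩, -⟩ := h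
      exact ⟨fun _ h3 => h1 trivial (by rw [h3] at hp; exact hp.eq_nil),
        fun _ _ => Set.mem_univ _, p, hp',
        fun a ha => h2 a (hp.mem_iff.2 ha)⟩
    · rw [← hp.length_eq, h.2]
  have hgne : ∀ l, g l ≠ 0 → (l ∈ Ny n b ∧ l.length = n) ∧
      ∃ a ∈ l, ∃ γ : Matrix.symplecticGroup (Fin n) ℤ, γ • a ∈ I := by
    intro l hl
    have h1 : l ∈ Ny n b ∧ l.length = n := by
      by_contra h1
      exact hl (if_neg h1)
    refine ⟨h1, ?_⟩
    by_contra! h2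
    refine hl ?_
    rw [hg]
    simp only [if_pos h1]
    rw [asm_eq_zero, mul_zero]
    intro x hx
    refine hβK x fun a ha => ?_
    obtain ⟨a, ha', rfl⟩ := List.mem_map.1 (hx.mem_iff.1 ha)
    rcases hr a with ⟨-, γ, hγ⟩ | ⟨v, h, -⟩
    · exact absurd hγ (h2 a ha' γ)
    · exact ⟨v, h.symm⟩
  have hgγ : ∀ (γ : Matrix.symplecticGroup (Fin n) ℤ) l, g (l.map (γ • ·)) = c γ * g l := by
    intro γ l
    have h1 : (l.map (γ • ·)) ∈ Ny n b ↔ l ∈ Ny n b := ⟨fun h => by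
      have := Ny_smul γ⁻¹ _ h
      rw [map_smul_smul] at this
      simpa using this, Ny_smul γ l⟩
    have h2 : (l.map (γ • ·)).map r = (l.map r).map (γ • ·) := by
      rw [List.map_map, List.map_map]
      exact List.map_congr_left fun a _ => hrγ γ a
    simp only [hg, h1, List.length_map, h2]
    rw [← asm_map, asm_congr (g := fun x => c γ * β x) fun x _ => hβγ γ x, asm_smul]
    split_ifs
    · ring
    · simp
  have hgc : ∀ l ∈ Ny n b, cob g l = α l := by
    intro l hl
    by_cases hlen : l.length = n + 1
    · have h1 : cob g l = cob (fun x => (n.factorial : ℚ)⁻¹ * asm n β (x.map r)) l := by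
        refine cob_congr fun l' hl' hll =>
          if_pos ⟨⟨fun _ h => ?_, fun _ _ => Set.mem_univ _, ?_⟩, ?_⟩
        · rw [h] at hll
          simp at hll
          omega
        · obtain ⟨-, -, p, hp, h⟩ := hl
          exact ⟨p, hp, fun a ha => h a (hl'.subset ha)⟩
        · omega
      rw [h1, cob_asm r (lft_alt (hT.alt [])) hlen fun x hx => ?_]
      · by_cases h2 : ∃ v, Sum.inr v ∈ l.map r
        · obtain ⟨v, hv⟩ := h2
          rw [lft_inr hv]
          by_contra h3
          obtain ⟨a, ha, had⟩ := hαd l (Ne.symm h3)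
          obtain ⟨-, -, p, hp, h⟩ := hl
          obtain ⟨a', ha', hav⟩ := List.mem_map.1 hv
          refine Set.disjoint_left.1 (had v) (h a ha) ?_
          have := hr' a' (h a' ha')
          rwa [hav] at this
        · rw [show l.map r = l.map Sum.inl from List.map_congr_left fun a ha => ?_, lft_map_inl]
          rcases hr a with ⟨h, -⟩ | ⟨v, h, -⟩
          · exact h
          · exact absurd ⟨v, h ▸ List.mem_map_of_mem ha⟩ h2
      · refine hβ x (Nh_sub _ (hrN l hl) x fun a ha => hx.mem_iff.1 ha) ?_
        rw [hx.length_eq, List.length_map, hlen]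
    · rw [cob_eq_zero fun l' _ hll => ?_]
      · by_contra h
        exact hlen (hαN l (Ne.symm h)).2
      · by_contra h
        have := (hgne l' h).1.2
        omega
  refine ⟨fun l => Finsupp.single [] (g l), ⟨fun l hl => ?_, fun x => ?_, fun l x h => ?_,
    fun γ l => ?_, I, hI, fun l hl => ?_⟩, ?_⟩
  · have := (hgne l fun h => hl (by simp [h])).1
    exact ⟨this.1, by rw [this.2]⟩
  · by_cases hx : [] = x
    · simpa [hx, Finsupp.single_apply] using hgalt
    · simp only [Finsupp.single_apply, if_neg hx]
      exact Alt.zero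
  · by_contra hx
    have : [] ≠ x := fun h' => hx (by rw [← h']; rfl)
    exact h (Finsupp.single_eq_of_ne' this)
  · simp [hgγ]
  · exact (hgne l fun h => hl (by simp [h])).2
  · funext l
    by_cases hl : l ∈ Ny n b
    · ext x
      rw [dl_apply, dl_of_mem hl, cobV_eq_cob]
      by_cases hx : [] = x
      · subst hx
        simpa using hgc l hl
      · have h0 : T l x = 0 := by
          by_contra h
          exact hx (List.length_eq_zero_iff.1 (hT.len l x h)).symm
        rw [h0]
        exact cob_eq_zero fun l' _ _ => Finsupp.single_eq_of_ne' hx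
    · rw [dl_of_notMem hl]
      by_contra h
      exact hl (hT.supp l (Ne.symm h)).1

end SpTop

namespace SpTop

open Matrix

section BarComplex

variable {G : Type*} [Group G]

lemma cob_ofFn {A : Type*} {m : ℕ} (φ : List A → ℚ) (a : Fin (m + 1) → A) :
    cob φ (List.ofFn a) = ∑ p : Fin (m + 1), (-1) ^ (p : ℕ) * φ (List.ofFn (a ∘ p.succAbove)) := by
  induction m generalizing φ with
  | zero => simp [cob_cons, Function.comp_def]
  | succ m ih =>
    rw [List.ofFn_succ, cob_cons, ih, Fin.sum_univ_succ (n := m + 1), sub_eq_add_neg,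
      ← Finset.sum_neg_distrib]
    congr 1
    · simp [Function.comp_def]
    · refine Finset.sum_congr rfl fun p _ => ?_
      rw [List.ofFn_succ (f := a ∘ p.succ.succAbove)]
      simp [Function.comp_def, pow_succ]

/-- The homogeneous chain with initial vertex `1` attached to an inhomogeneous one. -/
def barList {m : ℕ} (x : Fin m → G) : List G := List.ofFn (Fin.partialProd x)

/-- The boundary of an inhomogeneous chain with trivial coefficients. -/
noncomputable def barBd (m : ℕ) : ((Fin (m + 1) → G) →₀ ℚ) →ₗ[ℚ] ((Fin m → G) →₀ ℚ) :=
  Finsupp.linearCombination ℚ fun x => Finsupp.single (Fin.tail x) 1 +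
    ∑ j : Fin (m + 1), (-1 : ℚ) ^ ((j : ℕ) + 1) • Finsupp.single (j.contractNth (· * ·) x) 1

lemma linearCombination_barBd {m : ℕ} (h : (Fin m → G) → ℚ) (x : Fin (m + 1) → G) :
    Finsupp.linearCombination ℚ h (barBd m (Finsupp.single x 1)) = h (Fin.tail x) +
      ∑ j : Fin (m + 1), (-1 : ℚ) ^ ((j : ℕ) + 1) * h (j.contractNth (· * ·) x) := by
  simp [barBd, map_sum]

lemma cob_barList {m : ℕ} {ψ : List G → ℚ} (hψ : ∀ (γ : G) x, ψ (x.map (γ * ·)) = ψ x)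
    (x : Fin (m + 1) → G) : cob ψ (barList x) =
      Finsupp.linearCombination ℚ (fun y => ψ (barList y)) (barBd m (Finsupp.single x 1)) := by
  rw [linearCombination_barBd, barList, cob_ofFn, Fin.sum_univ_succ]
  congr 1
  · rw [← hψ (x 0) (barList (Fin.tail x)), barList, List.map_ofFn]
    simp only [Fin.val_zero, pow_zero, one_mul]
    congr 2
    funext j
    exact Fin.partialProd_succ' x j
  · refine Finset.sum_congr rfl fun j _ => ?_
    rw [barList, Fin.partialProd_contractNth, Fin.val_succ]

/-- The homogeneous cochain attached to an inhomogeneous one. -/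
noncomputable def homCochain {m : ℕ} (f : (Fin m → G) → ℚ) (l : List G) : ℚ :=
  if h : l.length = m + 1 then
    f fun j => (l.get (Fin.cast h.symm j.castSucc))⁻¹ * l.get (Fin.cast h.symm j.succ)
  else 0

lemma homCochain_map {m : ℕ} (f : (Fin m → G) → ℚ) (γ : G) (l : List G) :
    homCochain f (l.map (γ * ·)) = homCochain f l := by
  by_cases h : l.length = m + 1
  · rw [homCochain, homCochain, dif_pos (by simpa using h), dif_pos h]
    congr 1
    funext j
    simp [mul_assoc]
  · rw [homCochain, homCochain, dif_neg (by simpa using h), dif_neg h]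

lemma homCochain_barList {m : ℕ} (f : (Fin m → G) → ℚ) (x : Fin m → G) :
    homCochain f (barList x) = f x := by
  rw [homCochain, dif_pos (by simp [barList])]
  congr 1
  funext j
  simp only [barList, List.get_ofFn]
  exact Fin.partialProd_right_inv x j

lemma exists_eq_map_barList {m : ℕ} {l : List G} (hl : l.length = m + 1) :
    ∃ (γ : G) (x : Fin m → G), l = (barList x).map (γ * ·) := by
  obtain ⟨a, rfl⟩ : ∃ a : Fin (m + 1) → G, l = List.ofFn a :=
    ⟨fun j => l.get (Fin.cast hl.symm j), by
      refine List.ext_get (by simp [hl]) fun j _ _ => ?_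
      rw [List.get_ofFn]
      rfl⟩
  refine ⟨a 0, fun j => (a j.castSucc)⁻¹ * a j.succ, ?_⟩
  rw [barList, List.map_ofFn]
  congr 1
  exact (Fin.partialProd_left_inv a).symm

lemma ev_mapDomain_barList {m : ℕ} (φ : List G → ℚ) (y : (Fin m → G) →₀ ℚ) :
    ev φ (y.mapDomain barList) = Finsupp.linearCombination ℚ (fun x => φ (barList x)) y := by
  rw [ev, Finsupp.linearCombination_mapDomain]
  rfl

/-- A cochain vanishing on the cycles is a coboundary. -/
lemma exists_primitive_of_ker {m : ℕ} {f : (Fin (m + 1) → G) → ℚ}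
    (hf : ∀ y, barBd m y = 0 → Finsupp.linearCombination ℚ f y = 0) :
    ∃ h : (Fin m → G) → ℚ,
      ∀ x, f x = Finsupp.linearCombination ℚ h (barBd m (Finsupp.single x 1)) := by
  have hmem : Finsupp.linearCombination ℚ f ∈ LinearMap.range (barBd (G := G) m).dualMap := by
    rw [LinearMap.range_dualMap_eq_dualAnnihilator_ker, Submodule.mem_dualAnnihilator]
    exact fun y hy => hf y hy
  obtain ⟨F, hF⟩ := hmem
  refine ⟨fun y => F (Finsupp.single y 1), fun x => ?_⟩
  have h1 : Finsupp.linearCombination ℚ (fun y => F (Finsupp.single y 1)) = F := by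
    ext y
    simp
  rw [h1, ← LinearMap.dualMap_apply, hF]
  simp

end BarComplex

section GroupCohomology

open CategoryTheory

lemma d_trivial_apply {G : Type} [Group G] (m : ℕ) (f : (Fin m → G) → ℚ) (x : Fin (m + 1) → G) :
    inhomogeneousCochains.d (Rep.trivial ℚ G ℚ) m f x =
      Finsupp.linearCombination ℚ f (barBd m (Finsupp.single x 1)) := by
  rw [linearCombination_barBd, inhomogeneousCochains.d_hom_apply]
  rfl

lemma subsingleton_groupCohomology {G : Type} [Group G] (m : ℕ)
    (H : ∀ f : (Fin (m + 1) → G) → ℚ, inhomogeneousCochains.d (Rep.trivial ℚ G ℚ) (m + 1) f = 0 →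
      ∃ h : (Fin m → G) → ℚ, inhomogeneousCochains.d (Rep.trivial ℚ G ℚ) m h = f) :
    Subsingleton (groupCohomology (Rep.trivial ℚ G ℚ) (m + 1)) := by
  refine subsingleton_of_forall_eq 0 fun c => ?_
  induction c using groupCohomology_induction_on with
  | h x =>
    let A := Rep.trivial ℚ G ℚ
    have hx : inhomogeneousCochains.d A (m + 1) (groupCohomology.iCocycles A (m + 1) x) = 0 := by
      rw [← groupCohomology.inhomogeneousCochains.d_def, ← ConcreteCategory.comp_apply,
        HomologicalComplex.iCycles_d]
      rfl
    obtain ⟨h, hh⟩ := H _ hx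
    have h2 : x = groupCohomology.toCocycles A m (m + 1) h := by
      apply (ModuleCat.mono_iff_injective (groupCohomology.iCocycles A (m + 1))).1 inferInstance
      rw [← ConcreteCategory.comp_apply (groupCohomology.toCocycles A m (m + 1)),
        HomologicalComplex.toCycles_i, groupCohomology.inhomogeneousCochains.d_def]
      exact hh.symm
    have h3 : groupCohomology.toCocycles A m (m + 1) ≫ groupCohomology.π A (m + 1) = 0 :=
      HomologicalComplex.toCycles_comp_homologyπ _ _ _
    rw [h2, ← ConcreteCategory.comp_apply, h3]
    rfl

end GroupCohomology

lemma linearCombination_eq_zero_of_barBd_eq_zero {n i : ℕ} (hn : 1 ≤ n) (hi : n ^ 2 = i + 1)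
    {f : (Fin (i + 1) → symplecticGroup (Fin n) ℤ) → ℚ}
    (hf : ∀ x, Finsupp.linearCombination ℚ f (barBd (i + 1) (Finsupp.single x 1)) = 0)
    (y : (Fin (i + 1) → symplecticGroup (Fin n) ℤ) →₀ ℚ) (hy : barBd i y = 0) :
    Finsupp.linearCombination ℚ f y = 0 := by
  classical
  obtain ⟨b, u, c, S, hcov, hc⟩ := exists_sys hn
  have key := ev_eq_zero_of_sys S n i (by rw [hi])
    (fun T hT hTc => exists_row_primitive hn hcov hc T hT hTc) (y.mapDomain barList)
    (fun x hx => ?_) (fun φ hφ => ?_) (homCochain f) (homCochain_map f) (fun x hx => ?_)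
  · rw [ev_mapDomain_barList] at key
    simpa only [homCochain_barList] using key
  · obtain ⟨x', -, rfl⟩ := Finset.mem_image.1
      (Finsupp.mapDomain_support (Finsupp.mem_support_iff.2 hx))
    exact ⟨List.ofFn fun j => Fin.partialProd x' j.succ, by simp [barList, List.ofFn_succ],
      by simp⟩
  · rw [ev_bd, ev_mapDomain_barList]
    have h1 : Finsupp.linearCombination ℚ (fun x => cob φ (barList x)) =
        (Finsupp.linearCombination ℚ fun x => φ (barList x)) ∘ₗ
          barBd (G := symplecticGroup (Fin n) ℤ) i := by
      ext x
      simp [cob_barList hφ]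
    rw [h1, LinearMap.comp_apply, hy, map_zero]
  · obtain ⟨γ, x', rfl⟩ := exists_eq_map_barList hx
    rw [← cob_map]
    simp only [homCochain_map]
    rw [cob_barList (homCochain_map f)]
    simpa only [homCochain_barList] using hf x'

end SpTop

/-- **Gunnells; Brück–Patzt–Sroka.** For every `n ≥ 1`, the rational group cohomology of
`Sp_{2n}(ℤ)` vanishes in its virtual cohomological dimension `n²`. -/
theorem sp2n_z_top_cohomology_vanishes (n : ℕ) (hn : 1 ≤ n) :
    Subsingleton
      (groupCohomology (Rep.trivial ℚ (↥(Matrix.symplecticGroup (Fin n) ℤ)) ℚ)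
        (n ^ 2)) := by
  obtain ⟨i, hi⟩ : ∃ i, n ^ 2 = i + 1 := ⟨n ^ 2 - 1, (Nat.sub_add_cancel (Nat.pow_pos hn)).symm⟩
  rw [hi]
  refine SpTop.subsingleton_groupCohomology i fun f hf => ?_
  obtain ⟨h, hh⟩ := SpTop.exists_primitive_of_ker (f := f)
    (SpTop.linearCombination_eq_zero_of_barBd_eq_zero hn hi fun x => by
      rw [← SpTop.d_trivial_apply, hf]
      rfl)
  exact ⟨h, funext fun x => by rw [hh x, SpTop.d_trivial_apply]⟩
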